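/- arXiv:2201.08037 — 2 statements merged into one kernel-verified Lean document; each statement's English description precedes it below -/
import Mathlib

section
/- Let F = ℝ or F = 𝔽_p, and let 𝓛 ⊆ Aff(F), viewed as a subset of F*×F, be a finite set such that no line in F*×F contains more than M(𝓛) points of 𝓛, no vertical line in F*×F contains more than m(𝓛) points of 𝓛, and (in the case F = 𝔽_p) m(𝓛)·|𝓛| ≤ p². Then E(𝓛) ≪ m(𝓛)^{1/2}|𝓛|^{5/2} + M(𝓛)|𝓛|², where E(𝓛) = T₂(𝓛) = |{(l₁,l₂,l₃,l₄) ∈ 𝓛⁴ : l₁l₂^{−1} = l₃l₄^{−1} in Aff(F)}| is the energy of 𝓛 in the affine group. -/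
open scoped Classical Pointwise

noncomputable section

/-- Number of collinear `k`-tuples of points of `A × B`. -/
def Ctuples (F : Type*) [Field F] (k : ℕ) (A B : Finset F) : ℕ :=
  ((Fintype.piFinset fun _ : Fin k => A ×ˢ B).filter fun f => Collinear F (Set.range f)).card

/-- Additive energy of two finite sets. -/
def addE (F : Type*) [Field F] (A B : Finset F) : ℕ :=
  (((A ×ˢ A) ×ˢ B ×ˢ B).filter fun q => q.1.1 - q.2.1 = q.1.2 - q.2.2).card

/-- Multiplicative energy of two finite sets. -/
def mulE (F : Type*) [Field F] (A B : Finset F) : ℕ :=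
  (((A ×ˢ A) ×ˢ B ×ˢ B).filter fun q => q.1.1 * q.2.2 = q.1.2 * q.2.1).card

/-- `max_s E^×(A - s)`. -/
def mulEbar (F : Type*) [Field F] (A : Finset F) : ℕ :=
  ⨆ s : F, mulE F (A.image fun a => a - s) (A.image fun a => a - s)

def repSub (F : Type*) [Field F] (A B : Finset F) (x : F) : ℕ :=
  ((A ×ˢ B).filter fun q => q.1 - q.2 = x).card

def addEk (F : Type*) [Field F] (k : ℕ) (A : Finset F) : ℕ :=
  ∑ x ∈ A - A, repSub F A A x ^ k

def repDiv (F : Type*) [Field F] (A B : Finset F) (x : F) : ℕ :=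
  ((A ×ˢ B).filter fun q => q.2 ≠ 0 ∧ q.1 / q.2 = x).card

def mulEk (F : Type*) [Field F] (k : ℕ) (A : Finset F) : ℕ :=
  ∑ x ∈ A / A, repDiv F A A x ^ k

def mulEkbar (F : Type*) [Field F] (k : ℕ) (A : Finset F) : ℕ :=
  ⨆ s : F, mulEk F k (A.image fun a => a - s)

/-- Number of points of `A × B` on the graph of `x ↦ l.1 * x + l.2`. -/
def nPts {F : Type*} [Field F] (A B : Finset F) (l : F × F) : ℕ :=
  ((A ×ˢ B).filter fun q => q.2 = l.1 * q.1 + l.2).card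

/-- τ-rich lines of `𝓛`. -/
def Lrich {F : Type*} [Field F] (A B : Finset F) (L : Finset (F × F)) (τ : ℝ) : Finset (F × F) :=
  L.filter fun l => τ ≤ (nPts A B l : ℝ)

def affMap {F : Type*} [Field F] (l : F × F) : F → F := fun x => l.1 * x + l.2

def affInv {F : Type*} [Field F] (l : F × F) : F → F := fun x => (x - l.2) / l.1

/-- alternating product `l₁ ∘ l₂⁻¹ ∘ l₃ ∘ l₄⁻¹ ∘ ⋯` in the affine group. -/
def altAff {F : Type*} [Field F] {k : ℕ} (a : Fin k → F × F) : F → F :=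
  (List.ofFn fun i : Fin k => if (i : ℕ) % 2 = 0 then affMap (a i) else affInv (a i)).foldr
    (· ∘ ·) id

def TaffSet {F : Type*} [Field F] (k : ℕ) (L : Finset (F × F)) : ℕ :=
  (((Fintype.piFinset fun _ : Fin k => L) ×ˢ Fintype.piFinset fun _ : Fin k => L).filter
    fun q => altAff q.1 = altAff q.2).card

def affEnergy {F : Type*} [Field F] (L : Finset (F × F)) : ℕ :=
  (((L ×ˢ L) ×ˢ L ×ˢ L).filter fun q =>
    affMap q.1.1 ∘ affInv q.1.2 = affMap q.2.1 ∘ affInv q.2.2).card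

/-- incidences between `A × B` and the graphs of the maps in `L`. -/
def nInc {F : Type*} [Field F] (A B : Finset F) (L : Finset (F × F)) : ℕ :=
  (((A ×ˢ B) ×ˢ L).filter fun q => q.1.2 = q.2.1 * q.1.1 + q.2.2).card

/-- balanced function of `A ⊆ 𝔽_p`. -/
def balanced {p : ℕ} [NeZero p] (A : Finset (ZMod p)) : ZMod p → ℝ :=
  fun x => (if x ∈ A then 1 else 0) - (A.card : ℝ) / p

def addEfun {p : ℕ} [NeZero p] (f : ZMod p → ℝ) : ℝ :=
  ∑ x, ∑ y, ∑ z, ∑ w, if x - y = z - w then f x * f y * f z * f w else 0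

def mulEfun {p : ℕ} [NeZero p] (f : ZMod p → ℝ) : ℝ :=
  ∑ x, ∑ y, ∑ z, ∑ w, if x * w = z * y then f x * f y * f z * f w else 0

def mulEbarFun {p : ℕ} [NeZero p] (f : ZMod p → ℝ) : ℝ :=
  ⨆ s : ZMod p, mulEfun fun x => f (x + s)

/-- a line in the plane: `inl (a,b)` is `y = a x + b`, `inr c` is `x = c`. -/
def onLine {F : Type*} [Field F] (l : (F × F) ⊕ F) (q : F × F) : Prop :=
  match l with
  | .inl ab => q.2 = ab.1 * q.1 + ab.2
  | .inr c => q.1 = c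

def iLine {F : Type*} [Field F] (A B : Finset F) (l : (F × F) ⊕ F) : ℕ :=
  ((A ×ˢ B).filter fun q => onLine l q).card

def altSum {M : Type*} [AddCommGroup M] {k : ℕ} (x : Fin k → M) : M :=
  ∑ i : Fin k, if (i : ℕ) % 2 = 0 then x i else -x i

def TaddSet {M : Type*} [AddCommGroup M] (k : ℕ) (A : Finset M) : ℕ :=
  (((Fintype.piFinset fun _ : Fin k => A) ×ˢ Fintype.piFinset fun _ : Fin k => A).filter
    fun q => altSum q.1 = altSum q.2).card

def TaddFun {p : ℕ} [NeZero p] (k : ℕ) (f : ZMod p → ℝ) : ℝ :=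
  ∑ x : Fin k → ZMod p, ∑ y : Fin k → ZMod p,
    if altSum x = altSum y then (∏ i, f (x i)) * ∏ i, f (y i) else 0

def TaffFun {p : ℕ} [Fact p.Prime] (k : ℕ) (f : ZMod p × ZMod p → ℝ) : ℝ :=
  ∑ a ∈ Fintype.piFinset fun _ : Fin k => (Finset.univ.filter fun l : ZMod p × ZMod p => l.1 ≠ 0),
    ∑ b ∈ Fintype.piFinset fun _ : Fin k => (Finset.univ.filter fun l : ZMod p × ZMod p => l.1 ≠ 0),
      if altAff a = altAff b then (∏ i, f (a i)) * ∏ i, f (b i) else 0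

/-- `Ẽ^×_k (X, Y)`. -/
def tmulEk (F : Type*) [Field F] (k : ℕ) (X Y : Finset F) : ℕ :=
  (((Fintype.piFinset fun _ : Fin k => X.erase 0) ×ˢ
      Fintype.piFinset fun _ : Fin k => Y.erase 0).filter
    fun q => ∀ i j : Fin k, q.1 i * q.2 j = q.1 j * q.2 i).card

def addEkG {G : Type*} [AddCommGroup G] (k : ℕ) (A : Finset G) : ℕ :=
  ∑ x ∈ A - A, (((A ×ˢ A).filter fun q => q.1 - q.2 = x).card) ^ k

end

namespace AffineEnergy

section

open MvPolynomial

variable {K : Type*} [Field K]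

theorem card_le_degreeOf_zero {r : MvPolynomial (Fin 2) K} (hr : r ≠ 0) (S : Finset K)
    (h : ∀ x ∈ S, aeval ![Polynomial.C x, Polynomial.X] r = 0) : S.card ≤ degreeOf 0 r := by
  have hr' : finSuccEquiv K 1 r ≠ 0 := by simpa using hr
  have hroot : ∀ x ∈ S, (finSuccEquiv K 1 r).IsRoot (C x) := by
    intro x hx
    let e : MvPolynomial (Fin 1) K →ₐ[K] Polynomial K := aeval ![Polynomial.X]
    have he : Function.Injective e := by
      have : e = (aeval fun _ => Polynomial.X) := by
        apply MvPolynomial.algHom_ext; intro i; fin_cases i; simp [e]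
      rw [this]
      exact (MvPolynomial.uniqueAlgEquiv K (Fin 1)).injective
    apply he
    rw [map_zero, ← h x hx]
    have : (e.toRingHom.comp ((Polynomial.evalRingHom (C x)).comp
        (finSuccEquiv K 1).toRingEquiv.toRingHom)) =
        (aeval ![Polynomial.C x, Polynomial.X] : _ →ₐ[K] Polynomial K).toRingHom := by
      apply MvPolynomial.ringHom_ext
      · intro a; simp [e, Polynomial.algebraMap_eq, finSuccEquiv_apply]
      · intro i
        refine Fin.cases ?_ (fun j => ?_) i
        · simp [e, finSuccEquiv_X_zero]
        · have h1 : finSuccEquiv K 1 (X 1) = Polynomial.C (X 0) := finSuccEquiv_X_succ (j := 0)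
          simp [e, h1, Fin.fin_one_eq_zero j]
    exact congrArg (fun f => f r) this
  rw [← natDegree_finSuccEquiv]
  have hsub : (S.image (C : K → MvPolynomial (Fin 1) K)) ⊆ (finSuccEquiv K 1 r).roots.toFinset := by
    intro z hz
    obtain ⟨x, hx, rfl⟩ := Finset.mem_image.1 hz
    simpa [hr'] using hroot x hx
  calc S.card = (S.image (C : K → MvPolynomial (Fin 1) K)).card :=
        (Finset.card_image_of_injective _ (C_injective _ _)).symm
    _ ≤ _ := Finset.card_le_card hsub
    _ ≤ _ := Multiset.toFinset_card_le _
    _ ≤ _ := Polynomial.card_roots' _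

theorem finSuccEquiv_symm_C {n : ℕ} (r : MvPolynomial (Fin n) K) :
    (finSuccEquiv K n).symm (Polynomial.C r) = rename Fin.succ r := by
  rw [AlgEquiv.symm_apply_eq]
  induction r using MvPolynomial.induction_on with
  | C a => simp [finSuccEquiv_apply]
  | add p q hp hq => simp only [map_add, hp, hq]
  | mul_X p i hp => simp only [map_mul, hp, rename_X, finSuccEquiv_X_succ]

theorem exists_eliminant {g h : MvPolynomial (Fin 3) K} (hg : Irreducible g)
    (hz : 0 < degreeOf 0 g) (hgh : ¬ g ∣ h) :
    ∃ r : MvPolynomial (Fin 2) K, r ≠ 0 ∧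
      degreeOf 0 r ≤ degreeOf 0 g * degreeOf 1 h + degreeOf 0 h * degreeOf 1 g ∧
      ∃ u v, g * u + h * v = rename Fin.succ r := by
  set R := MvPolynomial (Fin 2) K
  set e := finSuccEquiv K 2
  have hG : Irreducible (e g) := (MulEquiv.irreducible_iff e.toMulEquiv).2 hg
  have hdeg : (e g).natDegree = degreeOf 0 g := natDegree_finSuccEquiv g
  have hdegh : (e h).natDegree = degreeOf 0 h := natDegree_finSuccEquiv h
  have hprim : (e g).IsPrimitive := hG.isPrimitive (by omega)
  have hirr := (hprim.irreducible_iff_irreducible_map_fraction_map (K := FractionRing R)).1 hG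
  have hnd : ¬ (e g).map (algebraMap R (FractionRing R)) ∣
      (e h).map (algebraMap R (FractionRing R)) := by
    intro H
    exact hgh ((map_dvd_iff e).1 (hprim.dvd_of_fraction_map_dvd_fraction_map H))
  have hcop := (hirr.coprime_iff_not_dvd).2 hnd
  have hres : Polynomial.resultant (e g) (e h) ≠ 0 := by
    intro H
    have h1 := Polynomial.resultant_map_map (e g) (e h) (e g).natDegree (e h).natDegree
      (algebraMap R (FractionRing R))
    rw [H, map_zero] at h1
    rw [← Polynomial.natDegree_map_eq_of_injective (IsFractionRing.injective R (FractionRing R))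
      (e g), ← Polynomial.natDegree_map_eq_of_injective
      (IsFractionRing.injective R (FractionRing R)) (e h)] at h1
    exact (Polynomial.resultant_eq_zero_iff.1 h1).2 hcop
  obtain ⟨p, q, -, -, hpq⟩ := Polynomial.exists_mul_add_mul_eq_C_resultant (e g) (e h) le_rfl le_rfl
    (Or.inl (by omega))
  refine ⟨_, hres, ?_, e.symm p, e.symm q, ?_⟩
  · rw [Polynomial.resultant, Matrix.det_apply]
    refine (degreeOf_sum_le _ _ _).trans (Finset.sup_le fun σ _ => ?_)
    have hs : ∀ a : R, degreeOf 0 (Equiv.Perm.sign σ • a) ≤ degreeOf 0 a := by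
      intro a
      rcases Int.units_eq_one_or (Equiv.Perm.sign σ) with h | h
      · simp [h]
      · rw [h, Units.neg_smul, one_smul]
        exact (degreeOf_neg _ _).le
    refine (hs _).trans ((degreeOf_prod_le _ _ _).trans ?_)
    rw [← hdeg, ← hdegh, Fin.sum_univ_add]
    have hc : ∀ (f : MvPolynomial (Fin 3) K) i, degreeOf 0 ((e f).coeff i) ≤ degreeOf 1 f :=
      fun f i => degreeOf_coeff_finSuccEquiv f 0 i
    refine add_le_add ?_ ?_
    · refine (Finset.sum_le_card_nsmul _ _ (degreeOf 1 h) ?_).trans (by simp)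
      intro i _
      simp only [Polynomial.sylvester, Matrix.of_apply, Fin.addCases_left]
      split_ifs
      · exact hc _ _
      · simp
    · refine (Finset.sum_le_card_nsmul _ _ (degreeOf 1 g) ?_).trans (by simp)
      intro i _
      simp only [Polynomial.sylvester, Matrix.of_apply, Fin.addCases_right]
      split_ifs
      · exact hc _ _
      · simp
  · rw [← finSuccEquiv_symm_C, ← hpq]
    simp [e]

/-- Restriction to the line `z = α + β y` in the plane at abscissa `x`. -/
noncomputable def evA (x α β : K) : MvPolynomial (Fin 3) K →ₐ[K] Polynomial K :=
  aeval ![Polynomial.C α + Polynomial.C β * Polynomial.X, Polynomial.C x, Polynomial.X]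

/-- Restriction to the line `z = γ + δ x` in the plane at ordinate `y`. -/
noncomputable def evB (y γ δ : K) : MvPolynomial (Fin 3) K →ₐ[K] Polynomial K :=
  aeval ![Polynomial.C γ + Polynomial.C δ * Polynomial.X, Polynomial.X, Polynomial.C y]

theorem evA_rename (x α β : K) (r : MvPolynomial (Fin 2) K) :
    evA x α β (rename Fin.succ r) = aeval ![Polynomial.C x, Polynomial.X] r := by
  rw [evA, aeval_rename]
  congr 2

theorem eval_evA_eq_eval_evB {x α β y γ δ : K} (h : α + β * y = γ + δ * x)
    (f : MvPolynomial (Fin 3) K) : (evA x α β f).eval y = (evB y γ δ f).eval x := by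
  have : ((Polynomial.evalRingHom y).comp (evA x α β).toRingHom) =
      ((Polynomial.evalRingHom x).comp (evB y γ δ).toRingHom) := by
    apply MvPolynomial.ringHom_ext
    · intro a; simp
    · intro i
      fin_cases i <;> simp [evA, evB, h]
  exact congrArg (fun φ => φ f) this

theorem natDegree_aeval_le {S : Type*} [CommRing S] [Algebra K S] (v : Fin 3 → Polynomial S)
    (c : Fin 3 → ℕ) (hv : ∀ i, (v i).natDegree ≤ c i) (f : MvPolynomial (Fin 3) K) :
    (aeval v f).natDegree ≤ ∑ i, degreeOf i f * c i := by
  rw [aeval_def, eval₂_eq']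
  refine Polynomial.natDegree_sum_le_of_forall_le _ _ fun m hm => ?_
  refine Polynomial.natDegree_mul_le.trans ?_
  have h0 : (algebraMap K (Polynomial S) (coeff m f)).natDegree = 0 := by
    rw [Polynomial.algebraMap_apply, Polynomial.natDegree_C]
  rw [h0, zero_add]
  refine (Polynomial.natDegree_prod_le _ _).trans (Finset.sum_le_sum fun i _ => ?_)
  refine Polynomial.natDegree_pow_le.trans (Nat.mul_le_mul ?_ (hv i))
  exact monomial_le_degreeOf i hm

theorem natDegree_evA_le (x α β : K) (f : MvPolynomial (Fin 3) K) :
    (evA x α β f).natDegree ≤ degreeOf 2 f + degreeOf 0 f := by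
  refine (natDegree_aeval_le _ ![1, 0, 1] ?_ f).trans ?_
  · intro i; fin_cases i
    · simp; compute_degree
    · simp
    · simp
  · simp [Fin.sum_univ_three]; omega

theorem natDegree_evB_le (y γ δ : K) (f : MvPolynomial (Fin 3) K) :
    (evB y γ δ f).natDegree ≤ degreeOf 1 f + degreeOf 0 f := by
  refine (natDegree_aeval_le _ ![1, 1, 0] ?_ f).trans ?_
  · intro i; fin_cases i
    · simp; compute_degree
    · simp
    · simp
  · simp [Fin.sum_univ_three]; omega

/-- Lines over distinct abscissae contained in two surfaces without common component. -/
theorem card_common_lines_le {g h : MvPolynomial (Fin 3) K} (hg : Irreducible g)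
    (hz : 0 < degreeOf 0 g) (hgh : ¬ g ∣ h) {ι : Type*} (S : Finset ι) (x α β : ι → K)
    (hx : Function.Injective x)
    (hSg : ∀ i ∈ S, evA (x i) (α i) (β i) g = 0) (hSh : ∀ i ∈ S, evA (x i) (α i) (β i) h = 0) :
    S.card ≤ degreeOf 0 g * degreeOf 1 h + degreeOf 0 h * degreeOf 1 g := by
  obtain ⟨r, hr, hd, u, v, huv⟩ := exists_eliminant hg hz hgh
  refine le_trans ?_ hd
  rw [← Finset.card_image_of_injective S hx]
  refine card_le_degreeOf_zero hr _ fun z hz => ?_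
  obtain ⟨i, hi, rfl⟩ := Finset.mem_image.1 hz
  rw [← evA_rename (x i) (α i) (β i), ← huv]
  simp [hSg i hi, hSh i hi]

/-- Lines over distinct abscissae contained in a surface independent of `z`. -/
theorem card_lines_le_of_degreeOf_zero {g : MvPolynomial (Fin 3) K} (hg : g ≠ 0)
    (hz : degreeOf 0 g = 0) {ι : Type*} (S : Finset ι) (x α β : ι → K)
    (hx : Function.Injective x) (hSg : ∀ i ∈ S, evA (x i) (α i) (β i) g = 0) :
    S.card ≤ degreeOf 1 g := by
  obtain ⟨r, hr⟩ : ∃ r, finSuccEquiv K 2 g = Polynomial.C r :=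
    ⟨_, Polynomial.eq_C_of_natDegree_eq_zero (by rw [natDegree_finSuccEquiv, hz])⟩
  have hgr : g = rename Fin.succ r := by
    rw [← finSuccEquiv_symm_C, ← hr, AlgEquiv.symm_apply_apply]
  have hr0 : r ≠ 0 := by rintro rfl; simp at hgr; exact hg hgr
  have hd : degreeOf 0 r ≤ degreeOf 1 g := by
    have := degreeOf_coeff_finSuccEquiv g 0 0
    rwa [hr, Polynomial.coeff_C_zero] at this
  refine le_trans ?_ hd
  rw [← Finset.card_image_of_injective S hx]
  refine card_le_degreeOf_zero hr0 _ fun z hz => ?_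
  obtain ⟨i, hi, rfl⟩ := Finset.mem_image.1 hz
  rw [← evA_rename (x i) (α i) (β i), ← hgr]
  exact hSg i hi

theorem degreeOf_pderiv_le {σ : Type*} (i j : σ) (p : MvPolynomial σ K) :
    degreeOf j (pderiv i p) ≤ degreeOf j p := by
  rw [degreeOf_le_iff]
  intro m hm
  rw [mem_support_iff, coeff_pderiv] at hm
  have h := monomial_le_degreeOf j (mem_support_iff.2 (left_ne_zero_of_mul hm))
  exact le_trans (by simp) h

theorem degreeOf_pderiv_lt {σ : Type*} {i : σ} {p : MvPolynomial σ K} (hp : 0 < degreeOf i p) :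
    degreeOf i (pderiv i p) < degreeOf i p := by
  rw [degreeOf_lt_iff hp]
  intro m hm
  rw [mem_support_iff, coeff_pderiv] at hm
  have h := monomial_le_degreeOf i (mem_support_iff.2 (left_ne_zero_of_mul hm))
  simpa [Nat.succ_le_iff] using h

theorem pderiv_ne_zero {σ : Type*} {i : σ} {p : MvPolynomial σ K} (hp : 0 < degreeOf i p)
    (hd : (degreeOf i p : K) ≠ 0) : pderiv i p ≠ 0 := by
  have hne : p.support.Nonempty := by
    rw [Finset.nonempty_iff_ne_empty]
    intro h
    rw [support_eq_empty] at h
    simp [h] at hp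
  obtain ⟨m, hm, hmd⟩ := Finset.exists_mem_eq_sup p.support hne fun m => m i
  rw [← degreeOf_eq_sup] at hmd
  intro h
  have h1 := congrArg (coeff (m - Finsupp.single i 1)) h
  have h2 : m - Finsupp.single i 1 + Finsupp.single i 1 = m := by
    apply tsub_add_cancel_of_le
    rw [Finsupp.single_le_iff]
    omega
  rw [coeff_pderiv, h2, coeff_zero] at h1
  have h3 : (((m - Finsupp.single i 1 : σ →₀ ℕ) i : ℕ) : K) + 1 = (degreeOf i p : K) := by
    rw [hmd, Finsupp.tsub_apply, Finsupp.single_eq_same, ← Nat.cast_add_one]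
    congr 1
    omega
  rw [h3] at h1
  exact mul_ne_zero (mem_support_iff.1 hm) hd h1

theorem not_dvd_pderiv {σ : Type*} {i : σ} {p : MvPolynomial σ K} (hp : 0 < degreeOf i p)
    (hd : (degreeOf i p : K) ≠ 0) : ¬ p ∣ pderiv i p := by
  rintro ⟨q, hq⟩
  have h0 := pderiv_ne_zero hp hd
  have hlt := degreeOf_pderiv_lt hp
  rw [hq] at h0 hlt
  rw [degreeOf_mul_eq (left_ne_zero_of_mul h0) (right_ne_zero_of_mul h0)] at hlt
  omega

/-- The second derivative of `g` along the direction in a plane `x = const` which is tangent to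
the level curve of `g`. -/
noncomputable def flec (g : MvPolynomial (Fin 3) K) : MvPolynomial (Fin 3) K :=
  pderiv 0 g * pderiv 0 g * pderiv 2 (pderiv 2 g) - C 2 * (pderiv 2 g * pderiv 0 g *
    pderiv 2 (pderiv 0 g)) + pderiv 2 g * pderiv 2 g * pderiv 0 (pderiv 0 g)

theorem degreeOf_flec_le (j : Fin 3) (g : MvPolynomial (Fin 3) K) :
    degreeOf j (flec g) ≤ 3 * degreeOf j g := by
  have h1 : ∀ i, degreeOf j (pderiv i g) ≤ degreeOf j g := fun i => degreeOf_pderiv_le i j g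
  have h2 : ∀ i k, degreeOf j (pderiv i (pderiv k g)) ≤ degreeOf j g := fun i k =>
    (degreeOf_pderiv_le i j _).trans (h1 k)
  have h3 : ∀ a b c : MvPolynomial (Fin 3) K, degreeOf j a ≤ degreeOf j g →
      degreeOf j b ≤ degreeOf j g → degreeOf j c ≤ degreeOf j g →
      degreeOf j (a * b * c) ≤ 3 * degreeOf j g := by
    intro a b c ha hb hc
    have := degreeOf_mul_le j (a * b) c
    have := degreeOf_mul_le j a b
    omega
  unfold flec
  refine (degreeOf_add_le _ _ _).trans (max_le ?_ (h3 _ _ _ (h1 _) (h1 _) (h2 _ _)))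
  refine (degreeOf_sub_le _ _ _).trans (max_le (h3 _ _ _ (h1 _) (h1 _) (h2 _ _)) ?_)
  exact (degreeOf_C_mul_le _ _ _).trans (h3 _ _ _ (h1 _) (h1 _) (h2 _ _))

/-- A nonzero polynomial of small degree vanishing on given lines. -/
theorem exists_vanishing {κ : Type*} (B : Finset κ) (y γ δ : κ → K) (D E : ℕ)
    (h : B.card * (2 * D + 1) < (D + 1) ^ 2 * (E + 1)) :
    ∃ f : MvPolynomial (Fin 3) K, f ≠ 0 ∧ degreeOf 0 f ≤ D ∧ degreeOf 1 f ≤ D ∧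
      degreeOf 2 f ≤ E ∧ ∀ b ∈ B, evB (y b) (γ b) (δ b) f = 0 := by
  let m₀ : Fin 3 →₀ ℕ := Finsupp.equivFunOnFinite.symm ![D, D, E]
  let V := restrictSupport K ((Finset.Iic m₀ : Finset (Fin 3 →₀ ℕ)) : Set (Fin 3 →₀ ℕ))
  have hfin : Module.finrank K V = (D + 1) ^ 2 * (E + 1) := by
    rw [Module.finrank_eq_nat_card_basis (basisRestrictSupport K _)]
    simp only [Nat.card_eq_fintype_card, Fintype.card_coe, SetLike.coe_sort_coe]
    rw [Finsupp.card_Iic, Finset.prod_subset (Finset.subset_univ _)]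
    · simp [Fin.prod_univ_three, m₀]; ring
    · intro i _ hi
      simp at hi
      simp [hi]
  have hfd : FiniteDimensional K V := Module.finite_of_finrank_pos (by rw [hfin]; positivity)
  let T : V →ₗ[K] (B → Fin (2 * D + 1) → K) :=
    LinearMap.pi fun b => LinearMap.pi fun n =>
      (Polynomial.lcoeff K n) ∘ₗ (evB (y b) (γ b) (δ b)).toLinearMap ∘ₗ V.subtype
  have hker : LinearMap.ker T ≠ ⊥ := by
    apply LinearMap.ker_ne_bot_of_finrank_lt
    rw [hfin]
    simpa [Module.finrank_pi_fintype] using h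
  obtain ⟨⟨f, hfV⟩, hf, hf0⟩ := Submodule.exists_mem_ne_zero_of_ne_bot hker
  have hdeg : ∀ i, degreeOf i f ≤ m₀ i := by
    intro i
    rw [degreeOf_le_iff]
    intro m hm
    have := (mem_restrictSupport_iff K).1 hfV hm
    simp at this
    exact this i
  refine ⟨f, fun h => hf0 (by simp [h]), hdeg 0, hdeg 1, hdeg 2, fun b hb => ?_⟩
  ext n
  by_cases hn : n < 2 * D + 1
  · have := congrFun (congrFun (LinearMap.mem_ker.1 hf) ⟨b, hb⟩) ⟨n, hn⟩
    simpa [T] using this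
  · rw [Polynomial.coeff_eq_zero_of_natDegree_lt, Polynomial.coeff_zero]
    have := natDegree_evB_le (y b) (γ b) (δ b) f
    have h0 : degreeOf 0 f ≤ D := hdeg 0
    have h1 : degreeOf 1 f ≤ D := hdeg 1
    omega

/-- The distinct irreducible factors of a nonzero polynomial. -/
theorem exists_factors {f : MvPolynomial (Fin 3) K} (hf : f ≠ 0) :
    ∃ S : Finset (MvPolynomial (Fin 3) K), (∀ g ∈ S, Irreducible g) ∧
      (∀ g ∈ S, ∀ h ∈ S, g ∣ h → g = h) ∧ (∀ i, ∑ g ∈ S, degreeOf i g ≤ degreeOf i f) ∧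
      ∀ φ : MvPolynomial (Fin 3) K →ₐ[K] Polynomial K, φ f = 0 → ∃ g ∈ S, φ g = 0 := by
  induction f using UniqueFactorizationMonoid.induction_on_prime with
  | h₁ => exact absurd rfl hf
  | h₂ u hu =>
    refine ⟨∅, by simp, by simp, by simp, fun φ hφ => ?_⟩
    exact absurd hφ (hu.map φ).ne_zero
  | h₃ a p ha hp ih =>
    obtain ⟨S, hS1, hS2, hS3, hS4⟩ := ih ha
    have hdeg : ∀ i, degreeOf i (p * a) = degreeOf i p + degreeOf i a := fun i =>
      degreeOf_mul_eq hp.ne_zero ha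
    by_cases hex : ∃ g ∈ S, p ∣ g
    · obtain ⟨g, hg, hpg⟩ := hex
      refine ⟨S, hS1, hS2, fun i => (hS3 i).trans (by rw [hdeg]; omega), fun φ hφ => ?_⟩
      rw [map_mul] at hφ
      rcases mul_eq_zero.1 hφ with h | h
      · obtain ⟨q, rfl⟩ := hpg
        exact ⟨_, hg, by simp [h]⟩
      · exact hS4 φ h
    · push Not at hex
      have hp' : p ∉ S := fun h => hex p h dvd_rfl
      refine ⟨insert p S, ?_, ?_, fun i => ?_, fun φ hφ => ?_⟩
      · simp only [Finset.mem_insert, forall_eq_or_imp]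
        exact ⟨hp.irreducible, hS1⟩
      · simp only [Finset.mem_insert, forall_eq_or_imp]
        refine ⟨⟨fun _ => trivial, fun g hg h => absurd h (hex g hg)⟩,
          fun g hg => ⟨fun h => ?_, hS2 g hg⟩⟩
        exact absurd ((hS1 g hg).dvd_symm hp.irreducible h) (hex g hg)
      · rw [Finset.sum_insert hp', hdeg]
        exact Nat.add_le_add_left (hS3 i) _
      · rw [map_mul] at hφ
        rcases mul_eq_zero.1 hφ with h | h
        · exact ⟨p, by simp, h⟩
        · obtain ⟨g, hg, hg0⟩ := hS4 φ h
          exact ⟨g, by simp [hg], hg0⟩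

theorem eq_zero_of_second_order {R : Type*} [CommRing R] [IsDomain R] {h q U V : Polynomial R}
    (hchar : ∀ r : ℕ, 0 < r → r ≤ h.natDegree → (r : R) ≠ 0)
    (heq : h * q = U ^ 2 * h.derivative.derivative + h.derivative * V) (hU : U.eval 0 ≠ 0)
    (h0 : h.eval 0 = 0) (h1 : h.derivative.eval 0 = 0) : h = 0 := by
  by_contra hne
  obtain ⟨s, hs, hnd⟩ := Polynomial.exists_eq_pow_rootMultiplicity_mul_and_not_dvd h hne 0
  rw [Polynomial.dvd_iff_isRoot, Polynomial.IsRoot.def] at hnd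
  simp only [map_zero, sub_zero] at hs
  generalize h.rootMultiplicity 0 = k at hs
  match k with
  | 0 => simp [hs] at h0; exact hnd h0
  | 1 => simp [hs] at h1; exact hnd h1
  | n + 2 =>
    have hs0 : s ≠ 0 := by rintro rfl; simp at hnd
    have hdeg : h.natDegree = n + 2 + s.natDegree := by
      rw [hs, Polynomial.natDegree_mul (by simp) hs0, Polynomial.natDegree_X_pow]
    have hd1 : h.derivative = Polynomial.X ^ n * (Polynomial.X *
        (((n + 2 : ℕ) : Polynomial R) * s + Polynomial.X * s.derivative)) := by
      rw [hs]
      simp only [Polynomial.derivative_mul, Polynomial.derivative_X_pow, Polynomial.C_eq_natCast]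
      simp only [show n + 2 - 1 = n + 1 by omega]
      ring
    have hd2 : h.derivative.derivative = Polynomial.X ^ n *
        (((n + 1 : ℕ) : Polynomial R) * (((n + 2 : ℕ) : Polynomial R) * s) +
        Polynomial.X * (((n + 1 : ℕ) : Polynomial R) * s.derivative + s.derivative +
          ((n + 2 : ℕ) : Polynomial R) * s.derivative +
          Polynomial.X * s.derivative.derivative)) := by
      rw [hd1, ← mul_assoc, ← pow_succ]
      simp only [Polynomial.derivative_mul, Polynomial.derivative_X_pow, Polynomial.C_eq_natCast,
        Nat.add_sub_cancel, Polynomial.derivative_add, Polynomial.derivative_natCast,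
        Polynomial.derivative_X]
      ring
    rw [hd2, hd1, hs] at heq
    have hX : (Polynomial.X : Polynomial R) ^ n ≠ 0 := by simp
    have heq' := mul_left_cancel₀ hX (b := Polynomial.X ^ 2 * s * q) (c := U ^ 2 *
        (((n + 1 : ℕ) : Polynomial R) * (((n + 2 : ℕ) : Polynomial R) * s) +
        Polynomial.X * (((n + 1 : ℕ) : Polynomial R) * s.derivative + s.derivative +
          ((n + 2 : ℕ) : Polynomial R) * s.derivative +
          Polynomial.X * s.derivative.derivative)) + Polynomial.X *
        (((n + 2 : ℕ) : Polynomial R) * s + Polynomial.X * s.derivative) * V)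
        (by linear_combination heq)
    have := congrArg (Polynomial.eval 0) heq'
    simp only [Polynomial.eval_mul, Polynomial.eval_add, Polynomial.eval_pow, Polynomial.eval_X,
      Polynomial.eval_natCast, zero_mul, add_zero, ne_eq, OfNat.ofNat_ne_zero,
      not_false_eq_true, zero_pow] at this
    refine mul_ne_zero (pow_ne_zero 2 hU) (mul_ne_zero (hchar (n + 1) ?_ ?_)
      (mul_ne_zero (hchar (n + 2) ?_ ?_) hnd)) this.symm <;> omega

theorem pderiv_comm {σ : Type*} (i j : σ) (p : MvPolynomial σ K) :
    pderiv i (pderiv j p) = pderiv j (pderiv i p) := by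
  ext m
  simp only [coeff_pderiv]
  rcases eq_or_ne i j with rfl | h
  · rfl
  · simp [h, h.symm, add_right_comm _ (Finsupp.single i 1)]
    ring

/-- Restriction to the ruled surface `(z, y) = (γ + δ x - w t, y₀ + u t)`. -/
noncomputable def tangentHom (y γ δ : K) (u w : Polynomial K) :
    MvPolynomial (Fin 3) K →ₐ[K] Polynomial (Polynomial K) :=
  aeval ![Polynomial.C (Polynomial.C γ + Polynomial.C δ * Polynomial.X) -
    Polynomial.C w * Polynomial.X, Polynomial.C Polynomial.X,
    Polynomial.C (Polynomial.C y) + Polynomial.C u * Polynomial.X]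

theorem eval_zero_tangentHom (y γ δ : K) (u w : Polynomial K) (f : MvPolynomial (Fin 3) K) :
    (tangentHom y γ δ u w f).eval 0 = evB y γ δ f := by
  have : (Polynomial.evalRingHom (0 : Polynomial K)).comp (tangentHom y γ δ u w).toRingHom =
      (evB y γ δ).toRingHom := by
    apply MvPolynomial.ringHom_ext
    · intro a; simp [Polynomial.algebraMap_apply]
    · intro i
      fin_cases i <;> simp [tangentHom, evB]
  exact congrArg (fun φ => φ f) this

theorem derivative_tangentHom (y γ δ : K) (u w : Polynomial K) (f : MvPolynomial (Fin 3) K) :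
    (tangentHom y γ δ u w f).derivative = Polynomial.C u * tangentHom y γ δ u w (pderiv 2 f) -
      Polynomial.C w * tangentHom y γ δ u w (pderiv 0 f) := by
  induction f using MvPolynomial.induction_on with
  | C a => simp [MvPolynomial.algHom_C, Polynomial.algebraMap_apply]
  | add p q hp hq => simp only [map_add, hp, hq]; ring
  | mul_X p i hp =>
    simp only [map_mul, Polynomial.derivative_mul, hp, Derivation.leibniz, map_add, smul_eq_mul,
      pderiv_X]
    fin_cases i <;> simp [tangentHom] <;> ring

theorem natDegree_tangentHom_le (y γ δ : K) (u w : Polynomial K) (f : MvPolynomial (Fin 3) K) :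
    (tangentHom y γ δ u w f).natDegree ≤ degreeOf 2 f + degreeOf 0 f := by
  refine (natDegree_aeval_le _ ![1, 0, 1] ?_ f).trans ?_
  · intro i; fin_cases i
    · simp; compute_degree
    · simp
    · simp; compute_degree
  · simp [Fin.sum_univ_three]; omega

theorem tangentHom_eq_zero {g : MvPolynomial (Fin 3) K} (hG : g ∣ flec g)
    (hchar : ∀ r : ℕ, 0 < r → r ≤ degreeOf 2 g + degreeOf 0 g → (r : K) ≠ 0) {y γ δ : K}
    (hb : evB y γ δ g = 0) (hs : evB y γ δ (pderiv 0 g) ≠ 0) :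
    tangentHom y γ δ (evB y γ δ (pderiv 0 g)) (evB y γ δ (pderiv 2 g)) g = 0 := by
  obtain ⟨q, hq⟩ := hG
  set u := evB y γ δ (pderiv 0 g)
  set w := evB y γ δ (pderiv 2 g)
  set φ := tangentHom y γ δ u w with hφ
  have hd : ∀ f, (φ f).derivative = Polynomial.C u * φ (pderiv 2 f) -
    Polynomial.C w * φ (pderiv 0 f) := derivative_tangentHom y γ δ u w
  have hd1 := hd g
  have hd2 : (φ g).derivative.derivative =
      Polynomial.C u * (Polynomial.C u * φ (pderiv 2 (pderiv 2 g)) -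
        Polynomial.C w * φ (pderiv 2 (pderiv 0 g))) -
      Polynomial.C w * (Polynomial.C u * φ (pderiv 2 (pderiv 0 g)) -
        Polynomial.C w * φ (pderiv 0 (pderiv 0 g))) := by
    rw [hd1]
    simp only [Polynomial.derivative_sub, Polynomial.derivative_mul, Polynomial.derivative_C,
      zero_mul, zero_add, hd, pderiv_comm (0 : Fin 3) 2 g]
  have hq' := congrArg φ hq
  simp only [flec, map_add, map_sub, map_mul, map_ofNat] at hq'
  refine eq_zero_of_second_order (q := Polynomial.C u ^ 2 * φ q) (U := φ (pderiv 0 g))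
    (V := -2 * Polynomial.C u * φ (pderiv 0 g) * φ (pderiv 2 (pderiv 0 g)) +
      (φ g).derivative * φ (pderiv 0 (pderiv 0 g)) +
      2 * Polynomial.C w * φ (pderiv 0 g) * φ (pderiv 0 (pderiv 0 g))) ?_ ?_ ?_ ?_ ?_
  · intro r h0 hr
    rw [← Polynomial.C_eq_natCast, Ne, Polynomial.C_eq_zero]
    exact hchar r h0 (hr.trans (natDegree_tangentHom_le _ _ _ _ _ _))
  · rw [hd2, hd1]
    linear_combination (-Polynomial.C u ^ 2) * hq'
  · rwa [eval_zero_tangentHom]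
  · rwa [eval_zero_tangentHom]
  · rw [hd1]
    simp only [Polynomial.eval_sub, Polynomial.eval_mul, Polynomial.eval_C, hφ,
      eval_zero_tangentHom]
    ring

theorem eq_zero_of_tangentHom [Infinite K] {y γ δ : K} {u w : Polynomial K} (hu : u ≠ 0)
    {r : MvPolynomial (Fin 2) K} (hr : tangentHom y γ δ u w (rename Fin.succ r) = 0) : r = 0 := by
  have key : ∀ v : Fin 2 → K, u.eval (v 0) ≠ 0 → eval v r = 0 := by
    intro v hv
    let e : Polynomial (Polynomial K) →+* K := (Polynomial.evalRingHom (v 0)).comp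
      (Polynomial.evalRingHom (Polynomial.C ((v 1 - y) / u.eval (v 0))))
    have : (e.comp (tangentHom y γ δ u w).toRingHom).comp (rename Fin.succ).toRingHom = eval v := by
      apply MvPolynomial.ringHom_ext
      · intro a; simp [e]
      · intro i
        fin_cases i
        · simp [e, tangentHom]
        · simp [e, tangentHom]; field_simp; ring
    rw [← this]
    simp [hr]
  have hev : ∀ v : Fin 2 → K, eval v (Polynomial.aeval (X 0) u) = u.eval (v 0) := by
    intro v
    have := Polynomial.aeval_algHom_apply (MvPolynomial.aeval v) (X 0 : MvPolynomial (Fin 2) K) u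
    simpa [MvPolynomial.coe_aeval_eq_eval, Polynomial.coe_aeval_eq_eval] using this.symm
  have hprod : r * Polynomial.aeval (X 0) u = 0 := by
    apply MvPolynomial.funext
    intro v
    by_cases hv : u.eval (v 0) = 0
    · rw [map_mul, hev, hv, mul_zero, map_zero]
    · simp [key v hv]
  refine (mul_eq_zero.1 hprod).resolve_right fun h => hu ?_
  apply Polynomial.funext
  intro x
  have := congrArg (eval fun _ : Fin 2 => x) h
  simpa [hev] using this

/-- The bilinear surface through two lines at distinct ordinates. -/
noncomputable def plane (y₁ γ₁ δ₁ y₂ γ₂ δ₂ : K) : MvPolynomial (Fin 3) K :=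
  C (y₂ - y₁) * (X 0 - (C γ₁ + C δ₁ * X 1)) -
    (C (γ₂ - γ₁) + C (δ₂ - δ₁) * X 1) * (X 2 - C y₁)

theorem dvd_plane [Infinite K] {g : MvPolynomial (Fin 3) K} (hg : Irreducible g)
    (hz : 0 < degreeOf 0 g) (hG : g ∣ flec g)
    (hchar : ∀ r : ℕ, 0 < r → r ≤ degreeOf 2 g + degreeOf 0 g → (r : K) ≠ 0)
    {y₁ γ₁ δ₁ y₂ γ₂ δ₂ : K} (h1 : evB y₁ γ₁ δ₁ g = 0) (hs : evB y₁ γ₁ δ₁ (pderiv 0 g) ≠ 0)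
    (h2 : evB y₂ γ₂ δ₂ g = 0) : g ∣ plane y₁ γ₁ δ₁ y₂ γ₂ δ₂ := by
  have ht := tangentHom_eq_zero hG hchar h1 hs
  set u := evB y₁ γ₁ δ₁ (pderiv 0 g)
  set w := evB y₁ γ₁ δ₁ (pderiv 2 g)
  have hX : ∀ (y γ δ : K) (s : Polynomial K),
      evB y γ δ (Polynomial.aeval (X 1) s) = s := by
    intro y γ δ s
    rw [← Polynomial.aeval_algHom_apply]
    simp [evB]
  have hX' : ∀ (s : Polynomial K), tangentHom y₁ γ₁ δ₁ u w (Polynomial.aeval (X 1) s) =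
      Polynomial.C s := by
    intro s
    rw [← Polynomial.aeval_algHom_apply]
    have := Polynomial.aeval_algHom_apply (Polynomial.CAlgHom (R := K) (A := Polynomial K))
      Polynomial.X s
    simpa [tangentHom] using this
  set l : MvPolynomial (Fin 3) K := Polynomial.aeval (X 1) u * (X 0 - (C γ₁ + C δ₁ * X 1)) +
    Polynomial.aeval (X 1) w * (X 2 - C y₁) with hl
  have hgl : g ∣ l := by
    by_contra hgl
    obtain ⟨r, hr, -, a, b, hab⟩ := exists_eliminant hg hz hgl
    refine hr (eq_zero_of_tangentHom (y := y₁) (γ := γ₁) (δ := δ₁) (w := w) hs ?_)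
    rw [← hab, map_add, map_mul, map_mul, ht, hl]
    simp only [map_add, map_mul, map_sub, hX']
    simp [tangentHom]
    left
    ring
  have hl2 : evB y₂ γ₂ δ₂ l = 0 := by
    obtain ⟨q, hq⟩ := hgl
    rw [hq, map_mul, h2, zero_mul]
  simp only [hl, map_add, map_mul, map_sub, hX] at hl2
  have hmul : C (y₂ - y₁) * l = Polynomial.aeval (X 1) u * plane y₁ γ₁ δ₁ y₂ γ₂ δ₂ := by
    have h3 := congrArg (Polynomial.aeval (X 1 : MvPolynomial (Fin 3) K)) hl2
    simp [evB] at h3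
    rw [hl, plane]
    simp only [map_sub]
    linear_combination (X 2 - C y₁) * h3
  have hdvd : g ∣ Polynomial.aeval (X 1) u * plane y₁ γ₁ δ₁ y₂ γ₂ δ₂ := by
    rw [← hmul]; exact hgl.mul_left _
  refine (hg.prime.dvd_or_dvd hdvd).resolve_left ?_
  rintro ⟨q, hq⟩
  apply hs
  rw [← hX y₁ γ₁ δ₁ u, hq, map_mul, h1, zero_mul]

theorem evA_plane {y₁ γ₁ δ₁ y₂ γ₂ δ₂ x α β : K} (hy : y₁ ≠ y₂)
    (h : evA x α β (plane y₁ γ₁ δ₁ y₂ γ₂ δ₂) = 0) :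
    α + β * y₁ = γ₁ + δ₁ * x ∧ α + β * y₂ = γ₂ + δ₂ * x := by
  have hy' : y₂ - y₁ ≠ 0 := sub_ne_zero.2 hy.symm
  have h1 := congrArg (Polynomial.eval y₁) h
  have h2 := congrArg (Polynomial.eval y₂) h
  simp [evA, plane] at h1 h2
  constructor
  · apply mul_left_cancel₀ hy'
    rcases h1 with h1 | h1
    · exact absurd h1 hy'
    · linear_combination (y₂ - y₁) * h1
  · apply mul_left_cancel₀ hy'
    linear_combination h2

theorem eq_of_dvd_plane {g₁ g₂ : MvPolynomial (Fin 3) K} {y₁ γ₁ δ₁ y₂ γ₂ δ₂ : K} (hy : y₁ ≠ y₂)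
    (hg₂ : Irreducible g₂) (hz₁ : 0 < degreeOf 0 g₁)
    (hz₂ : 0 < degreeOf 0 g₂) (h1 : g₁ ∣ plane y₁ γ₁ δ₁ y₂ γ₂ δ₂)
    (h2 : g₂ ∣ plane y₁ γ₁ δ₁ y₂ γ₂ δ₂) : g₂ ∣ g₁ := by
  obtain ⟨q, hq⟩ := h1
  rw [hq] at h2
  refine (hg₂.prime.dvd_or_dvd h2).resolve_right ?_
  rintro ⟨q', rfl⟩
  have hne : plane y₁ γ₁ δ₁ y₂ γ₂ δ₂ ≠ 0 := by
    intro h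
    have := congrArg (eval ![γ₁ + 1, 0, y₁]) h
    simp [plane] at this
    exact hy (sub_eq_zero.1 this).symm
  have hdeg : degreeOf 0 (plane y₁ γ₁ δ₁ y₂ γ₂ δ₂) ≤ 1 := by
    have hc : ∀ a, degreeOf 0 (C a : MvPolynomial (Fin 3) K) = 0 := fun a => degreeOf_C _ _
    have hx : ∀ i : Fin 3, degreeOf 0 (X i : MvPolynomial (Fin 3) K) = if 0 = i then 1 else 0 :=
      fun i => degreeOf_X _ _
    have hca : ∀ a b, degreeOf 0 (C a + C b * X 1 : MvPolynomial (Fin 3) K) = 0 := by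
      intro a b
      have := degreeOf_add_le 0 (C a : MvPolynomial (Fin 3) K) (C b * X 1)
      have := degreeOf_C_mul_le (X 1 : MvPolynomial (Fin 3) K) 0 b
      have := hc a
      have := hx 1
      simp at this
      simp_all
    unfold plane
    refine (degreeOf_sub_le _ _ _).trans (max_le ?_ ?_)
    · refine (degreeOf_C_mul_le _ _ _).trans ((degreeOf_sub_le _ _ _).trans (max_le ?_ ?_))
      · simp [hx]
      · simp [hca]
    · refine (degreeOf_mul_le _ _ _).trans ?_
      have := degreeOf_sub_le 0 (X 2 : MvPolynomial (Fin 3) K) (C y₁)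
      simp [hx, hc] at this
      rw [hca, this]
      simp
  rw [hq] at hne hdeg
  have h3 := right_ne_zero_of_mul hne
  rw [degreeOf_mul_eq (left_ne_zero_of_mul hne) h3,
    degreeOf_mul_eq (left_ne_zero_of_mul h3) (right_ne_zero_of_mul h3)] at hdeg
  omega

theorem card_le_natDegree {ι : Type*} {q : Polynomial K} (hq : q ≠ 0) {x : ι → K}
    (hx : Function.Injective x) (S : Finset ι) (h : ∀ i ∈ S, q.eval (x i) = 0) :
    S.card ≤ q.natDegree := by
  rw [← Finset.card_image_of_injective S hx]
  refine Polynomial.card_le_degree_of_subset_roots fun z hz => ?_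
  obtain ⟨i, hi, rfl⟩ := Finset.mem_image.1 hz
  exact (Polynomial.mem_roots hq).2 (h i hi)

theorem derivative_evA (x α β : K) (f : MvPolynomial (Fin 3) K) :
    (evA x α β f).derivative = evA x α β (pderiv 2 f) +
      Polynomial.C β * evA x α β (pderiv 0 f) := by
  induction f using MvPolynomial.induction_on with
  | C a => simp [MvPolynomial.algHom_C]
  | add p q hp hq => simp only [map_add, hp, hq]; ring
  | mul_X p i hp =>
    simp only [map_mul, Polynomial.derivative_mul, hp, Derivation.leibniz, map_add, smul_eq_mul,
      pderiv_X]
    fin_cases i <;> simp [evA] <;> ring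

theorem evA_flec {x α β : K} {g : MvPolynomial (Fin 3) K} (h : evA x α β g = 0) :
    evA x α β (flec g) = 0 := by
  have h1 := derivative_evA x α β g
  have h2 := congrArg Polynomial.derivative h1
  simp only [h, Polynomial.derivative_zero, Polynomial.derivative_add,
    Polynomial.derivative_mul, Polynomial.derivative_C, zero_mul, zero_add,
    derivative_evA, pderiv_comm (0 : Fin 3) 2 g] at h1 h2
  have h3 : evA x α β (pderiv 2 g) = -(Polynomial.C β * evA x α β (pderiv 0 g)) := by
    linear_combination -h1
  simp only [flec, map_add, map_sub, map_mul, h3]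
  simp only [map_ofNat]
  linear_combination (-(evA x α β (pderiv 0 g)) ^ 2) * h2

theorem card_bad_lines_le {ι : Type*} {x α β : ι → K} (hx : Function.Injective x)
    {g : MvPolynomial (Fin 3) K} (hg : Irreducible g)
    (hchar : 0 < degreeOf 0 g → (degreeOf 0 g : K) ≠ 0) (A : Finset ι)
    (hA : ∀ i ∈ A, evA (x i) (α i) (β i) g = 0) :
    (A.filter fun i => degreeOf 0 g = 0 ∨ evA (x i) (α i) (β i) (pderiv 0 g) = 0 ∨
      ¬ g ∣ flec g).card ≤ (8 * degreeOf 0 g + 1) * degreeOf 1 g := by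
  have hle : (A.filter fun i => degreeOf 0 g = 0 ∨ evA (x i) (α i) (β i) (pderiv 0 g) = 0 ∨
      ¬ g ∣ flec g).card ≤ A.card := Finset.card_filter_le _ _
  rcases Nat.eq_zero_or_pos (degreeOf 0 g) with h0 | h0
  · have := card_lines_le_of_degreeOf_zero hg.ne_zero h0 A x α β hx hA
    nlinarith
  by_cases hG : g ∣ flec g
  · have := card_common_lines_le hg h0 (not_dvd_pderiv h0 (hchar h0)) (A.filter fun i =>
      degreeOf 0 g = 0 ∨ evA (x i) (α i) (β i) (pderiv 0 g) = 0 ∨ ¬ g ∣ flec g) x α β hx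
      (fun i hi => hA i (Finset.mem_filter.1 hi).1) (fun i hi => by
        have := (Finset.mem_filter.1 hi).2
        simpa [hG, h0.ne'] using this)
    have h1 := degreeOf_pderiv_le 0 1 g
    have h2 := degreeOf_pderiv_le 0 0 g
    nlinarith
  · have := card_common_lines_le hg h0 hG A x α β hx hA (fun i hi => evA_flec (hA i hi))
    have h1 := degreeOf_flec_le 1 g
    have h2 := degreeOf_flec_le 0 g
    nlinarith

theorem card_mul_le_of_card_inter_le_one {τ κ : Type*} (T : Finset τ) (S : τ → Finset κ)
    (B : Finset κ) (hB : ∀ t ∈ T, S t ⊆ B) {r : ℕ} (hr : ∀ t ∈ T, r + T.card ≤ (S t).card)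
    (hT : ∀ t ∈ T, ∀ t' ∈ T, t ≠ t' → (S t ∩ S t').card ≤ 1) : T.card * r ≤ B.card := by
  let S' : τ → Finset κ := fun t => S t \ (T.erase t).biUnion fun t' => S t ∩ S t'
  have hdisj : (T : Set τ).PairwiseDisjoint S' := by
    intro t ht t' ht' hne
    rw [Function.onFun, Finset.disjoint_left]
    intro j hj hj'
    simp only [S', Finset.mem_sdiff, Finset.mem_biUnion, Finset.mem_erase, Finset.mem_inter,
      not_exists, not_and] at hj hj'
    exact hj.2 t' ⟨hne.symm, ht'⟩ hj.1 hj'.1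
  calc T.card * r ≤ ∑ t ∈ T, (S' t).card := by
        rw [← smul_eq_mul]
        refine Finset.card_nsmul_le_sum _ _ _ fun t ht => ?_
        have h1 : ((T.erase t).biUnion fun t' => S t ∩ S t').card ≤ (T.erase t).card * 1 :=
          Finset.card_biUnion_le_card_mul _ _ _ fun t' ht' =>
            hT t ht t' (Finset.mem_of_mem_erase ht') (Finset.ne_of_mem_erase ht').symm
        have h2 := Finset.card_erase_le (s := T) (a := t)
        have h3 := Finset.le_card_sdiff ((T.erase t).biUnion fun t' => S t ∩ S t') (S t)
        have := hr t ht
        simp only [S']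
        omega
    _ = (T.biUnion S').card := (Finset.card_biUnion hdisj).symm
    _ ≤ B.card := Finset.card_le_card (Finset.biUnion_subset.2 fun t ht =>
        Finset.sdiff_subset.trans (hB t ht))

/-- Incidence of the lines `(x, z) = (x i, α i + β i y)` and `(y, z) = (y j, γ j + δ j x)`. -/
def Meets {ι κ : Type*} (x α β : ι → K) (y γ δ : κ → K) (i : ι) (j : κ) : Prop :=
  α i + β i * y j = γ j + δ j * x i

section

variable {ι κ : Type*} {x α β : ι → K} {y γ δ : κ → K}

theorem sum_card_meets_le (hx : Function.Injective x) {g : MvPolynomial (Fin 3) K} (A : Finset ι)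
    (hA : ∀ i ∈ A, evA (x i) (α i) (β i) g = 0) (B : Finset κ) :
    ∑ i ∈ A, (B.filter fun j => Meets x α β y γ δ i j ∧ evB (y j) (γ j) (δ j) g ≠ 0).card ≤
      B.card * (degreeOf 1 g + degreeOf 0 g) := by
  have := Finset.sum_card_bipartiteAbove_eq_sum_card_bipartiteBelow (s := A) (t := B)
    (fun i j => Meets x α β y γ δ i j ∧ evB (y j) (γ j) (δ j) g ≠ 0)
  simp only [Finset.bipartiteAbove, Finset.bipartiteBelow] at this
  rw [this, ← smul_eq_mul]
  refine Finset.sum_le_card_nsmul _ _ _ fun j _ => ?_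
  by_cases hj : evB (y j) (γ j) (δ j) g = 0
  · simp [hj]
  refine (card_le_natDegree hj hx _ fun i hi => ?_).trans (natDegree_evB_le _ _ _ _)
  rw [Finset.mem_filter] at hi
  rw [← eval_evA_eq_eval_evB hi.2.1, hA i hi.1, Polynomial.eval_zero]

theorem card_singular_le (hy : Function.Injective y) {g : MvPolynomial (Fin 3) K} {i : ι}
    (hi : evA (x i) (α i) (β i) g ≠ 0) (B : Finset κ) :
    (B.filter fun j => Meets x α β y γ δ i j ∧ evB (y j) (γ j) (δ j) g = 0).card ≤
      degreeOf 2 g + degreeOf 0 g := by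
  refine (card_le_natDegree hi hy _ fun j hj => ?_).trans (natDegree_evA_le _ _ _ _)
  rw [Finset.mem_filter] at hj
  rw [eval_evA_eq_eval_evB hj.2.1, hj.2.2, Polynomial.eval_zero]

variable [Infinite K]

set_option maxHeartbeats 1000000 in
theorem false_of_rich (hx : Function.Injective x) (hy : Function.Injective y)
    {A : Finset ι} {B : Finset κ} {s₀ M : ℕ} (hs : 1 ≤ s₀) (hne : A.Nonempty)
    (hBA : B.card ≤ A.card) (hAs : A.card ≤ s₀ ^ 2)
    (hchar : ∀ r : ℕ, 0 < r → r ≤ 17 * s₀ → (r : K) ≠ 0)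
    (hM : ∀ j ∈ B, ∀ j' ∈ B, j ≠ j' → (A.filter fun i => Meets x α β y γ δ i j ∧
      Meets x α β y γ δ i j').card ≤ M)
    (hrich : ∀ i ∈ A, 80 * (s₀ + M) ≤ (B.filter fun j => Meets x α β y γ δ i j).card) :
    False := by
  set n := B.card with hn
  have hn0 : 0 < n := by
    obtain ⟨i, hi⟩ := hne
    have h1 := hrich i hi
    have h2 : (B.filter fun j => Meets x α β y γ δ i j).card ≤ B.card :=
      Finset.card_filter_le _ _
    omega
  obtain ⟨D, hD⟩ : ∃ D, D = 2 * n / (16 * s₀ + 1) := ⟨_, rfl⟩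
  have hD1 : D * (16 * s₀ + 1) ≤ 2 * n := by rw [hD]; exact Nat.div_mul_le_self _ _
  have hD2 : 2 * n < (D + 1) * (16 * s₀ + 1) := by
    rw [hD, ← Nat.div_lt_iff_lt_mul (by omega)]; exact Nat.lt_succ_self _
  have hD3 : 8 * s₀ * D ≤ n := by nlinarith
  have hD4 : 8 * D ≤ s₀ := by
    have : s₀ * (8 * D) ≤ s₀ * s₀ := by nlinarith
    exact Nat.le_of_mul_le_mul_left this (by omega)
  obtain ⟨f, hf0, hfZ, hfX, hfY, hfB⟩ := exists_vanishing B y γ δ D (16 * s₀) (by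
    rw [← hn]; nlinarith)
  have hfA : ∀ i ∈ A, evA (x i) (α i) (β i) f = 0 := by
    intro i hi
    by_contra h
    have h1 := card_le_natDegree h hy (B.filter fun j => Meets x α β y γ δ i j) (by
      intro j hj
      rw [Finset.mem_filter] at hj
      rw [eval_evA_eq_eval_evB hj.2, hfB j hj.1, Polynomial.eval_zero])
    have h2 := natDegree_evA_le (x i) (α i) (β i) f
    have h3 := hrich i hi
    omega
  obtain ⟨S, hS1, hS2, hS3, hS4⟩ := exists_factors hf0
  have hk : ∀ i, ∃ g, i ∈ A → g ∈ S ∧ evA (x i) (α i) (β i) g = 0 := by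
    intro i
    by_cases hi : i ∈ A
    · obtain ⟨g, hg⟩ := hS4 _ (hfA i hi)
      exact ⟨g, fun _ => hg⟩
    · exact ⟨0, fun h => absurd h hi⟩
  choose k hk using hk
  have hdeg : ∀ (c : Fin 3), ∀ g ∈ S, degreeOf c g ≤ degreeOf c f := fun c g hg =>
    (Finset.single_le_sum (f := fun g => degreeOf c g) (fun _ _ => Nat.zero_le _) hg).trans (hS3 c)
  let cls : MvPolynomial (Fin 3) K → Finset ι := fun g => A.filter fun i => k i = g
  have hcls : ∀ g, ∀ i ∈ cls g, evA (x i) (α i) (β i) g = 0 := by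
    intro g i hi
    obtain ⟨h1, h2⟩ := Finset.mem_filter.1 hi
    rw [← h2]; exact (hk i h1).2
  let bad : MvPolynomial (Fin 3) K → Finset ι := fun g => (cls g).filter fun i =>
    degreeOf 0 g = 0 ∨ evA (x i) (α i) (β i) (pderiv 0 g) = 0 ∨ ¬ g ∣ flec g
  let out : ι → MvPolynomial (Fin 3) K → Finset κ := fun i g => B.filter fun j =>
    Meets x α β y γ δ i j ∧ evB (y j) (γ j) (δ j) g ≠ 0
  let trans : MvPolynomial (Fin 3) K → Finset ι := fun g => (cls g).filter fun i =>
    40 * (s₀ + M) ≤ (out i g).card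
  let good : MvPolynomial (Fin 3) K → Finset ι := fun g => cls g \ (bad g ∪ trans g)
  let smooth : MvPolynomial (Fin 3) K → Finset κ := fun g => B.filter fun j =>
    evB (y j) (γ j) (δ j) g = 0 ∧ evB (y j) (γ j) (δ j) (pderiv 0 g) ≠ 0
  let T := S.filter fun g => (good g).Nonempty
  -- the irregular lines
  have hbad : ∑ g ∈ S, (bad g).card ≤ (8 * D + 1) * D := by
    calc ∑ g ∈ S, (bad g).card ≤ ∑ g ∈ S, (8 * D + 1) * degreeOf 1 g := by
          refine Finset.sum_le_sum fun g hg => ?_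
          have h0 := (hdeg 0 g hg).trans hfZ
          refine (card_bad_lines_le hx (hS1 g hg) (fun h => hchar _ h (by omega)) (cls g)
            (hcls g)).trans ?_
          gcongr
      _ = (8 * D + 1) * ∑ g ∈ S, degreeOf 1 g := by rw [Finset.mul_sum]
      _ ≤ _ := Nat.mul_le_mul_left _ ((hS3 1).trans hfX)
  -- the lines crossing many others transversally
  have htrans : (∑ g ∈ S, (trans g).card) * (40 * (s₀ + M)) ≤ n * (2 * D) := by
    calc (∑ g ∈ S, (trans g).card) * (40 * (s₀ + M))
        ≤ ∑ g ∈ S, n * (degreeOf 1 g + degreeOf 0 g) := by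
          rw [Finset.sum_mul]
          refine Finset.sum_le_sum fun g hg => ?_
          refine le_trans ?_ (sum_card_meets_le hx (cls g) (hcls g) B (γ := γ) (δ := δ) (y := y))
          rw [← smul_eq_mul]
          refine (Finset.card_nsmul_le_sum (trans g) (fun i => (out i g).card) _ fun i hi =>
            (Finset.mem_filter.1 hi).2).trans ?_
          exact Finset.sum_le_sum_of_subset (Finset.filter_subset _ _)
      _ = n * (∑ g ∈ S, degreeOf 1 g + ∑ g ∈ S, degreeOf 0 g) := by
          rw [← Finset.mul_sum, Finset.sum_add_distrib]
      _ ≤ _ := Nat.mul_le_mul_left _ (by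
          have h1 := (hS3 1).trans hfX
          have h0 := (hS3 0).trans hfZ
          omega)
  have hgood : ∀ g ∈ T, 0 < degreeOf 0 g ∧ g ∣ flec g ∧
      22 * s₀ + 40 * M + s₀ ≤ (smooth g).card := by
    intro g hg
    obtain ⟨hgS, i, hi⟩ := Finset.mem_filter.1 hg
    obtain ⟨hic, hi⟩ := Finset.mem_sdiff.1 hi
    simp only [bad, trans, Finset.mem_union, Finset.mem_filter, hic, true_and, not_or, not_not,
      not_le] at hi
    obtain ⟨⟨h1, h2, h3⟩, h4⟩ := hi
    refine ⟨Nat.pos_of_ne_zero h1, h3, ?_⟩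
    have h5 := hrich i (Finset.mem_filter.1 hic).1
    have h6 := card_singular_le (γ := γ) (δ := δ) hy h2 B
    have h7 := degreeOf_pderiv_le 0 2 g
    have h8 := degreeOf_pderiv_le 0 0 g
    have h9 := (hdeg 0 g hgS).trans hfZ
    have h10 := (hdeg 2 g hgS).trans hfY
    have h11 : (B.filter fun j => Meets x α β y γ δ i j) ⊆ out i g ∪
        ((B.filter fun j => Meets x α β y γ δ i j ∧
          evB (y j) (γ j) (δ j) (pderiv 0 g) = 0) ∪ smooth g) := by
      intro j hj
      simp only [out, smooth, Finset.mem_union, Finset.mem_filter] at hj ⊢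
      tauto
    have h12 := Finset.card_le_card h11
    have h13 := Finset.card_union_le (out i g) ((B.filter fun j => Meets x α β y γ δ i j ∧
          evB (y j) (γ j) (δ j) (pderiv 0 g) = 0) ∪ smooth g)
    have h14 := Finset.card_union_le (B.filter fun j => Meets x α β y γ δ i j ∧
          evB (y j) (γ j) (δ j) (pderiv 0 g) = 0) (smooth g)
    omega
  have hplane : ∀ g ∈ T, ∀ j ∈ smooth g, ∀ j' ∈ smooth g,
      g ∣ plane (y j) (γ j) (δ j) (y j') (γ j') (δ j') := by
    intro g hg j hj j' hj'
    obtain ⟨h1, h2, -⟩ := hgood g hg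
    have hgS := (Finset.mem_filter.1 hg).1
    have h9 := (hdeg 0 g hgS).trans hfZ
    have h10 := (hdeg 2 g hgS).trans hfY
    exact dvd_plane (hS1 g hgS) h1 h2 (fun r h0 hr => hchar r h0 (by omega))
      (Finset.mem_filter.1 hj).2.1 (Finset.mem_filter.1 hj).2.2 (Finset.mem_filter.1 hj').2.1
  have hclsM : ∀ g ∈ T, (cls g).card ≤ M := by
    intro g hg
    obtain ⟨-, -, h3⟩ := hgood g hg
    obtain ⟨j, hj, j', hj', hne⟩ := Finset.one_lt_card.1 (show 1 < (smooth g).card by omega)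
    refine le_trans (Finset.card_le_card ?_)
      (hM j (Finset.mem_filter.1 hj).1 j' (Finset.mem_filter.1 hj').1 hne)
    intro i hi
    obtain ⟨q, hq⟩ := hplane g hg j hj j' hj'
    have := evA_plane (x := x i) (α := α i) (β := β i) (hy.ne hne)
      (by rw [hq, map_mul, hcls g i hi, zero_mul])
    exact Finset.mem_filter.2 ⟨(Finset.mem_filter.1 hi).1, this⟩
  have hTD : T.card ≤ D := by
    calc T.card = T.card • 1 := by simp
      _ ≤ ∑ g ∈ T, degreeOf 0 g := Finset.card_nsmul_le_sum _ _ _ fun g hg => (hgood g hg).1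
      _ ≤ ∑ g ∈ S, degreeOf 0 g := Finset.sum_le_sum_of_subset (Finset.filter_subset _ _)
      _ ≤ D := (hS3 0).trans hfZ
  have hTn : T.card * (22 * s₀ + 40 * M) ≤ n := by
    refine card_mul_le_of_card_inter_le_one T smooth B (fun _ _ => Finset.filter_subset _ _)
      (fun g hg => ?_) fun g hg g' hg' hne => ?_
    · have := (hgood g hg).2.2
      omega
    · by_contra! h
      obtain ⟨j, hj, j', hj', hjj⟩ := Finset.one_lt_card.1 h
      rw [Finset.mem_inter] at hj hj'
      have hgS := (Finset.mem_filter.1 hg).1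
      have hgS' := (Finset.mem_filter.1 hg').1
      exact hne (hS2 g' hgS' g hgS (eq_of_dvd_plane (hy.ne hjj) (hS1 g' hgS') (hgood g hg).1
        (hgood g' hg').1 (hplane g hg j hj.1 j' hj'.1) (hplane g' hg' j hj.2 j' hj'.2))).symm
  have hgoodcard : ∑ g ∈ S, (good g).card ≤ T.card * M := by
    rw [← smul_eq_mul]
    calc ∑ g ∈ S, (good g).card = ∑ g ∈ T, (good g).card := by
          refine (Finset.sum_subset (Finset.filter_subset _ _) fun g hg hgT => ?_).symm
          simpa [T, hg, Finset.not_nonempty_iff_eq_empty] using hgT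
      _ ≤ _ := Finset.sum_le_card_nsmul _ _ _ fun g hg =>
          (Finset.card_le_card Finset.sdiff_subset).trans (hclsM g hg)
  have htotal : A.card ≤ ∑ g ∈ S, (good g).card + (∑ g ∈ S, (bad g).card +
      ∑ g ∈ S, (trans g).card) := by
    rw [Finset.card_eq_sum_card_fiberwise (f := k) (t := S) fun i hi => (hk i hi).1,
      ← Finset.sum_add_distrib, ← Finset.sum_add_distrib]
    refine Finset.sum_le_sum fun g _ => ?_
    have h1 : cls g ⊆ good g ∪ (bad g ∪ trans g) := by
      intro i hi
      simp only [good, Finset.mem_union, Finset.mem_sdiff, hi, true_and]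
      tauto
    have h2 := Finset.card_le_card h1
    have h3 := Finset.card_union_le (good g) (bad g ∪ trans g)
    have h4 := Finset.card_union_le (bad g) (trans g)
    exact h2.trans (h3.trans (Nat.add_le_add_left h4 _))
  have e1 : 4 * ∑ g ∈ S, (bad g).card ≤ n := by nlinarith
  have e2 : 4 * ∑ g ∈ S, (trans g).card ≤ n := by
    have h1 : (∑ g ∈ S, (trans g).card) * (40 * s₀) ≤ n * (2 * D) :=
      le_trans (Nat.mul_le_mul_left _ (by omega)) htrans
    have h2 : s₀ * (4 * ∑ g ∈ S, (trans g).card) ≤ s₀ * n := by nlinarith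
    exact Nat.le_of_mul_le_mul_left h2 (by omega)
  have e3 : 4 * (T.card * M) ≤ n := by nlinarith
  omega

end

end

/-- The number of related pairs. -/
noncomputable def incidences {ι κ : Type*} (r : ι → κ → Prop) (A : Finset ι) (B : Finset κ) : ℕ :=
  ∑ i ∈ A, (B.filter (r i)).card

section

variable {ι κ : Type*} (r : ι → κ → Prop)

theorem incidences_comm (A : Finset ι) (B : Finset κ) :
    incidences r A B = incidences (fun j i => r i j) B A :=
  Finset.sum_card_bipartiteAbove_eq_sum_card_bipartiteBelow r

theorem incidences_union {A A' : Finset ι} (h : Disjoint A A') (B : Finset κ) :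
    incidences r (A ∪ A') B = incidences r A B + incidences r A' B :=
  Finset.sum_union h

theorem incidences_le_mul (A : Finset ι) (B : Finset κ) :
    incidences r A B ≤ A.card * B.card := by
  rw [← smul_eq_mul]
  exact Finset.sum_le_card_nsmul _ _ _ fun i _ => Finset.card_filter_le _ _

theorem incidences_le_of_left {n b Δ : ℕ} (B : Finset κ)
    (h : ∀ A : Finset ι, A.card ≤ n → incidences r A B ≤ Δ * A.card + b) :
    ∀ (k : ℕ) (A : Finset ι), A.card ≤ k * n → incidences r A B ≤ Δ * A.card + k * b := by
  intro k
  induction k with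
  | zero =>
    intro A hA
    have : A = ∅ := by simpa using hA
    simp [this, incidences]
  | succ k ih =>
    intro A hA
    rcases le_total A.card n with hn | hn
    · have := h A hn
      nlinarith
    · obtain ⟨A', hA', hc⟩ := Finset.exists_subset_card_eq hn
      have h1 := h A' hc.le
      have h2 := Finset.card_sdiff_add_card_eq_card hA'
      have h3 := ih (A \ A') (by rw [add_mul] at hA; omega)
      have h4 := incidences_union r (Finset.disjoint_sdiff (s := A') (t := A)) B
      rw [Finset.union_sdiff_of_subset hA'] at h4
      rw [h4]
      nlinarith

theorem incidences_le_of_card_le {n Δ : ℕ}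
    (h : ∀ (A : Finset ι) (B : Finset κ), A.card ≤ n → B.card ≤ n →
      incidences r A B ≤ Δ * (A.card + B.card)) (k : ℕ) (A : Finset ι) (B : Finset κ)
    (hA : A.card ≤ k * n) (hB : B.card ≤ k * n) :
    incidences r A B ≤ k * Δ * (A.card + B.card) := by
  have h1 : ∀ B : Finset κ, B.card ≤ n →
      incidences r A B ≤ (k * Δ) * B.card + Δ * A.card := by
    intro B hB
    have := incidences_le_of_left r B (b := Δ * B.card)
      (fun A hA => (h A B hA hB).trans (by rw [mul_add])) k A hA
    nlinarith
  have h2 := incidences_le_of_left (fun j i => r i j) A (fun B hB => by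
    rw [← incidences_comm r]; exact h1 B hB) k B hB
  rw [← incidences_comm] at h2
  nlinarith

theorem incidences_eq_erase_add {A : Finset ι} {i : ι} (hi : i ∈ A) (B : Finset κ) :
    incidences r A B = incidences r (A.erase i) B + (B.filter (r i)).card :=
  (Finset.sum_erase_add _ _ hi).symm

end

section

variable {K : Type*} [Field K] [Infinite K] {ι κ : Type*} {x α β : ι → K} {y γ δ : κ → K}

theorem incidences_meets_le (hx : Function.Injective x) (hy : Function.Injective y)
    {s₀ M : ℕ} (hs : 1 ≤ s₀) (hchar : ∀ r : ℕ, 0 < r → r ≤ 17 * s₀ → (r : K) ≠ 0)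
    (hM : ∀ j j', j ≠ j' → ∀ A : Finset ι, (∀ i ∈ A, Meets x α β y γ δ i j ∧
      Meets x α β y γ δ i j') → A.card ≤ M)
    (hM' : ∀ i i', i ≠ i' → ∀ B : Finset κ, (∀ j ∈ B, Meets x α β y γ δ i j ∧
      Meets x α β y γ δ i' j) → B.card ≤ M) (A : Finset ι) (B : Finset κ)
    (hA : A.card ≤ s₀ ^ 2) (hB : B.card ≤ s₀ ^ 2) :
    incidences (Meets x α β y γ δ) A B ≤ 80 * (s₀ + M) * (A.card + B.card) := by
  induction hn : A.card + B.card generalizing A B with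
  | zero =>
    have : A = ∅ := by rw [← Finset.card_eq_zero]; omega
    simp [this, incidences]
  | succ n ih =>
    rcases le_total B.card A.card with h | h
    · have hne : A.Nonempty := by rw [← Finset.card_pos]; omega
      obtain ⟨i, hi, hlt⟩ : ∃ i ∈ A, (B.filter fun j => Meets x α β y γ δ i j).card <
          80 * (s₀ + M) := by
        by_contra! hrich
        refine false_of_rich hx hy hs hne h hA hchar (fun j _ j' _ hjj => hM j j' hjj _ ?_) hrich
        intro i hi
        exact (Finset.mem_filter.1 hi).2
      have hc := Finset.card_erase_add_one hi
      have := ih (A.erase i) B (by omega) hB (by omega)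
      rw [incidences_eq_erase_add _ hi, mul_add_one]
      exact add_le_add this hlt.le
    · have hne : B.Nonempty := by rw [← Finset.card_pos]; omega
      have hsymm : ∀ i j, Meets y γ δ x α β j i ↔ Meets x α β y γ δ i j := fun i j => eq_comm
      obtain ⟨j, hj, hlt⟩ : ∃ j ∈ B, (A.filter fun i => Meets x α β y γ δ i j).card <
          80 * (s₀ + M) := by
        by_contra! hrich
        refine false_of_rich hy hx (α := γ) (β := δ) (γ := α) (δ := β) hs hne h hB hchar
          (fun i _ i' _ hii => hM' i i' hii _ ?_) (by simpa only [hsymm] using hrich)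
        intro j hj
        simpa only [hsymm] using (Finset.mem_filter.1 hj).2
      have hc := Finset.card_erase_add_one hj
      have := ih A (B.erase j) hA (by omega) (by omega)
      rw [incidences_comm] at this ⊢
      rw [incidences_eq_erase_add _ hj, mul_add_one]
      exact add_le_add this hlt.le

theorem incidences_meets_le_sqrt (hx : Function.Injective x) (hy : Function.Injective y)
    {N P M : ℕ} (hP : ∀ r : ℕ, 0 < r → r < P → (r : K) ≠ 0) (hNP : N ≤ P ^ 2)
    (hM : ∀ j j', j ≠ j' → ∀ A : Finset ι, (∀ i ∈ A, Meets x α β y γ δ i j ∧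
      Meets x α β y γ δ i j') → A.card ≤ M)
    (hM' : ∀ i i', i ≠ i' → ∀ B : Finset κ, (∀ j ∈ B, Meets x α β y γ δ i j ∧
      Meets x α β y γ δ i' j) → B.card ≤ M) (A : Finset ι) (B : Finset κ)
    (hA : A.card ≤ N) (hB : B.card ≤ N) :
    incidences (Meets x α β y γ δ) A B ≤
      1600000 * (N.sqrt + M) * (A.card + B.card) := by
  rcases Nat.eq_zero_or_pos N with rfl | hN
  · have : A = ∅ := by simpa using hA
    simp [this, incidences]
  have hs1 : 1 ≤ N.sqrt := Nat.sqrt_pos.2 hN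
  rcases lt_or_ge P 21 with h | h
  · have h1 := incidences_le_mul (Meets x α β y γ δ) A B
    have h2 : B.card ≤ 441 := by nlinarith
    have h3 : A.card * B.card ≤ A.card * 441 := Nat.mul_le_mul_left _ h2
    have h4 : 441 * A.card ≤ 1600000 * (N.sqrt + M) * A.card :=
      Nat.mul_le_mul_right _ (by omega)
    nlinarith
  · have hsP : N.sqrt ≤ P := by
      have := Nat.sqrt_le_sqrt hNP
      rwa [Nat.sqrt_eq'] at this
    have hN2 : N ≤ 10000 * (N.sqrt / 100 + 1) ^ 2 := by
      have h1 := Nat.lt_succ_sqrt' N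
      have h2 : N.sqrt + 1 ≤ 100 * (N.sqrt / 100 + 1) := by omega
      calc N ≤ (N.sqrt + 1) ^ 2 := h1.le
        _ ≤ (100 * (N.sqrt / 100 + 1)) ^ 2 := Nat.pow_le_pow_left h2 2
        _ = _ := by ring
    refine (incidences_le_of_card_le _ (fun A B hA hB => incidences_meets_le hx hy
      (s₀ := N.sqrt / 100 + 1) (by omega) (fun r h0 hr => hP r h0 (by omega)) hM hM' A B hA hB)
      10000 A B (hA.trans hN2) (hB.trans hN2)).trans ?_
    exact Nat.mul_le_mul_right _ (by omega)

end

theorem exists_eval_ne_zero {K τ : Type*} [Field K] [Infinite K] (S : Finset τ)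
    (q : τ → Polynomial K) (hq : ∀ t ∈ S, q t ≠ 0) : ∃ e, ∀ t ∈ S, (q t).eval e ≠ 0 := by
  by_contra! h
  have : ∏ t ∈ S, q t = 0 := by
    apply Polynomial.funext
    intro e
    obtain ⟨t, ht, h0⟩ := h e
    rw [Polynomial.eval_prod, Polynomial.eval_zero]
    exact Finset.prod_eq_zero ht h0
  obtain ⟨t, ht, h0⟩ := Finset.prod_eq_zero_iff.1 this
  exact hq t ht h0

/-- Incidence of the point `p` and the plane with coefficients `q`. -/
def PointPlane {F : Type*} [Field F] (p q : F × F × F) : Prop :=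
  p.2.2 + p.2.1 * q.1 = q.2.1 * p.1 + q.2.2

theorem incidences_univ {ι κ : Type*} (r : ι → κ → Prop) (A : Finset ι) (B : Finset κ) :
    incidences (fun (i : A) (j : B) => r i j) Finset.univ Finset.univ = incidences r A B := by
  simp only [incidences, Finset.card_filter]
  rw [← Finset.sum_coe_sort A]
  exact Finset.sum_congr rfl fun i _ => Finset.sum_coe_sort B fun j => if r i j then 1 else 0

section

variable {K : Type*} [Field K]

open Polynomial in
theorem exists_generic_parameter [Infinite K] (A B : Finset (K × K × K)) :
    ∃ e : K, (∀ p ∈ A, 1 - e ^ 3 * p.2.1 ≠ 0) ∧ (∀ q ∈ B, 1 - e ^ 2 * q.2.1 ≠ 0) ∧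
      (∀ p ∈ A, ∀ p' ∈ A, p ≠ p' → (p.1 - e * p.2.1 - e ^ 2 * p.2.2) * (1 - e ^ 3 * p'.2.1) ≠
        (p'.1 - e * p'.2.1 - e ^ 2 * p'.2.2) * (1 - e ^ 3 * p.2.1)) ∧
      ∀ q ∈ B, ∀ q' ∈ B, q ≠ q' → (q.1 - e * q.2.1 - e ^ 3 * q.2.2) * (1 - e ^ 2 * q'.2.1) ≠
        (q'.1 - e * q'.2.1 - e ^ 3 * q'.2.2) * (1 - e ^ 2 * q.2.1) := by
  obtain ⟨e, he⟩ := exists_eval_ne_zero (K := K)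
    ((A.disjSum B).disjSum ((A ×ˢ A).filter (fun t => t.1 ≠ t.2) |>.disjSum
      ((B ×ˢ B).filter fun t => t.1 ≠ t.2)))
    (Sum.elim (Sum.elim (fun p => 1 - X ^ 3 * C p.2.1) fun q => 1 - X ^ 2 * C q.2.1)
      (Sum.elim
        (fun t => (C t.1.1 - X * C t.1.2.1 - X ^ 2 * C t.1.2.2) * (1 - X ^ 3 * C t.2.2.1) -
          (C t.2.1 - X * C t.2.2.1 - X ^ 2 * C t.2.2.2) * (1 - X ^ 3 * C t.1.2.1))
        (fun t => (C t.1.1 - X * C t.1.2.1 - X ^ 3 * C t.1.2.2) * (1 - X ^ 2 * C t.2.2.1) -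
          (C t.2.1 - X * C t.2.2.1 - X ^ 3 * C t.2.2.2) * (1 - X ^ 2 * C t.1.2.1)))) (by
      rintro ((p | q) | (⟨p, p'⟩ | ⟨q, q'⟩)) ht h
      · have := congrArg (eval 0) h
        simp at this
      · have := congrArg (eval 0) h
        simp at this
      · simp only [Finset.inr_mem_disjSum, Finset.inl_mem_disjSum, Finset.mem_filter] at ht
        simp only [Sum.elim_inr, Sum.elim_inl] at h
        have h' : C (p.1 - p'.1) - C (p.2.1 - p'.2.1) * X ^ 1 - C (p.2.2 - p'.2.2) * X ^ 2 -
            C (p.1 * p'.2.1 - p'.1 * p.2.1) * X ^ 3 +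
            C (p.2.2 * p'.2.1 - p'.2.2 * p.2.1) * X ^ 5 = 0 := by
          rw [← h]; simp only [C_sub, C_mul]; ring
        have h0 := congrArg (coeff · 0) h'
        have h1 := congrArg (coeff · 1) h'
        have h2 := congrArg (coeff · 2) h'
        simp only [coeff_add, coeff_sub, coeff_C_mul, coeff_C, coeff_X_pow, coeff_zero] at h0 h1 h2
        norm_num at h0 h1 h2
        exact ht.2 (Prod.ext (sub_eq_zero.1 h0)
          (Prod.ext (sub_eq_zero.1 h1).symm (sub_eq_zero.1 h2).symm))
      · simp only [Finset.inr_mem_disjSum, Finset.mem_filter] at ht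
        simp only [Sum.elim_inr] at h
        have h' : C (q.1 - q'.1) - C (q.2.1 - q'.2.1) * X ^ 1 -
            C (q.1 * q'.2.1 - q'.1 * q.2.1) * X ^ 2 - C (q.2.2 - q'.2.2) * X ^ 3 +
            C (q.2.2 * q'.2.1 - q'.2.2 * q.2.1) * X ^ 5 = 0 := by
          rw [← h]; simp only [C_sub, C_mul]; ring
        have h0 := congrArg (coeff · 0) h'
        have h1 := congrArg (coeff · 1) h'
        have h3 := congrArg (coeff · 3) h'
        simp only [coeff_add, coeff_sub, coeff_C_mul, coeff_C, coeff_X_pow, coeff_zero] at h0 h1 h3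
        norm_num at h0 h1 h3
        exact ht.2 (Prod.ext (sub_eq_zero.1 h0)
          (Prod.ext (sub_eq_zero.1 h1).symm (sub_eq_zero.1 h3).symm)))
  refine ⟨e, fun p hp => ?_, fun q hq => ?_, fun p hp p' hp' hne => ?_, fun q hq q' hq' hne => ?_⟩
  · simpa only [Sum.elim_inl, Sum.elim_inr, eval_sub, eval_mul, eval_pow, eval_X, eval_C,
      eval_one] using he (.inl (.inl p)) (by simpa using hp)
  · simpa only [Sum.elim_inl, Sum.elim_inr, eval_sub, eval_mul, eval_pow, eval_X, eval_C,
      eval_one] using he (.inl (.inr q)) (by simpa using hq)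
  · have := he (.inr (.inl (p, p'))) (by simpa using ⟨⟨hp, hp'⟩, hne⟩)
    exact sub_ne_zero.1 (by simpa only [Sum.elim_inl, Sum.elim_inr, eval_sub, eval_mul, eval_pow,
      eval_X, eval_C, eval_one] using this)
  · have := he (.inr (.inr (q, q'))) (by simpa using ⟨⟨hq, hq'⟩, hne⟩)
    exact sub_ne_zero.1 (by simpa only [Sum.elim_inl, Sum.elim_inr, eval_sub, eval_mul, eval_pow,
      eval_X, eval_C, eval_one] using this)

theorem incidences_pointPlane_le_of_infinite [Infinite K] {A B : Finset (K × K × K)} {N P M : ℕ}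
    (hP : ∀ r : ℕ, 0 < r → r < P → (r : K) ≠ 0) (hNP : N ≤ P ^ 2)
    (hM : ∀ q ∈ B, ∀ q' ∈ B, q ≠ q' → ∀ S ⊆ A, (∀ p ∈ S, PointPlane p q ∧ PointPlane p q') →
      S.card ≤ M)
    (hM' : ∀ p ∈ A, ∀ p' ∈ A, p ≠ p' → ∀ S ⊆ B, (∀ q ∈ S, PointPlane p q ∧ PointPlane p' q) →
      S.card ≤ M) (hA : A.card ≤ N) (hB : B.card ≤ N) :
    incidences PointPlane A B ≤ 1600000 * (N.sqrt + M) * (A.card + B.card) := by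
  obtain ⟨e, h1, h2, h3, h4⟩ := exists_generic_parameter A B
  let x : A → K := fun p => (p.1.1 - e * p.1.2.1 - e ^ 2 * p.1.2.2) / (1 - e ^ 3 * p.1.2.1)
  let α : A → K := fun p => p.1.2.2 / (1 - e ^ 3 * p.1.2.1)
  let β : A → K := fun p => p.1.2.1 / (1 - e ^ 3 * p.1.2.1)
  let y : B → K := fun q => (q.1.1 - e * q.1.2.1 - e ^ 3 * q.1.2.2) / (1 - e ^ 2 * q.1.2.1)
  let γ : B → K := fun q => q.1.2.2 / (1 - e ^ 2 * q.1.2.1)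
  let δ : B → K := fun q => q.1.2.1 / (1 - e ^ 2 * q.1.2.1)
  have hx : Function.Injective x := by
    intro p p' h
    by_contra hne
    exact h3 p p.2 p' p'.2 (fun h => hne (Subtype.ext h))
      ((div_eq_div_iff (h1 p p.2) (h1 p' p'.2)).1 h)
  have hy : Function.Injective y := by
    intro q q' h
    by_contra hne
    exact h4 q q.2 q' q'.2 (fun h => hne (Subtype.ext h))
      ((div_eq_div_iff (h2 q q.2) (h2 q' q'.2)).1 h)
  have hr : Meets x α β y γ δ = fun (p : A) (q : B) => PointPlane (p : K × K × K) q := by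
    funext p q
    have hp := h1 p p.2
    have hq := h2 q q.2
    simp only [Meets, PointPlane, x, α, β, y, γ, δ, eq_iff_iff]
    rw [div_mul_div_comm, div_mul_div_comm, div_add_div _ _ hp (mul_ne_zero hp hq),
      div_add_div _ _ hq (mul_ne_zero hq hp),
      div_eq_div_iff (mul_ne_zero hp (mul_ne_zero hp hq)) (mul_ne_zero hq (mul_ne_zero hq hp))]
    have hpq : (1 - e ^ 3 * p.1.2.1) ^ 2 * (1 - e ^ 2 * q.1.2.1) ^ 2 ≠ 0 := by positivity
    constructor
    · intro h
      apply mul_left_cancel₀ hpq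
      linear_combination h
    · intro h
      linear_combination (1 - e ^ 3 * p.1.2.1) ^ 2 * (1 - e ^ 2 * q.1.2.1) ^ 2 * h
  have := incidences_meets_le_sqrt (α := α) (β := β) (γ := γ) (δ := δ) hx hy hP hNP (M := M)
    (fun q q' hne S hS => ?_) (fun p p' hne S hS => ?_) Finset.univ Finset.univ
    (by simpa using hA) (by simpa using hB)
  · rw [hr, incidences_univ PointPlane] at this
    simpa using this
  · rw [hr] at hS
    rw [← Finset.card_map (Function.Embedding.subtype _)]
    refine hM q q.2 q' q'.2 (fun h => hne (Subtype.ext h)) _ ?_ ?_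
    · intro p hp
      simp at hp
      exact hp.1
    · intro p hp
      obtain ⟨t, ht, rfl⟩ := Finset.mem_map.1 hp
      exact hS t ht
  · rw [hr] at hS
    rw [← Finset.card_map (Function.Embedding.subtype _)]
    refine hM' p p.2 p' p'.2 (fun h => hne (Subtype.ext h)) _ ?_ ?_
    · intro p hp
      simp at hp
      exact hp.1
    · intro p hp
      obtain ⟨t, ht, rfl⟩ := Finset.mem_map.1 hp
      exact hS t ht

end

theorem incidences_pointPlane_le {F : Type*} [Field F] {A B : Finset (F × F × F)} {N P M : ℕ}
    (hP : ∀ r : ℕ, 0 < r → r < P → (r : F) ≠ 0) (hNP : N ≤ P ^ 2)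
    (hM : ∀ q ∈ B, ∀ q' ∈ B, q ≠ q' → ∀ S ⊆ A, (∀ p ∈ S, PointPlane p q ∧ PointPlane p q') →
      S.card ≤ M)
    (hM' : ∀ p ∈ A, ∀ p' ∈ A, p ≠ p' → ∀ S ⊆ B, (∀ q ∈ S, PointPlane p q ∧ PointPlane p' q) →
      S.card ≤ M) (hA : A.card ≤ N) (hB : B.card ≤ N) :
    incidences PointPlane A B ≤ 1600000 * (N.sqrt + M) * (A.card + B.card) := by
  let K := AlgebraicClosure F
  have : Infinite K := IsAlgClosed.instInfinite
  let i : F →+* K := algebraMap F K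
  have hi : Function.Injective i := i.injective
  let f : F × F × F ↪ K × K × K := ⟨Prod.map i (Prod.map i i), hi.prodMap (hi.prodMap hi)⟩
  have hr : ∀ p q, PointPlane (f p) (f q) ↔ PointPlane p q := by
    intro p q
    simp only [PointPlane, f, Function.Embedding.coeFn_mk, Prod.map_fst, Prod.map_snd,
      ← map_mul, ← map_add, hi.eq_iff]
  have hinc : incidences PointPlane (A.map f) (B.map f) = incidences PointPlane A B := by
    simp only [incidences, Finset.sum_map, Finset.filter_map, Finset.card_map]
    simp only [Function.comp_def, hr]
  have hS : ∀ (A : Finset (F × F × F)) (S : Finset (K × K × K)), S ⊆ A.map f →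
      ∃ S' ⊆ A, S = S'.map f := by
    intro A S hS
    refine ⟨A.filter fun p => f p ∈ S, Finset.filter_subset _ _, ?_⟩
    ext p
    simp only [Finset.mem_map, Finset.mem_filter]
    constructor
    · intro hp
      obtain ⟨p, hp', rfl⟩ := Finset.mem_map.1 (hS hp)
      exact ⟨p, ⟨hp', hp⟩, rfl⟩
    · rintro ⟨p, ⟨-, hp⟩, rfl⟩
      exact hp
  rw [← hinc, ← Finset.card_map f, ← Finset.card_map (s := B) f]
  refine incidences_pointPlane_le_of_infinite (P := P) (fun r h0 hr => ?_) hNP ?_ ?_ (by simpa)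
    (by simpa)
  · rw [← map_natCast i, Ne, map_eq_zero]
    exact hP r h0 hr
  · intro q hq q' hq' hne S hSA hSr
    obtain ⟨t, ht, rfl⟩ := Finset.mem_map.1 hq
    obtain ⟨t', ht', rfl⟩ := Finset.mem_map.1 hq'
    obtain ⟨S, hSA', rfl⟩ := hS _ _ hSA
    rw [Finset.card_map]
    refine hM t ht t' ht' (fun h => hne (by rw [h])) S hSA' fun p hp => ?_
    simpa only [hr] using hSr (f p) (Finset.mem_map_of_mem f hp)
  · intro q hq q' hq' hne S hSA hSr
    obtain ⟨t, ht, rfl⟩ := Finset.mem_map.1 hq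
    obtain ⟨t', ht', rfl⟩ := Finset.mem_map.1 hq'
    obtain ⟨S, hSA', rfl⟩ := hS _ _ hSA
    rw [Finset.card_map]
    refine hM' t ht t' ht' (fun h => hne (by rw [h])) S hSA' fun p hp => ?_
    simpa only [hr] using hSr (f p) (Finset.mem_map_of_mem f hp)

section

variable {F : Type*} [Field F]

theorem PointPlane.symm {p q : F × F × F} (h : PointPlane p q) : PointPlane q p := by
  unfold PointPlane at *
  linear_combination -h

theorem card_le_of_pointPlane {L : Finset (F × F)} {M : ℕ}
    (hM : ∀ S ⊆ L, Collinear F (S : Set (F × F)) → S.card ≤ M) {S : Finset (F × F × F)}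
    (hS : ∀ p ∈ S, p.1 ≠ 0 ∧ (p.1⁻¹, p.2.2 / p.1) ∈ L) {q q' : F × F × F} (hq : q.1 ≠ 0)
    (hne : q ≠ q') (h : ∀ p ∈ S, PointPlane p q ∧ PointPlane p q') : S.card ≤ M := by
  rcases S.eq_empty_or_nonempty with rfl | hSne
  · simp
  have hinj : Set.InjOn (fun p : F × F × F => (p.1⁻¹, p.2.2 / p.1)) S := by
    intro p hp p' hp' he
    obtain ⟨h1, h3⟩ := Prod.ext_iff.1 he
    have h1 : p.1 = p'.1 := inv_injective h1
    have h3 : p.2.2 = p'.2.2 := by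
      simp only [h1] at h3
      exact (div_left_inj' (hS p' hp').1).1 h3
    refine Prod.ext h1 (Prod.ext (mul_right_cancel₀ hq ?_) h3)
    have e := (h p hp).1
    have e' := (h p' hp').1
    unfold PointPlane at e e'
    linear_combination e - e' - h3 + q.2.1 * h1
  rw [← Finset.card_image_of_injOn hinj]
  refine hM _ (Finset.image_subset_iff.2 fun p hp => (hS p hp).2) ?_
  rw [collinear_iff_exists_forall_eq_smul_vadd]
  by_cases h1 : q.1 = q'.1
  · have h2 : q.2.1 - q'.2.1 ≠ 0 := by
      intro h2
      obtain ⟨p, hp⟩ := hSne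
      have e := (h p hp).1
      have e' := (h p hp).2
      unfold PointPlane at e e'
      exact hne (Prod.ext h1 (Prod.ext (sub_eq_zero.1 h2)
        (by linear_combination e' - e + p.2.1 * h1 - p.1 * h2)))
    refine ⟨((-(q.2.2 - q'.2.2) / (q.2.1 - q'.2.1))⁻¹, 0), (0, 1), ?_⟩
    rintro _ hp
    simp only [Finset.coe_image, Set.mem_image, Finset.mem_coe] at hp
    obtain ⟨p, hp, rfl⟩ := hp
    refine ⟨p.2.2 / p.1, ?_⟩
    have e := (h p hp).1
    have e' := (h p hp).2
    unfold PointPlane at e e'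
    have : p.1 = -(q.2.2 - q'.2.2) / (q.2.1 - q'.2.1) := by
      rw [eq_div_iff h2]
      linear_combination e' - e + p.2.1 * h1
    simp [this]
  · have h1 : q'.1 - q.1 ≠ 0 := fun h => h1 (sub_eq_zero.1 h).symm
    refine ⟨(0, (q.2.1 * q'.1 - q'.2.1 * q.1) / (q'.1 - q.1)),
      (1, (q.2.2 * q'.1 - q'.2.2 * q.1) / (q'.1 - q.1)), ?_⟩
    rintro _ hp
    simp only [Finset.coe_image, Set.mem_image, Finset.mem_coe] at hp
    obtain ⟨p, hp, rfl⟩ := hp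
    refine ⟨p.1⁻¹, ?_⟩
    have e := (h p hp).1
    have e' := (h p hp).2
    unfold PointPlane at e e'
    have h0 := (hS p hp).1
    simp only [vadd_eq_add, Prod.smul_mk, smul_eq_mul, Prod.mk_add_mk, mul_one, add_zero]
    refine Prod.ext rfl ?_
    field_simp
    linear_combination q'.1 * e - q.1 * e'

theorem mul_eq_mul_and_pointPlane_of_comp_eq {l₁ l₂ l₃ l₄ : F × F} (h₁ : l₁.1 ≠ 0) (h₂ : l₂.1 ≠ 0)
    (h₄ : l₄.1 ≠ 0) (h : affMap l₁ ∘ affInv l₂ = affMap l₃ ∘ affInv l₄) :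
    l₁.1 * l₄.1 = l₂.1 * l₃.1 ∧
      PointPlane (l₁.1⁻¹, l₄.2, l₁.2 / l₁.1) (l₂.1⁻¹, l₃.2, l₂.2 / l₂.1) := by
  have e0 := congrFun h 0
  have e1 := congrFun h 1
  simp only [Function.comp_apply, affMap, affInv] at e0 e1
  have ht : l₁.1 * l₄.1 = l₂.1 * l₃.1 := by
    field_simp at e0 e1
    have := congrArg₂ (· - ·) e1 e0
    linear_combination this
  refine ⟨ht, ?_⟩
  unfold PointPlane
  field_simp at e0 ⊢
  apply mul_right_cancel₀ h₄
  linear_combination e0 + l₄.2 * ht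

/-- The points encoding the pairs of elements of `L` with product of slopes `t`. -/
noncomputable def fiber (L : Finset (F × F)) (t : F) : Finset (F × F × F) :=
  ((L ×ˢ L).filter fun w => w.1.1 * w.2.1 = t).image fun w => (w.1.1⁻¹, w.2.2, w.1.2 / w.1.1)

theorem affEnergy_le_sum_incidences {L : Finset (F × F)} (hL : ∀ l ∈ L, l.1 ≠ 0) :
    affEnergy L ≤ ∑ t ∈ (L ×ˢ L).image fun w => w.1.1 * w.2.1,
      incidences PointPlane (fiber L t) (fiber L t) := by
  unfold affEnergy
  rw [Finset.card_eq_sum_card_fiberwise (f := fun q => q.1.1.1 * q.2.2.1)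
    (t := (L ×ˢ L).image fun w => w.1.1 * w.2.1)]
  · refine Finset.sum_le_sum fun t _ => ?_
    have hinc : incidences PointPlane (fiber L t) (fiber L t) =
        ((fiber L t ×ˢ fiber L t).filter fun w => PointPlane w.1 w.2).card := by
      simp only [incidences, Finset.card_filter, Finset.sum_product]
    rw [hinc]
    refine Finset.card_le_card_of_injOn (fun q => ((q.1.1.1⁻¹, q.2.2.2, q.1.1.2 / q.1.1.1),
      (q.1.2.1⁻¹, q.2.1.2, q.1.2.2 / q.1.2.1))) ?_ ?_
    · rintro ⟨⟨l₁, l₂⟩, l₃, l₄⟩ hq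
      simp only [Finset.coe_filter, Finset.mem_filter, Finset.mem_product,
        Set.mem_ofPred_eq] at hq
      obtain ⟨⟨⟨⟨h₁, h₂⟩, h₃, h₄⟩, he⟩, ht⟩ := hq
      obtain ⟨e, hpp⟩ := mul_eq_mul_and_pointPlane_of_comp_eq (hL _ h₁) (hL _ h₂) (hL _ h₄) he
      simp only [Finset.coe_filter, Finset.mem_product, Set.mem_ofPred_eq]
      refine ⟨⟨Finset.mem_image.2 ⟨(l₁, l₄), ?_, rfl⟩, Finset.mem_image.2 ⟨(l₂, l₃), ?_, rfl⟩⟩, hpp⟩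
      · simp [h₁, h₄, ht]
      · simp [h₂, h₃, ← e, ht]
    · rintro ⟨⟨l₁, l₂⟩, l₃, l₄⟩ hq ⟨⟨k₁, k₂⟩, k₃, k₄⟩ hk heq
      simp only [Finset.coe_filter, Finset.mem_filter, Finset.mem_product,
        Set.mem_ofPred_eq] at hq hk
      obtain ⟨⟨⟨⟨h₁, h₂⟩, h₃, h₄⟩, he⟩, ht⟩ := hq
      obtain ⟨⟨⟨⟨g₁, g₂⟩, g₃, g₄⟩, ge⟩, gt⟩ := hk
      obtain ⟨e, -⟩ := mul_eq_mul_and_pointPlane_of_comp_eq (hL _ h₁) (hL _ h₂) (hL _ h₄) he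
      obtain ⟨f, -⟩ := mul_eq_mul_and_pointPlane_of_comp_eq (hL _ g₁) (hL _ g₂) (hL _ g₄) ge
      simp only [Prod.mk.injEq, inv_inj] at heq
      obtain ⟨⟨a1, b4, b1⟩, a2, b3, b2⟩ := heq
      rw [a1, div_left_inj' (hL _ g₁)] at b1
      rw [a2, div_left_inj' (hL _ g₂)] at b2
      have a4 : l₄.1 = k₄.1 := mul_left_cancel₀ (hL _ g₁) (by rw [gt, ← a1, ht])
      have a3 : l₃.1 = k₃.1 := mul_left_cancel₀ (hL _ g₂) (by rw [← f, gt, ← a2, ← e, ht])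
      rw [Prod.ext a1 b1, Prod.ext a2 b2, Prod.ext a3 b3, Prod.ext a4 b4]
  · rintro ⟨⟨l₁, l₂⟩, l₃, l₄⟩ hq
    simp only [Finset.coe_filter, Finset.mem_product, Set.mem_ofPred_eq] at hq
    exact Finset.mem_coe.2 (Finset.mem_image.2
      ⟨(l₁, l₄), Finset.mem_product.2 ⟨hq.1.1.1, hq.1.2.2⟩, rfl⟩)

theorem card_fiber_le {L : Finset (F × F)} {m : ℕ} (hL : ∀ l ∈ L, l.1 ≠ 0)
    (hm : ∀ a, (L.filter fun l => l.1 = a).card ≤ m) (t : F) : (fiber L t).card ≤ m * L.card := by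
  refine Finset.card_image_le.trans ?_
  refine Finset.card_le_mul_card_image_of_maps_to (f := Prod.snd) (t := L)
    (fun w hw => (Finset.mem_product.1 (Finset.mem_filter.1 hw).1).2) m fun l hl => ?_
  refine le_trans (Finset.card_le_card_of_injOn Prod.fst ?_ ?_) (hm (t / l.1))
  · intro w hw
    simp only [Finset.coe_filter, Finset.mem_filter, Finset.mem_product, Set.mem_ofPred_eq] at hw ⊢
    obtain ⟨⟨⟨h, -⟩, ht⟩, rfl⟩ := hw
    exact ⟨h, (eq_div_iff (hL _ hl)).2 ht⟩
  · intro w hw w' hw' h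
    simp only [Finset.coe_filter, Set.mem_ofPred_eq] at hw hw'
    exact Prod.ext h (hw.2.trans hw'.2.symm)

theorem sum_card_fiber_le (L : Finset (F × F)) :
    ∑ t ∈ (L ×ˢ L).image fun w => w.1.1 * w.2.1, (fiber L t).card ≤ L.card ^ 2 := by
  rw [sq, ← Finset.card_product, Finset.card_eq_sum_card_image fun w : (F × F) × F × F =>
    w.1.1 * w.2.1]
  exact Finset.sum_le_sum fun t _ => Finset.card_image_le

theorem affEnergy_le {L : Finset (F × F)} {m M P : ℕ} (hP : ∀ r : ℕ, 0 < r → r < P → (r : F) ≠ 0)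
    (hmP : m * L.card ≤ P ^ 2) (hL : ∀ l ∈ L, l.1 ≠ 0)
    (hM : ∀ S ⊆ L, Collinear F (S : Set (F × F)) → S.card ≤ M)
    (hm : ∀ a, (L.filter fun l => l.1 = a).card ≤ m) :
    affEnergy L ≤ 3200000 * ((m * L.card).sqrt + M) * L.card ^ 2 := by
  have hfib : ∀ t, ∀ p ∈ fiber L t, p.1 ≠ 0 ∧ (p.1⁻¹, p.2.2 / p.1) ∈ L := by
    intro t p hp
    obtain ⟨w, hw, rfl⟩ := Finset.mem_image.1 hp
    have hw := (Finset.mem_product.1 (Finset.mem_filter.1 hw).1).1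
    have h0 := hL _ hw
    refine ⟨inv_ne_zero h0, ?_⟩
    simpa [h0] using hw
  calc affEnergy L
      ≤ ∑ t ∈ (L ×ˢ L).image fun w => w.1.1 * w.2.1,
          incidences PointPlane (fiber L t) (fiber L t) := affEnergy_le_sum_incidences hL
    _ ≤ ∑ t ∈ (L ×ˢ L).image fun w => w.1.1 * w.2.1,
          1600000 * ((m * L.card).sqrt + M) * ((fiber L t).card + (fiber L t).card) :=
        Finset.sum_le_sum fun t _ => incidences_pointPlane_le hP hmP
          (fun q hq q' _ hne S hS h => card_le_of_pointPlane hM (fun p hp => hfib t p (hS hp))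
            (hfib t q hq).1 hne h)
          (fun q hq q' _ hne S hS h => card_le_of_pointPlane hM (fun p hp => hfib t p (hS hp))
            (hfib t q hq).1 hne fun p hp => ⟨(h p hp).1.symm, (h p hp).2.symm⟩)
          (card_fiber_le hL hm t) (card_fiber_le hL hm t)
    _ = 3200000 * ((m * L.card).sqrt + M) *
          ∑ t ∈ (L ×ˢ L).image fun w => w.1.1 * w.2.1, (fiber L t).card := by
        rw [← Finset.mul_sum, Finset.sum_add_distrib]
        ring
    _ ≤ _ := Nat.mul_le_mul_left _ (sum_card_fiber_le L)

theorem affEnergy_le_rpow {L : Finset (F × F)} {m M P : ℕ}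
    (hP : ∀ r : ℕ, 0 < r → r < P → (r : F) ≠ 0)
    (hmP : m * L.card ≤ P ^ 2) (hL : ∀ l ∈ L, l.1 ≠ 0)
    (hM : ∀ S ⊆ L, Collinear F (S : Set (F × F)) → S.card ≤ M)
    (hm : ∀ a, (L.filter fun l => l.1 = a).card ≤ m) :
    (affEnergy L : ℝ) ≤ 3200000 * ((m : ℝ) ^ (1 / 2 : ℝ) * (L.card : ℝ) ^ (5 / 2 : ℝ) +
      (M : ℝ) * (L.card : ℝ) ^ 2) := by
  have h : (affEnergy L : ℝ) ≤ 3200000 * (((m * L.card).sqrt : ℕ) + M) * (L.card : ℝ) ^ 2 := by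
    exact_mod_cast affEnergy_le hP hmP hL hM hm
  have hs : (((m * L.card).sqrt : ℕ) : ℝ) ≤ (m : ℝ) ^ (1 / 2 : ℝ) * (L.card : ℝ) ^ (1 / 2 : ℝ) := by
    rw [← Real.mul_rpow (by positivity) (by positivity), ← Real.sqrt_eq_rpow, ← Nat.cast_mul]
    exact Real.nat_sqrt_le_real_sqrt
  have h5 : (L.card : ℝ) ^ (5 / 2 : ℝ) = (L.card : ℝ) ^ (1 / 2 : ℝ) * (L.card : ℝ) ^ 2 := by
    rw [← Real.rpow_natCast, ← Real.rpow_add_of_nonneg (by positivity) (by norm_num) (by norm_num)]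
    norm_num
  rw [h5]
  calc (affEnergy L : ℝ) ≤ _ := h
    _ ≤ 3200000 * ((m : ℝ) ^ (1 / 2 : ℝ) * (L.card : ℝ) ^ (1 / 2 : ℝ) + M) *
        (L.card : ℝ) ^ 2 := by gcongr
    _ = _ := by ring

end

end AffineEnergy

theorem stmt17 :
    ∃ C : ℝ, 0 < C ∧
      ((∀ (L : Finset (ℝ × ℝ)) (m M : ℕ), (∀ l ∈ L, l.1 ≠ 0) →
          (∀ S : Finset (ℝ × ℝ), S ⊆ L → Collinear ℝ (S : Set (ℝ × ℝ)) → S.card ≤ M) →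
          (∀ a : ℝ, (L.filter fun l => l.1 = a).card ≤ m) →
          (affEnergy L : ℝ) ≤
            C * ((m : ℝ) ^ (1 / 2 : ℝ) * (L.card : ℝ) ^ (5 / 2 : ℝ) +
              (M : ℝ) * (L.card : ℝ) ^ 2)) ∧
        ∀ (p : ℕ) [Fact p.Prime] (L : Finset (ZMod p × ZMod p)) (m M : ℕ),
          (∀ l ∈ L, l.1 ≠ 0) →
          (∀ S : Finset (ZMod p × ZMod p), S ⊆ L →
            Collinear (ZMod p) (S : Set (ZMod p × ZMod p)) → S.card ≤ M) →
          (∀ a : ZMod p, (L.filter fun l => l.1 = a).card ≤ m) →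
          m * L.card ≤ p ^ 2 →
          (affEnergy L : ℝ) ≤
            C * ((m : ℝ) ^ (1 / 2 : ℝ) * (L.card : ℝ) ^ (5 / 2 : ℝ) +
              (M : ℝ) * (L.card : ℝ) ^ 2)) := by
  refine ⟨3200000, by norm_num, fun L m M hL hM hm => ?_, fun p _ L m M hL hM hm hmp => ?_⟩
  · refine AffineEnergy.affEnergy_le_rpow (P := m * L.card)
      (fun r hr _ => Nat.cast_ne_zero.2 hr.ne') (Nat.le_self_pow two_ne_zero _) hL hM hm
  · refine AffineEnergy.affEnergy_le_rpow (P := p) (fun r hr hrp h => ?_) hmp hL hM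
      fun a => by convert hm a
    exact absurd (Nat.le_of_dvd hr ((ZMod.natCast_eq_zero_iff r p).1 h)) hrp.not_ge
end

section
/- Let k ≥ 2 be an integer, M ≥ 1 a real number, p a prime, and A, B ⊆ 𝔽_p sets with |AB| ≤ M|A| and |B| ≳_k M^{2^{k+1}}. Then T⁺_{2^k}(A) ≲_k M^{2^{k+1}} ( |A|^{2^{k+1}}/p + |A|^{2^{k+1}−1} · |B|^{−(k−1)/2} ). -/
open scoped Classical Pointwise

section PolynomialMethod

open MvPolynomial

lemma natDegree_aeval_le_totalDegree {σ K : Type*} [Field K] (g : σ → Polynomial K)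
    (hg : ∀ i, (g i).natDegree ≤ 1) (P : MvPolynomial σ K) :
    (aeval g P).natDegree ≤ P.totalDegree := by
  rw [aeval_def, eval₂_eq]
  refine Polynomial.natDegree_sum_le_of_forall_le _ _ fun m hm => ?_
  refine (Polynomial.natDegree_C_mul_le _ _).trans ?_
  refine (Polynomial.natDegree_prod_le _ _).trans (le_trans ?_ (le_totalDegree hm))
  refine Finset.sum_le_sum fun i _ => Polynomial.natDegree_pow_le.trans ?_
  nlinarith [hg i]

lemma derivative_aeval_eq_sum {σ K : Type*} [Fintype σ] [Field K] (g : σ → Polynomial K)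
    (P : MvPolynomial σ K) :
    Polynomial.derivative (aeval g P) =
      ∑ i, aeval g (pderiv i P) * Polynomial.derivative (g i) := by
  induction P using MvPolynomial.induction_on with
  | C a => simp
  | add p q hp hq => simp [hp, hq, add_mul, Finset.sum_add_distrib]
  | mul_X p i hp =>
    have h : ∀ j, aeval g (pderiv j (p * X i)) * Polynomial.derivative (g j) =
        aeval g (pderiv j p) * Polynomial.derivative (g j) * g i
          + if j = i then aeval g p * Polynomial.derivative (g i) else 0 := by
      intro j
      rw [pderiv_mul, map_add, map_mul, map_mul, aeval_X]
      rcases eq_or_ne j i with rfl | hji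
      · rw [pderiv_X_self, map_one, if_pos rfl]
        ring
      · rw [pderiv_X_of_ne hji.symm, map_zero, if_neg hji]
        ring
    rw [map_mul, Polynomial.derivative_mul, hp, aeval_X, Finset.sum_congr rfl fun j _ => h j,
      Finset.sum_add_distrib, Finset.sum_mul]
    simp

lemma pderiv_pderiv_comm {σ K : Type*} [Field K] (i j : σ) (P : MvPolynomial σ K) :
    pderiv i (pderiv j P) = pderiv j (pderiv i P) := by
  ext m
  rcases eq_or_ne i j with rfl | hij
  · rfl
  · simp only [coeff_pderiv, Finsupp.add_apply, Finsupp.single_eq_of_ne hij,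
      Finsupp.single_eq_of_ne hij.symm, add_right_comm m (Finsupp.single i 1), Nat.cast_add]
    simp
    ring

lemma totalDegree_pderiv_add_one_le {σ K : Type*} [Field K] (i : σ) (P : MvPolynomial σ K)
    (h : pderiv i P ≠ 0) : (pderiv i P).totalDegree + 1 ≤ P.totalDegree := by
  have key : ∀ m ∈ (pderiv i P).support, (m.sum fun _ e => e) + 1 ≤ P.totalDegree := by
    intro m hm
    have h1 : m + Finsupp.single i 1 ∈ P.support := by
      rw [mem_support_iff, coeff_pderiv] at hm
      exact mem_support_iff.2 (left_ne_zero_of_mul hm)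
    have h2 := le_totalDegree h1
    rwa [Finsupp.sum_add_index' (fun _ => rfl) (fun _ _ _ => rfl),
      Finsupp.sum_single_index rfl] at h2
  obtain ⟨m, hm⟩ := Finset.nonempty_iff_ne_empty.2 (mt support_eq_empty.1 h)
  have h1 : 1 ≤ P.totalDegree := (Nat.le_add_left _ _).trans (key m hm)
  have : (pderiv i P).totalDegree ≤ P.totalDegree - 1 :=
    Finset.sup_le fun m hm => Nat.le_sub_of_add_le (key m hm)
  omega

lemma totalDegree_pderiv_le {σ K : Type*} [Field K] (i : σ) (P : MvPolynomial σ K) :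
    (pderiv i P).totalDegree ≤ P.totalDegree := by
  by_cases h : pderiv i P = 0
  · simp [h]
  · have := totalDegree_pderiv_add_one_le i P h
    omega

/-- A polynomial whose degree is below the characteristic and whose partial derivatives all vanish
is constant. -/
lemma totalDegree_eq_zero_of_pderiv_eq_zero {σ K : Type*} [Field K] (P : MvPolynomial σ K)
    (hchar : ∀ m : ℕ, 0 < m → m ≤ P.totalDegree → (m : K) ≠ 0) (h : ∀ i, pderiv i P = 0) :
    P.totalDegree = 0 := by
  refine Nat.le_zero.1 (Finset.sup_le fun m hm => Nat.le_zero.2 ?_)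
  by_contra hne
  obtain ⟨i, hi⟩ : ∃ i, m i ≠ 0 := by
    by_contra! hall
    exact hne (Finset.sum_eq_zero fun i _ => hall i)
  have hle : m i ≤ P.totalDegree :=
    le_trans (Finset.single_le_sum (f := fun j => m j) (fun j _ => Nat.zero_le _)
      (Finsupp.mem_support_iff.2 hi)) (le_totalDegree hm)
  have hc := congrArg (coeff (m - Finsupp.single i 1)) (h i)
  have hm' : m - Finsupp.single i 1 + Finsupp.single i 1 = m :=
    tsub_add_cancel_of_le (Finsupp.single_le_iff.2 (Nat.one_le_iff_ne_zero.2 hi))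
  rw [coeff_pderiv, hm', coeff_zero, mul_eq_zero] at hc
  rcases hc with hc | hc
  · exact mem_support_iff.1 hm hc
  · apply hchar (m i) (Nat.pos_of_ne_zero hi) hle
    rw [← hc, Finsupp.tsub_apply, Finsupp.single_eq_same, ← Nat.cast_add_one,
      Nat.sub_add_cancel (Nat.one_le_iff_ne_zero.2 hi)]

/-- Parameter counting: finitely many lines (given by parametrisations of degree at most one) lie
on a common surface whose degree is controlled by their number. -/
lemma exists_ne_zero_vanishing {K : Type*} [Field K] (G : Finset (Fin 3 → Polynomial K))
    (hG : ∀ g ∈ G, ∀ i, (g i).natDegree ≤ 1) (e : ℕ) (he : G.card * (3 * e + 1) < (e + 1) ^ 3) :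
    ∃ P : MvPolynomial (Fin 3) K, P ≠ 0 ∧ P.totalDegree ≤ 3 * e ∧ ∀ g ∈ G, aeval g P = 0 := by
  let mon : (Fin 3 → Fin (e + 1)) → (Fin 3 →₀ ℕ) := fun f =>
    Finsupp.equivFunOnFinite.symm fun i => (f i : ℕ)
  have hmon : Function.Injective mon := fun f g h => by
    funext i
    exact Fin.ext (congrArg (fun m : Fin 3 →₀ ℕ => m i) h)
  let Φ : ((Fin 3 → Fin (e + 1)) → K) →ₗ[K] MvPolynomial (Fin 3) K :=
    ∑ f, (monomial (mon f)).comp (LinearMap.proj f)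
  have hΦ : ∀ c, Φ c = ∑ f, monomial (mon f) (c f) := fun c => by simp [Φ]
  have hdeg : ∀ c, (Φ c).totalDegree ≤ 3 * e := by
    intro c
    rw [hΦ]
    refine (totalDegree_finsetSum _ _).trans (Finset.sup_le fun f _ => ?_)
    refine (totalDegree_monomial_le _ _).trans ?_
    rw [Finsupp.sum_fintype _ _ fun _ => rfl]
    refine (Finset.sum_le_card_nsmul Finset.univ _ e fun i _ => ?_).trans (by simp)
    exact Nat.lt_succ_iff.1 (f i).2
  let Ψ : MvPolynomial (Fin 3) K →ₗ[K] (G × Fin (3 * e + 1) → K) :=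
    LinearMap.pi fun q => (Polynomial.lcoeff K q.2).comp (aeval q.1.1).toLinearMap
  have hker : LinearMap.ker (Ψ.comp Φ) ≠ ⊥ := by
    apply LinearMap.ker_ne_bot_of_finrank_lt
    simpa using he
  obtain ⟨c, hc, hc0⟩ := Submodule.exists_mem_ne_zero_of_ne_bot hker
  refine ⟨Φ c, ?_, hdeg c, fun g hg => ?_⟩
  · intro h0
    apply hc0
    funext f
    have h1 := congrArg (coeff (mon f)) h0
    rw [hΦ, coeff_sum] at h1
    simpa [coeff_monomial, hmon.eq_iff] using h1
  · ext j
    rw [Polynomial.coeff_zero]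
    rcases lt_or_ge j (3 * e + 1) with hj | hj
    · exact congrFun (LinearMap.mem_ker.1 hc) (⟨g, hg⟩, ⟨j, hj⟩)
    · apply Polynomial.coeff_eq_zero_of_natDegree_lt
      have := natDegree_aeval_le_totalDegree g (hG g hg) (Φ c)
      have := hdeg c
      omega

/-- If the second derivative of `a / b` vanishes then, below the characteristic, `a / b` is
affine. -/
lemma exists_affine_of_second_derivative_eq_zero {K : Type*} [Field K] (a b : Polynomial K)
    (d : ℕ) (ha : a.natDegree ≤ d) (hb : b.natDegree ≤ d)
    (hchar : ∀ m : ℕ, 0 < m → m ≤ d + 1 → (m : K) ≠ 0)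
    (t : K) (ht : b.eval t ≠ 0)
    (hW : a.derivative.derivative * b ^ 2 - a * b.derivative.derivative * b
      - 2 * b * b.derivative * a.derivative + 2 * a * b.derivative ^ 2 = 0) :
    ∃ α δ : K, a = (Polynomial.C α + Polynomial.C δ * Polynomial.X) * b := by
  let T : Polynomial K := Polynomial.X - Polynomial.C t
  have hT : T.derivative = 1 := by simp [T]
  have hTt : T.eval t = 0 := by simp [T]
  set f₀ : K := a.eval t / b.eval t with hf₀
  set f₁ : K := (a.derivative.eval t - f₀ * b.derivative.eval t) / b.eval t with hf₁
  obtain ⟨lam, hlam₀⟩ : ∃ lam : Polynomial K, lam = Polynomial.C f₀ + Polynomial.C f₁ * T :=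
    ⟨_, rfl⟩
  have hlam : lam.derivative = Polynomial.C f₁ := by simp [hlam₀, hT]
  have hlamt : lam.eval t = f₀ := by simp [hlam₀, hTt]
  have hlamd : lam.natDegree ≤ 1 := by
    simp only [hlam₀, T]
    compute_degree
  set c : Polynomial K := a - lam * b with hc
  have hct : c.eval t = 0 := by
    rw [hc, Polynomial.eval_sub, Polynomial.eval_mul, hlamt, hf₀, div_mul_cancel₀ _ ht, sub_self]
  have hct' : c.derivative.eval t = 0 := by
    rw [hc, Polynomial.derivative_sub, Polynomial.derivative_mul, hlam, Polynomial.eval_sub,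
      Polynomial.eval_add, Polynomial.eval_mul, Polynomial.eval_mul, hlamt, Polynomial.eval_C, hf₁,
      div_mul_cancel₀ _ ht]
    ring
  have hWc : c.derivative.derivative * b ^ 2 - c * b.derivative.derivative * b
      - 2 * b * b.derivative * c.derivative + 2 * c * b.derivative ^ 2 = 0 := by
    simp only [hc, Polynomial.derivative_sub, Polynomial.derivative_mul, hlam,
      Polynomial.derivative_add, Polynomial.derivative_C]
    linear_combination hW
  suffices hc0 : c = 0 by
    refine ⟨f₀ - f₁ * t, f₁, ?_⟩
    rw [hc, sub_eq_zero] at hc0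
    rw [hc0]
    simp only [hlam₀, T, map_sub, map_mul]
    ring
  by_contra hc0
  have hcdeg : c.natDegree ≤ d + 1 := by
    refine (Polynomial.natDegree_sub_le _ _).trans (max_le (ha.trans (Nat.le_succ d)) ?_)
    refine Polynomial.natDegree_mul_le.trans ?_
    omega
  obtain ⟨c₁, hc₁, hnd⟩ := Polynomial.exists_eq_pow_rootMultiplicity_mul_and_not_dvd c hc0 t
  set m := c.rootMultiplicity t with hm
  change c = T ^ m * c₁ at hc₁
  change ¬ T ∣ c₁ at hnd
  have hTroot : ∀ f : Polynomial K, T ∣ f ↔ f.eval t = 0 := fun f => Polynomial.dvd_iff_isRoot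
  have hT0 : T ≠ 0 := Polynomial.X_sub_C_ne_zero t
  have hm1 : m ≠ 0 := by
    intro h
    rw [h, pow_zero, one_mul] at hc₁
    exact hnd ((hTroot _).2 (hc₁ ▸ hct))
  have hm2 : m ≠ 1 := by
    intro h
    rw [h, pow_one] at hc₁
    apply hnd
    rw [hTroot]
    rw [hc₁, Polynomial.derivative_mul, hT] at hct'
    simpa [hTt] using hct'
  obtain ⟨n, hn⟩ : ∃ n, m = n + 2 := ⟨m - 2, by omega⟩
  have hmd : m ≤ d + 1 := by
    refine le_trans ?_ hcdeg
    have hc10 : c₁ ≠ 0 := by rintro rfl; simp at hnd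
    rw [hc₁, Polynomial.natDegree_mul (pow_ne_zero _ hT0) hc10, Polynomial.natDegree_pow,
      Polynomial.natDegree_X_sub_C]
    omega
  rw [hn] at hc₁
  have hd1 : c.derivative = T ^ (n + 1) * ((n + 2 : ℕ) * c₁ + T * c₁.derivative) := by
    rw [hc₁, Polynomial.derivative_mul, Polynomial.derivative_pow, hT]
    simp only [map_natCast, mul_one, show n + 2 - 1 = n + 1 from rfl]
    push_cast
    ring
  have hd2 : c.derivative.derivative = T ^ n * (((n + 1 : ℕ) * (n + 2 : ℕ)) * c₁
      + T * (2 * (n + 2 : ℕ) * c₁.derivative + T * c₁.derivative.derivative)) := by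
    rw [hd1, Polynomial.derivative_mul, Polynomial.derivative_pow, hT, Polynomial.derivative_add,
      Polynomial.derivative_mul, Polynomial.derivative_mul, hT, Polynomial.derivative_natCast]
    simp only [map_natCast, Nat.add_sub_cancel, mul_one, zero_mul, zero_add, one_mul]
    push_cast
    ring
  have hdvd : T ∣ (((n + 1 : ℕ) * (n + 2 : ℕ)) * c₁) * b ^ 2 := by
    have h3 : T ^ n * ((((n + 1 : ℕ) * (n + 2 : ℕ)) * c₁) * b ^ 2) =
        T ^ n * (T * (-(2 * (n + 2 : ℕ) * c₁.derivative + T * c₁.derivative.derivative) * b ^ 2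
          + T * c₁ * b.derivative.derivative * b
          + 2 * b * b.derivative * ((n + 2 : ℕ) * c₁ + T * c₁.derivative)
          - 2 * T * c₁ * b.derivative ^ 2)) := by
      rw [hd2, hd1, hc₁] at hWc
      linear_combination hWc
    rw [mul_left_cancel₀ (pow_ne_zero n hT0) h3]
    exact dvd_mul_right _ _
  rw [hTroot] at hdvd hnd
  have h1 : ((n + 1 : ℕ) : K) ≠ 0 := hchar _ (by omega) (by omega)
  have h2 : ((n + 2 : ℕ) : K) ≠ 0 := hchar _ (by omega) (by omega)
  simp only [Polynomial.eval_mul, Polynomial.eval_pow, Polynomial.eval_natCast] at hdvd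
  exact mul_ne_zero (mul_ne_zero (mul_ne_zero h1 h2) hnd) (pow_ne_zero 2 ht) hdvd

/-- The line `X = ξ, Z = u * Y - y`, for `l = (ξ, u, y)`. -/
noncomputable def xLine {K : Type*} [Field K] (l : K × K × K) : Fin 3 → Polynomial K :=
  ![Polynomial.C l.1, Polynomial.X, Polynomial.C l.2.1 * Polynomial.X - Polynomial.C l.2.2]

/-- The line `Y = η, Z = u * X - y`, for `l = (η, u, y)`. -/
noncomputable def yLine {K : Type*} [Field K] (l : K × K × K) : Fin 3 → Polynomial K :=
  ![Polynomial.X, Polynomial.C l.1, Polynomial.C l.2.1 * Polynomial.X - Polynomial.C l.2.2]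

/-- The lines `xLine l` and `yLine l'` intersect. -/
def Meets {K : Type*} [Field K] (l l' : K × K × K) : Prop :=
  l.2.1 * l'.1 - l.2.2 = l'.2.1 * l.1 - l'.2.2

lemma natDegree_xLine_le {K : Type*} [Field K] (l : K × K × K) (i : Fin 3) :
    (xLine l i).natDegree ≤ 1 := by
  fin_cases i
  · simp [xLine]
  · simp [xLine]
  · simp only [xLine, Fin.reduceFinMk, Matrix.cons_val]
    compute_degree

lemma natDegree_yLine_le {K : Type*} [Field K] (l : K × K × K) (i : Fin 3) :
    (yLine l i).natDegree ≤ 1 := by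
  fin_cases i
  · simp [yLine]
  · simp [yLine]
  · simp only [yLine, Fin.reduceFinMk, Matrix.cons_val]
    compute_degree

lemma derivative_aeval_xLine {K : Type*} [Field K] (l : K × K × K) (Q : MvPolynomial (Fin 3) K) :
    Polynomial.derivative (aeval (xLine l) Q) =
      aeval (xLine l) (pderiv 1 Q) + Polynomial.C l.2.1 * aeval (xLine l) (pderiv 2 Q) := by
  have h0 : Polynomial.derivative (xLine l 0) = 0 := by simp [xLine]
  have h1 : Polynomial.derivative (xLine l 1) = 1 := by simp [xLine]
  have h2 : Polynomial.derivative (xLine l 2) = Polynomial.C l.2.1 := by simp [xLine]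
  rw [derivative_aeval_eq_sum, Fin.sum_univ_three, h0, h1, h2]
  ring

lemma derivative_aeval_yLine {K : Type*} [Field K] (l : K × K × K) (Q : MvPolynomial (Fin 3) K) :
    Polynomial.derivative (aeval (yLine l) Q) =
      aeval (yLine l) (pderiv 0 Q) + Polynomial.C l.2.1 * aeval (yLine l) (pderiv 2 Q) := by
  have h0 : Polynomial.derivative (yLine l 0) = 1 := by simp [yLine]
  have h1 : Polynomial.derivative (yLine l 1) = 0 := by simp [yLine]
  have h2 : Polynomial.derivative (yLine l 2) = Polynomial.C l.2.1 := by simp [yLine]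
  rw [derivative_aeval_eq_sum, Fin.sum_univ_three, h0, h1, h2]
  ring

lemma Meets.eval_aeval_eq {K : Type*} [Field K] {l l' : K × K × K} (h : Meets l l')
    (Q : MvPolynomial (Fin 3) K) :
    (aeval (xLine l) Q).eval l'.1 = (aeval (yLine l') Q).eval l.1 := by
  induction Q using MvPolynomial.induction_on with
  | C a => simp
  | add p q hp hq => simp [hp, hq]
  | mul_X p i hp =>
    rw [map_mul, map_mul, aeval_X, aeval_X, Polynomial.eval_mul, Polynomial.eval_mul, hp]
    congr 1
    fin_cases i
    · simp [xLine, yLine]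
    · simp [xLine, yLine]
    · simpa [xLine, yLine, Meets] using h

/-- If every line of two families of lines crosses many lines of the other family, compared to the
degree of a surface containing all of them, then many of the lines crossing a suitable line of the
first family lie on a common quadric. -/
lemma exists_many_lines_on_quadric {K : Type*} [Field K] (L₁ L₂ : Finset (K × K × K)) (e D : ℕ)
    (hcard : (L₁.card + L₂.card) * (3 * e + 1) < (e + 1) ^ 3)
    (hchar : ∀ m : ℕ, 0 < m → m ≤ 3 * e + 1 → (m : K) ≠ 0) (hD : 12 * e < D)
    (h₁ : ∀ l ∈ L₁, D ≤ ((L₂.filter fun l' => Meets l l').image Prod.fst).card)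
    (h₂ : ∀ l' ∈ L₂, D ≤ ((L₁.filter fun l => Meets l l').image Prod.fst).card)
    (hne : L₁.Nonempty) :
    ∃ l ∈ L₁, ∃ α δ : K, ∃ T ⊆ L₂.filter fun l' => Meets l l',
      D ≤ (T.image Prod.fst).card + 3 * e ∧ ∀ l' ∈ T, l'.2.1 = α + δ * l'.1 := by
  let V : MvPolynomial (Fin 3) K → Prop := fun Q =>
    (∀ l ∈ L₁, aeval (xLine l) Q = 0) ∧ ∀ l' ∈ L₂, aeval (yLine l') Q = 0
  obtain ⟨P, hP0, hPd, hPV, hmin⟩ : ∃ P : MvPolynomial (Fin 3) K, P ≠ 0 ∧ P.totalDegree ≤ 3 * e ∧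
      V P ∧ ∀ Q, V Q → Q ≠ 0 → P.totalDegree ≤ Q.totalDegree := by
    obtain ⟨P₀, h0, hd, hv⟩ := exists_ne_zero_vanishing (L₁.image xLine ∪ L₂.image yLine)
      (by
        intro g hg i
        rcases Finset.mem_union.1 hg with hg | hg
        · obtain ⟨l, -, rfl⟩ := Finset.mem_image.1 hg
          exact natDegree_xLine_le l i
        · obtain ⟨l, -, rfl⟩ := Finset.mem_image.1 hg
          exact natDegree_yLine_le l i) e
      (lt_of_le_of_lt (Nat.mul_le_mul_right _ ((Finset.card_union_le _ _).trans
        (add_le_add Finset.card_image_le Finset.card_image_le))) hcard)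
    have hV₀ : V P₀ :=
      ⟨fun l hl => hv _ (Finset.mem_union_left _ (Finset.mem_image_of_mem _ hl)),
        fun l hl => hv _ (Finset.mem_union_right _ (Finset.mem_image_of_mem _ hl))⟩
    obtain ⟨P, ⟨hPV, hP0⟩, hmin⟩ := WellFounded.has_min
      (measure (totalDegree : MvPolynomial (Fin 3) K → ℕ)).wf {Q | V Q ∧ Q ≠ 0} ⟨P₀, hV₀, h0⟩
    have hmin' : ∀ Q, V Q → Q ≠ 0 → P.totalDegree ≤ Q.totalDegree :=
      fun Q hQ hQ0 => not_lt.1 (hmin Q ⟨hQ, hQ0⟩)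
    exact ⟨P, hP0, (hmin' _ hV₀ h0).trans hd, hPV, hmin'⟩
  have zero₁ : ∀ l ∈ L₁, ∀ f : Polynomial K, f.natDegree < D →
      (∀ l' ∈ L₂, Meets l l' → f.eval l'.1 = 0) → f = 0 := by
    intro l hl f hf h
    refine Polynomial.eq_zero_of_natDegree_lt_card_of_eval_eq_zero' f _ ?_
      (lt_of_lt_of_le hf (h₁ l hl))
    intro x hx
    obtain ⟨l', hl', rfl⟩ := Finset.mem_image.1 hx
    exact h l' (Finset.mem_filter.1 hl').1 (Finset.mem_filter.1 hl').2
  have zero₂ : ∀ l' ∈ L₂, ∀ f : Polynomial K, f.natDegree < D →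
      (∀ l ∈ L₁, Meets l l' → f.eval l.1 = 0) → f = 0 := by
    intro l hl f hf h
    refine Polynomial.eq_zero_of_natDegree_lt_card_of_eval_eq_zero' f _ ?_
      (lt_of_lt_of_le hf (h₂ l hl))
    intro x hx
    obtain ⟨l', hl', rfl⟩ := Finset.mem_image.1 hx
    exact h l' (Finset.mem_filter.1 hl').1 (Finset.mem_filter.1 hl').2
  have degx : ∀ l (Q : MvPolynomial (Fin 3) K), Q.totalDegree ≤ 3 * e →
      (aeval (xLine l) Q).natDegree ≤ 3 * e := fun l Q hQ =>
    (natDegree_aeval_le_totalDegree _ (natDegree_xLine_le l) Q).trans hQ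
  have degy : ∀ l (Q : MvPolynomial (Fin 3) K), Q.totalDegree ≤ 3 * e →
      (aeval (yLine l) Q).natDegree ≤ 3 * e := fun l Q hQ =>
    (natDegree_aeval_le_totalDegree _ (natDegree_yLine_le l) Q).trans hQ
  have hd1 : ∀ i, (pderiv i P).totalDegree ≤ 3 * e := fun i => (totalDegree_pderiv_le i P).trans hPd
  have hd2 : ∀ i j, (pderiv i (pderiv j P)).totalDegree ≤ 3 * e := fun i j =>
    (totalDegree_pderiv_le i _).trans (hd1 j)
  have vanish_of_x : ∀ Q : MvPolynomial (Fin 3) K, Q.totalDegree ≤ 3 * e →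
      (∀ l ∈ L₁, aeval (xLine l) Q = 0) → V Q := by
    refine fun Q hQ h => ⟨h, fun l' hl' => zero₂ l' hl' _ (by have := degy l' Q hQ; omega) ?_⟩
    intro l hl hm
    rw [← hm.eval_aeval_eq, h l hl, Polynomial.eval_zero]
  have vanish_of_y : ∀ Q : MvPolynomial (Fin 3) K, Q.totalDegree ≤ 3 * e →
      (∀ l ∈ L₂, aeval (yLine l) Q = 0) → V Q := by
    refine fun Q hQ h => ⟨fun l' hl' => zero₁ l' hl' _ (by have := degx l' Q hQ; omega) ?_, h⟩
    intro l hl hm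
    rw [hm.eval_aeval_eq, h l hl, Polynomial.eval_zero]
  have dx : ∀ l ∈ L₁, aeval (xLine l) (pderiv 1 P)
      + Polynomial.C l.2.1 * aeval (xLine l) (pderiv 2 P) = 0 := by
    intro l hl
    rw [← derivative_aeval_xLine, hPV.1 l hl, Polynomial.derivative_zero]
  have dy : ∀ l ∈ L₂, aeval (yLine l) (pderiv 0 P)
      + Polynomial.C l.2.1 * aeval (yLine l) (pderiv 2 P) = 0 := by
    intro l hl
    rw [← derivative_aeval_yLine, hPV.2 l hl, Polynomial.derivative_zero]
  obtain ⟨l, hl, hb⟩ : ∃ l ∈ L₁, aeval (xLine l) (pderiv 2 P) ≠ 0 := by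
    by_contra! hall
    have hV2 := vanish_of_x _ (hd1 2) hall
    have hV1 : V (pderiv 1 P) := vanish_of_x _ (hd1 1) fun l hl => by
      simpa [hall l hl] using dx l hl
    have hV0 : V (pderiv 0 P) := vanish_of_y _ (hd1 0) fun l hl => by
      simpa [hV2.2 l hl] using dy l hl
    have hpd : ∀ i, V (pderiv i P) → pderiv i P = 0 := by
      intro i hi
      by_contra h
      have h1 := hmin _ hi h
      have h2 := totalDegree_pderiv_add_one_le i P h
      omega
    have hconst := totalDegree_eq_zero_of_pderiv_eq_zero P
      (fun m hm hm' => hchar m hm (by omega)) (fun i => by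
        fin_cases i
        exacts [hpd _ hV0, hpd _ hV1, hpd _ hV2])
    rw [totalDegree_eq_zero_iff_eq_C] at hconst
    obtain ⟨l, hl⟩ := hne
    have h0 := hPV.1 l hl
    rw [hconst, algHom_C, Polynomial.algebraMap_eq, Polynomial.C_eq_zero] at h0
    rw [h0, C_0] at hconst
    exact hP0 hconst
  have dxx : ∀ l ∈ L₁, aeval (xLine l) (pderiv 1 (pderiv 1 P))
      + 2 * Polynomial.C l.2.1 * aeval (xLine l) (pderiv 1 (pderiv 2 P))
      + Polynomial.C l.2.1 ^ 2 * aeval (xLine l) (pderiv 2 (pderiv 2 P)) = 0 := by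
    intro l hl
    have h := congrArg Polynomial.derivative (dx l hl)
    rw [Polynomial.derivative_add, Polynomial.derivative_C_mul, derivative_aeval_xLine,
      derivative_aeval_xLine, pderiv_pderiv_comm 2 1, Polynomial.derivative_zero] at h
    linear_combination h
  have hR : ∀ l' ∈ L₂, aeval (yLine l') (pderiv 1 (pderiv 1 P)) * aeval (yLine l') (pderiv 2 P) ^ 2
      - 2 * aeval (yLine l') (pderiv 1 (pderiv 2 P)) * aeval (yLine l') (pderiv 1 P)
        * aeval (yLine l') (pderiv 2 P)
      + aeval (yLine l') (pderiv 2 (pderiv 2 P)) * aeval (yLine l') (pderiv 1 P) ^ 2 = 0 := by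
    intro l' hl'
    apply zero₂ l' hl'
    · have := degy l' _ (hd2 1 1)
      have := degy l' _ (hd2 1 2)
      have := degy l' _ (hd2 2 2)
      have := degy l' _ (hd1 1)
      have := degy l' _ (hd1 2)
      refine lt_of_le_of_lt ?_ (show 9 * e < D by omega)
      compute_degree
      omega
    · intro l hl hm
      have h1 := congrArg (Polynomial.eval l'.1) (dx l hl)
      have h2 := congrArg (Polynomial.eval l'.1) (dxx l hl)
      simp only [Polynomial.eval_add, Polynomial.eval_sub, Polynomial.eval_mul, Polynomial.eval_pow,
        Polynomial.eval_C, hm.eval_aeval_eq, Polynomial.eval_zero, Polynomial.eval_ofNat] at h1 h2 ⊢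
      set y := Polynomial.eval l.1 (aeval (yLine l') (pderiv 1 P))
      set z := Polynomial.eval l.1 (aeval (yLine l') (pderiv 2 P))
      set yz := Polynomial.eval l.1 (aeval (yLine l') (pderiv 1 (pderiv 2 P)))
      set zz := Polynomial.eval l.1 (aeval (yLine l') (pderiv 2 (pderiv 2 P)))
      linear_combination z ^ 2 * h2 + (-2 * yz * z + zz * (y - l.2.1 * z)) * h1
  set a := aeval (xLine l) (pderiv 0 P) with ha_def
  set b := aeval (xLine l) (pderiv 2 P) with hb_def
  have hadeg : a.natDegree ≤ 3 * e := degx l _ (hd1 0)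
  have hbdeg : b.natDegree ≤ 3 * e := degx l _ (hd1 2)
  set T := L₂.filter (fun l' => Meets l l' ∧ b.eval l'.1 ≠ 0) with hT_def
  have hTsub : T ⊆ L₂.filter fun l' => Meets l l' := fun l' h => by
    rw [hT_def, Finset.mem_filter] at h
    exact Finset.mem_filter.2 ⟨h.1, h.2.1⟩
  have hTcard : D ≤ (T.image Prod.fst).card + 3 * e := by
    have hsub : (L₂.filter fun l' => Meets l l').image Prod.fst
        ⊆ T.image Prod.fst ∪ b.roots.toFinset := by
      intro x hx
      obtain ⟨l', hl', rfl⟩ := Finset.mem_image.1 hx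
      rw [Finset.mem_filter] at hl'
      by_cases h0 : b.eval l'.1 = 0
      · refine Finset.mem_union_right _ ?_
        rw [Multiset.mem_toFinset, Polynomial.mem_roots hb]
        exact h0
      · exact Finset.mem_union_left _ (Finset.mem_image_of_mem _
          (Finset.mem_filter.2 ⟨hl'.1, hl'.2, h0⟩))
    calc D ≤ _ := h₁ l hl
      _ ≤ _ := Finset.card_le_card hsub
      _ ≤ _ := Finset.card_union_le _ _
      _ ≤ _ := Nat.add_le_add_left ((Multiset.toFinset_card_le _).trans
        ((Polynomial.card_roots' b).trans hbdeg)) _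
  have hab : ∀ l' ∈ T, a.eval l'.1 + l'.2.1 * b.eval l'.1 = 0 := by
    intro l' hl'
    rw [hT_def, Finset.mem_filter] at hl'
    have h := congrArg (Polynomial.eval l.1) (dy l' hl'.1)
    rw [Polynomial.eval_add, Polynomial.eval_mul, Polynomial.eval_C, Polynomial.eval_zero,
      ← hl'.2.1.eval_aeval_eq, ← hl'.2.1.eval_aeval_eq] at h
    exact h
  have hW : a.derivative.derivative * b ^ 2 - a * b.derivative.derivative * b
      - 2 * b * b.derivative * a.derivative + 2 * a * b.derivative ^ 2 = 0 := by
    have hTD : 9 * e < (T.image Prod.fst).card := by omega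
    refine Polynomial.eq_zero_of_natDegree_lt_card_of_eval_eq_zero' _ (T.image Prod.fst) ?_
      (lt_of_le_of_lt ?_ hTD)
    · intro x hx
      obtain ⟨l', hl'T, rfl⟩ := Finset.mem_image.1 hx
      have hl' := hl'T
      rw [hT_def, Finset.mem_filter] at hl'
      obtain ⟨hl'2, hm, -⟩ := hl'
      have e1 := hab l' hl'T
      have e2 := congrArg (Polynomial.eval l'.1) (dx l hl)
      have e3 := congrArg (Polynomial.eval l'.1) (dxx l hl)
      have e4 := congrArg (fun f => Polynomial.eval l.1 (Polynomial.derivative f)) (hR l' hl'2)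
      simp only [Polynomial.derivative_add, Polynomial.derivative_sub, Polynomial.derivative_mul,
        pow_two, Polynomial.derivative_ofNat, Polynomial.derivative_C, Polynomial.derivative_zero,
        ha_def, hb_def, derivative_aeval_yLine, derivative_aeval_xLine,
        pderiv_pderiv_comm (1 : Fin 3) 0, pderiv_pderiv_comm (2 : Fin 3) 0,
        pderiv_pderiv_comm (2 : Fin 3) 1,
        Polynomial.eval_add, Polynomial.eval_sub, Polynomial.eval_mul,
        Polynomial.eval_C, hm.eval_aeval_eq, Polynomial.eval_zero, Polynomial.eval_ofNat]
        at e1 e2 e3 e4 ⊢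
      rw [eq_neg_of_add_eq_zero_left e1]
      rw [add_assoc] at e3
      rw [eq_neg_of_add_eq_zero_left e2, eq_neg_of_add_eq_zero_left e3] at e4
      linear_combination e4
    · have h1 := Polynomial.natDegree_derivative_le a
      have h2 := Polynomial.natDegree_derivative_le b
      have h3 := Polynomial.natDegree_derivative_le a.derivative
      have h4 := Polynomial.natDegree_derivative_le b.derivative
      compute_degree
      omega
  obtain ⟨l₀, hl₀⟩ : T.Nonempty := by
    rw [← Finset.image_nonempty (f := Prod.fst), ← Finset.card_pos]
    omega
  obtain ⟨α, δ, hαδ⟩ := exists_affine_of_second_derivative_eq_zero a b (3 * e) hadeg hbdeg hchar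
    l₀.1 (by
      rw [hT_def, Finset.mem_filter] at hl₀
      exact hl₀.2.2) hW
  refine ⟨l, hl, -α, -δ, T, hTsub, hTcard, fun l' hl' => ?_⟩
  have h1 := hab l' hl'
  rw [hT_def, Finset.mem_filter] at hl'
  rw [hαδ] at h1
  simp only [Polynomial.eval_add, Polynomial.eval_mul, Polynomial.eval_C, Polynomial.eval_X] at h1
  refine mul_right_cancel₀ hl'.2.2 ?_
  linear_combination h1

end PolynomialMethod

/-- The incidence relation between triples `(u, b, y)`. -/
def Incident {F : Type*} [Field F] (q q' : F × F × F) : Prop :=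
  q.1 * q'.2.1 - q.2.2 = q'.1 * q.2.1 - q'.2.2

/-- The number of incident pairs of two families of triples. -/
noncomputable def incidences {F : Type*} [Field F] (L₁ L₂ : Finset (F × F × F)) : ℕ :=
  ∑ q ∈ L₁, (L₂.filter fun q' => Incident q q').card

/-- A bipartite graph of large average degree contains a nonempty subgraph of large minimal
degree. -/
lemma exists_subgraph_of_min_degree {α β : Type*} (R : α → β → Prop) (D : ℕ) (S : Finset α)
    (T : Finset β) (h : D * (S.card + T.card) < ∑ s ∈ S, (T.filter fun t => R s t).card) :
    ∃ S' ⊆ S, ∃ T' ⊆ T, S'.Nonempty ∧ (∀ s ∈ S', D ≤ (T'.filter fun t => R s t).card) ∧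
      ∀ t ∈ T', D ≤ (S'.filter fun s => R s t).card := by
  induction hn : S.card + T.card generalizing S T with
  | zero =>
    have : S = ∅ := Finset.card_eq_zero.1 (by omega)
    simp [this] at h
  | succ n ih =>
    by_cases hS : ∃ s ∈ S, (T.filter fun t => R s t).card < D
    · obtain ⟨s, hs, hd⟩ := hS
      have hsum := Finset.add_sum_erase S (fun s => (T.filter fun t => R s t).card) hs
      have hcard := Finset.card_erase_add_one hs
      have hc : (S.erase s).card + T.card = n := by omega
      obtain ⟨S', hS', T', hT', h'⟩ := ih (S.erase s) T (by
        rw [hc]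
        rw [hn] at h
        nlinarith) hc
      exact ⟨S', hS'.trans (Finset.erase_subset _ _), T', hT', h'⟩
    by_cases hT : ∃ t ∈ T, (S.filter fun s => R s t).card < D
    · obtain ⟨t, ht, hd⟩ := hT
      have hsum := Finset.add_sum_erase T (fun t => (S.filter fun s => R s t).card) ht
      have hcard := Finset.card_erase_add_one ht
      have hc : S.card + (T.erase t).card = n := by omega
      have h1 := Finset.sum_card_bipartiteAbove_eq_sum_card_bipartiteBelow R (s := S) (t := T)
      have h2 := Finset.sum_card_bipartiteAbove_eq_sum_card_bipartiteBelow R (s := S)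
        (t := T.erase t)
      simp only [Finset.bipartiteAbove, Finset.bipartiteBelow] at h1 h2
      obtain ⟨S', hS', T', hT', h'⟩ := ih S (T.erase t) (by
        rw [hc]
        rw [hn] at h
        rw [h2]
        rw [h1] at h
        nlinarith) hc
      exact ⟨S', hS', T', hT'.trans (Finset.erase_subset _ _), h'⟩
    push Not at hS hT
    refine ⟨S, subset_rfl, T, subset_rfl, ?_, hS, hT⟩
    by_contra hne
    rw [Finset.not_nonempty_iff_eq_empty] at hne
    simp [hne] at h

lemma incidences_le_of_card_lt {p : ℕ} [Fact p.Prime] (U B : Finset (ZMod p))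
    (L₁ L₂ : Finset (ZMod p × ZMod p × ZMod p))
    (h₂ : ∀ q ∈ L₂, q.1 ∈ U ∧ q.2.1 ∈ B) (e D : ℕ)
    (hcard : (L₁.card + L₂.card) * (3 * e + 1) < (e + 1) ^ 3) (hp : 3 * e + 1 < p)
    (hD : 12 * e < D) (hU : 3 * e + U.card < D) (hB : 3 * e + B.card < D) :
    incidences L₁ L₂ ≤ D * (L₁.card + L₂.card) := by
  by_contra! hlt
  obtain ⟨S, hS, T, hT, hne, hdS, hdT⟩ := exists_subgraph_of_min_degree Incident D L₁ L₂ hlt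
  let K := AlgebraicClosure (ZMod p)
  let i : ZMod p →+* K := algebraMap (ZMod p) K
  have hi : Function.Injective i := i.injective
  obtain ⟨s, hs⟩ : ∃ s : K, ∀ x, i x ≠ s := by
    by_contra! hall
    have : Finite K := Finite.of_surjective i hall
    exact not_finite K
  have hsep : ∀ b u b' u' : ZMod p, i b + s * i u = i b' + s * i u' → b = b' ∧ u = u' := by
    intro b u b' u' h
    have hu : u = u' := by
      by_contra hne
      have h0 : i u - i u' ≠ 0 := sub_ne_zero.2 (hi.ne hne)
      refine hs ((b' - b) / (u - u')) ?_
      rw [map_div₀, map_sub, map_sub, div_eq_iff h0]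
      linear_combination -h
    subst hu
    exact ⟨hi (add_right_cancel h), rfl⟩
  let φ : ZMod p × ZMod p × ZMod p → K × K × K := fun q => (i q.2.1 + s * i q.1, i q.1, i q.2.2)
  have hφ : Function.Injective φ := by
    rintro ⟨u, b, y⟩ ⟨u', b', y'⟩ h
    simp only [φ, Prod.mk.injEq] at h
    obtain ⟨h1, h2, h3⟩ := h
    rw [hi h2, hi h3, (hsep _ _ _ _ h1).1]
  have hmeets : ∀ q q', Meets (φ q) (φ q') ↔ Incident q q' := by
    intro q q'
    simp only [Meets, Incident, φ]
    rw [← hi.eq_iff]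
    simp only [map_sub, map_mul]
    constructor <;> intro h <;> linear_combination h
  have hsymm : ∀ q q' : ZMod p × ZMod p × ZMod p, Incident q q' ↔ Incident q' q :=
    fun q q' => eq_comm
  have hfst : ∀ q q' q'', Incident q q' → Incident q q'' → (φ q').1 = (φ q'').1 → q' = q'' := by
    rintro ⟨u, b, y⟩ ⟨u', b', y'⟩ ⟨u'', b'', y''⟩ h h' h1
    obtain ⟨rfl, rfl⟩ := hsep _ _ _ _ h1
    simp only [Incident] at h h'
    simp only [Prod.mk.injEq, true_and]
    linear_combination h - h'
  have hcard' : ((S.image φ).card + (T.image φ).card) * (3 * e + 1) < (e + 1) ^ 3 := by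
    rw [Finset.card_image_of_injective _ hφ, Finset.card_image_of_injective _ hφ]
    exact lt_of_le_of_lt (Nat.mul_le_mul_right _
      (add_le_add (Finset.card_le_card hS) (Finset.card_le_card hT))) hcard
  have hchar : ∀ m : ℕ, 0 < m → m ≤ 3 * e + 1 → (m : K) ≠ 0 := by
    intro m hm hm' h0
    have : (m : ZMod p) = 0 := hi (by rw [map_natCast, map_zero]; exact h0)
    rw [ZMod.natCast_eq_zero_iff] at this
    have := Nat.le_of_dvd hm this
    omega
  have hdS' : ∀ l ∈ S.image φ,
      D ≤ (((T.image φ).filter fun l' => Meets l l').image Prod.fst).card := by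
    intro l hl
    obtain ⟨q, hq, rfl⟩ := Finset.mem_image.1 hl
    refine (hdS q hq).trans ?_
    refine Finset.card_le_card_of_injOn (fun q' => (φ q').1) (fun q' hq' => ?_) ?_
    · rw [Finset.mem_coe, Finset.mem_filter] at hq'
      exact Finset.mem_coe.2 (Finset.mem_image_of_mem _ (Finset.mem_filter.2
        ⟨Finset.mem_image_of_mem _ hq'.1, (hmeets _ _).2 hq'.2⟩))
    · intro q' hq' q'' hq'' h
      exact hfst q q' q'' (Finset.mem_filter.1 hq').2 (Finset.mem_filter.1 hq'').2 h
  have hdT' : ∀ l' ∈ T.image φ,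
      D ≤ (((S.image φ).filter fun l => Meets l l').image Prod.fst).card := by
    intro l hl
    obtain ⟨q, hq, rfl⟩ := Finset.mem_image.1 hl
    refine (hdT q hq).trans ?_
    refine Finset.card_le_card_of_injOn (fun q' => (φ q').1) (fun q' hq' => ?_) ?_
    · rw [Finset.mem_coe, Finset.mem_filter] at hq'
      exact Finset.mem_coe.2 (Finset.mem_image_of_mem _ (Finset.mem_filter.2
        ⟨Finset.mem_image_of_mem _ hq'.1, (hmeets _ _).2 hq'.2⟩))
    · intro q' hq' q'' hq'' h
      exact hfst q q' q'' ((hsymm _ _).1 (Finset.mem_filter.1 hq').2)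
        ((hsymm _ _).1 (Finset.mem_filter.1 hq'').2) h
  obtain ⟨l, hl, α, δ, T', hT', hD', hquad⟩ := exists_many_lines_on_quadric (S.image φ) (T.image φ)
    e D hcard' hchar hD hdS' hdT' (hne.image φ)
  have hle : (T'.image Prod.fst).card ≤ max U.card B.card := by
    by_cases hδ : δ = 0
    · refine le_trans (Finset.card_le_card (t := B.image fun b => i b + s * α) ?_)
        (Finset.card_image_le.trans (le_max_right _ _))
      intro x hx
      obtain ⟨l', hl', rfl⟩ := Finset.mem_image.1 hx
      obtain ⟨q, hq, rfl⟩ := Finset.mem_image.1 (Finset.mem_filter.1 (hT' hl')).1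
      refine Finset.mem_image.2 ⟨q.2.1, (h₂ q (hT hq)).2, ?_⟩
      have := hquad _ hl'
      rw [hδ, zero_mul, add_zero] at this
      rw [← this]
    · refine le_trans (Finset.card_le_card (t := U.image fun u => (i u - α) / δ) ?_)
        (Finset.card_image_le.trans (le_max_left _ _))
      intro x hx
      obtain ⟨l', hl', rfl⟩ := Finset.mem_image.1 hx
      obtain ⟨q, hq, rfl⟩ := Finset.mem_image.1 (Finset.mem_filter.1 (hT' hl')).1
      refine Finset.mem_image.2 ⟨q.1, (h₂ q (hT hq)).1, ?_⟩
      have := hquad _ hl'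
      rw [div_eq_iff hδ]
      linear_combination this
  have := max_lt hU hB
  omega

/-- A subadditive function of finite sets that is at most `X` on sets of size at most `N`. -/
lemma le_mul_of_subadditive {α : Type*} [DecidableEq α] (f : Finset α → ℕ)
    (hf : ∀ V W, Disjoint V W → f (V ∪ W) ≤ f V + f W) (N X : ℕ) (hN : 0 < N) (L : Finset α)
    (hX : ∀ W ⊆ L, W.card ≤ N → f W ≤ X) : f L ≤ (L.card / N + 1) * X := by
  induction hn : L.card / N generalizing L with
  | zero =>
    rw [Nat.div_eq_zero_iff_lt hN] at hn
    simpa using hX L subset_rfl hn.le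
  | succ n ih =>
    have hNL : N ≤ L.card := by
      by_contra! h
      rw [Nat.div_eq_of_lt h] at hn
      omega
    obtain ⟨W, hWL, hW⟩ := Finset.exists_subset_card_eq hNL
    have hc : (L \ W).card / N = n := by
      have := Nat.div_eq_sub_div hN hNL
      rw [Finset.card_sdiff_of_subset hWL, hW]
      omega
    have h1 := hf W (L \ W) Finset.disjoint_sdiff
    rw [Finset.union_sdiff_of_subset hWL] at h1
    have h2 := hX W hWL hW.le
    have h3 := ih (L \ W) (fun V hV => hX V (hV.trans Finset.sdiff_subset)) hc
    nlinarith

lemma incidences_union_left {F : Type*} [Field F] [DecidableEq F]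
    (V W L : Finset (F × F × F)) (h : Disjoint V W) : incidences (V ∪ W) L = incidences V L + incidences W L :=
  Finset.sum_union h

lemma incidences_union_right {F : Type*} [Field F] [DecidableEq F]
    (L V W : Finset (F × F × F)) (h : Disjoint V W) : incidences L (V ∪ W) = incidences L V + incidences L W := by
  simp only [incidences, ← Finset.sum_add_distrib, Finset.filter_union]
  exact Finset.sum_congr rfl fun q _ =>
    Finset.card_union_of_disjoint (Finset.disjoint_filter_filter h)

lemma incidences_le_card_mul_card {F : Type*} [Field F] (V W : Finset (F × F × F)) :
    incidences V W ≤ V.card * W.card := by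
  rw [← smul_eq_mul]
  exact Finset.sum_le_card_nsmul _ _ _ fun q _ => Finset.card_filter_le _ _

lemma incidences_le_of_card_le {p : ℕ} [Fact p.Prime] (U B : Finset (ZMod p))
    (L₁ L₂ : Finset (ZMod p × ZMod p × ZMod p))
    (h₂ : ∀ q ∈ L₂, q.1 ∈ U ∧ q.2.1 ∈ B) (N : ℕ) (hN : 0 < N) (hNp : 96 * N < p ^ 2)
    (hL₁ : L₁.card ≤ N) (hL₂ : L₂.card ≤ N) :
    incidences L₁ L₂ ≤ (13 * Nat.sqrt (6 * N) + U.card + B.card + 1) * (2 * N) := by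
  have hs1 := Nat.sqrt_le (6 * N)
  have hs2 := Nat.lt_succ_sqrt (6 * N)
  have hs0 : 0 < Nat.sqrt (6 * N) := Nat.sqrt_pos.2 (by omega)
  set e := Nat.sqrt (6 * N)
  simp only [Nat.succ_eq_add_one] at hs2
  have hep : 4 * e < p := by
    refine lt_of_pow_lt_pow_left₀ 2 (Nat.zero_le _) ?_
    nlinarith
  refine (incidences_le_of_card_lt U B L₁ L₂ h₂ e (13 * e + U.card + B.card + 1) ?_ (by omega)
    (by omega) (by omega) (by omega)).trans (Nat.mul_le_mul_left _ (by omega))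
  calc (L₁.card + L₂.card) * (3 * e + 1) ≤ 2 * N * (3 * e + 1) := Nat.mul_le_mul_right _ (by omega)
    _ < 6 * N * (e + 1) := by nlinarith
    _ ≤ (e + 1) * (e + 1) * (e + 1) := Nat.mul_le_mul_right _ hs2.le
    _ = (e + 1) ^ 3 := by ring

lemma incidences_prod_le {p : ℕ} [Fact p.Prime] (U B S : Finset (ZMod p)) (hB : B.Nonempty)
    (hBU : B.card ≤ U.card) (hSU : S.card ≤ U.card) :
    (incidences (U ×ˢ B ×ˢ S) (U ×ˢ B ×ˢ S) : ℝ) ≤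
      21504 * (((U.card : ℝ) * B.card * S.card) ^ 2 / p
        + (U.card : ℝ) * B.card * S.card * (U.card * √(B.card))) := by
  set L := U ×ˢ B ×ˢ S with hLdef
  have hL : ∀ q ∈ L, q.1 ∈ U ∧ q.2.1 ∈ B := by
    intro q hq
    simp only [hLdef, Finset.mem_product] at hq
    exact ⟨hq.1, hq.2.1⟩
  have hLcard : L.card = U.card * B.card * S.card := by
    rw [hLdef, Finset.card_product, Finset.card_product, mul_assoc]
  have hLR : (U.card : ℝ) * B.card * S.card = L.card := by rw [hLcard]; push_cast; ring
  rw [hLR]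
  have hp0 : (0 : ℝ) < p := by exact_mod_cast (Fact.out : p.Prime).pos
  have hUp : U.card ≤ p := (Finset.card_le_univ U).trans_eq (ZMod.card p)
  have hBp : B.card ≤ p := hBU.trans hUp
  set n := L.card with hn
  have hterm1 : (0 : ℝ) ≤ (n : ℝ) ^ 2 / p := by positivity
  have hterm2 : (0 : ℝ) ≤ (n : ℝ) * (U.card * √(B.card)) := by positivity
  by_cases hlarge : 96 * n < p ^ 2
  · rcases Nat.eq_zero_or_pos n with hn0 | hn0
    · have := incidences_le_card_mul_card L L
      rw [← hn, hn0, zero_mul, Nat.le_zero] at this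
      rw [this, Nat.cast_zero]
      positivity
    have h := incidences_le_of_card_le U B L L hL n hn0 hlarge le_rfl le_rfl
    have hs : ((Nat.sqrt (6 * n) : ℕ) : ℝ) ≤ 3 * (U.card * √(B.card)) := by
      refine le_of_sq_le_sq ?_ (by positivity)
      rw [mul_pow, mul_pow, Real.sq_sqrt (by positivity)]
      have h1 : Nat.sqrt (6 * n) ^ 2 ≤ 9 * (U.card ^ 2 * B.card) := by
        refine (Nat.sqrt_le' _).trans ?_
        rw [hLcard]
        have := Nat.mul_le_mul_left (U.card * B.card) hSU
        nlinarith
      have h2 : (((Nat.sqrt (6 * n) ^ 2 : ℕ)) : ℝ) ≤ ((9 * (U.card ^ 2 * B.card) : ℕ) : ℝ) := by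
        exact_mod_cast h1
      push_cast at h2
      linarith
    have hb1 : (1 : ℝ) ≤ √(B.card) := by
      rw [Real.one_le_sqrt]
      exact_mod_cast hB.card_pos
    have hU1 : (1 : ℝ) ≤ U.card := by exact_mod_cast hB.card_pos.trans_le hBU
    have hU2 : (U.card : ℝ) ≤ U.card * √(B.card) := le_mul_of_one_le_right (by positivity) hb1
    have hBU' : (B.card : ℝ) ≤ U.card := by exact_mod_cast hBU
    have hR : (incidences L L : ℝ) ≤
        (13 * ((Nat.sqrt (6 * n) : ℕ) : ℝ) + U.card + B.card + 1) * (2 * n) := by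
      exact_mod_cast h
    calc (incidences L L : ℝ) ≤ _ := hR
      _ ≤ (42 * (U.card * √(B.card))) * (2 * n) := by
        gcongr
        linarith
      _ ≤ _ := by nlinarith
  · rcases lt_or_ge p 14 with hp | hp
    · have h : (incidences L L : ℝ) ≤ (n : ℝ) * n := by
        exact_mod_cast incidences_le_card_mul_card L L
      have h1 : (n : ℝ) * n ≤ 14 * ((n : ℝ) ^ 2 / p) := by
        rw [← mul_div_assoc, le_div_iff₀ hp0]
        have : (p : ℝ) ≤ 14 := by exact_mod_cast hp.le
        nlinarith [sq_nonneg (n : ℝ)]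
      linarith
    · set N := p ^ 2 / 192 with hNdef
      have hN1 : 192 * N ≤ p ^ 2 := Nat.mul_div_le _ _
      have hp2 : 14 * 14 ≤ p ^ 2 := by nlinarith
      have hN0 : 0 < N := by omega
      have hN2 : p ^ 2 ≤ 384 * N := by omega
      have hNn : N ≤ n := by omega
      set X := (13 * Nat.sqrt (6 * N) + U.card + B.card + 1) * (2 * N) with hX
      have hbound : incidences L L ≤ (n / N + 1) * ((n / N + 1) * X) := by
        refine le_mul_of_subadditive (fun V => incidences V L)
          (fun V W h => (incidences_union_left V W L h).le) N _ hN0 L fun V hV hVN => ?_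
        refine le_mul_of_subadditive (fun W => incidences V W)
          (fun W W' h => (incidences_union_right V W W' h).le) N _ hN0 L fun W hW hWN => ?_
        exact incidences_le_of_card_le U B V W (fun q hq => hL q (hW hq)) N hN0 (by omega) hVN hWN
      have hXle : X ≤ 14 * N * p := by
        have h1 := Nat.sqrt_le (6 * N)
        have h2 : 4 * Nat.sqrt (6 * N) < p := by
          refine lt_of_pow_lt_pow_left₀ 2 (Nat.zero_le _) ?_
          nlinarith
        calc X ≤ (7 * p) * (2 * N) := Nat.mul_le_mul_right _ (by omega)
          _ = 14 * N * p := by ring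
      have hNR : (0 : ℝ) < N := by exact_mod_cast hN0
      have hdiv : ((n / N + 1 : ℕ) : ℝ) ≤ 2 * n / N := by
        have h1 : ((n / N : ℕ) : ℝ) ≤ n / N := Nat.cast_div_le
        have h2 : (1 : ℝ) ≤ n / N := by
          rw [one_le_div hNR]
          exact_mod_cast hNn
        push_cast
        rw [mul_div_assoc]
        linarith
      have hXR : (X : ℝ) ≤ 14 * N * p := by exact_mod_cast hXle
      calc (incidences L L : ℝ) ≤ ((n / N + 1 : ℕ) : ℝ) * (((n / N + 1 : ℕ) : ℝ) * X) := by
            exact_mod_cast hbound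
        _ ≤ (2 * n / N) * ((2 * n / N) * (14 * N * p)) := by gcongr
        _ = 56 * n ^ 2 * (p / N) := by field_simp; ring
        _ ≤ 56 * n ^ 2 * (384 / p) := by
          refine mul_le_mul_of_nonneg_left ?_ (by positivity)
          rw [div_le_div_iff₀ hNR hp0]
          have : ((p ^ 2 : ℕ) : ℝ) ≤ ((384 * N : ℕ) : ℝ) := by exact_mod_cast hN2
          push_cast at this
          linarith
        _ = 21504 * ((n : ℝ) ^ 2 / p) := by ring
        _ ≤ _ := by linarith

lemma incidences_eq_card {F : Type*} [Field F] (L₁ L₂ : Finset (F × F × F)) :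
    incidences L₁ L₂ = ((L₁ ×ˢ L₂).filter fun q => Incident q.1 q.2).card := by
  rw [Finset.card_filter, Finset.sum_product]
  exact Finset.sum_congr rfl fun q _ => Finset.card_filter _ _

lemma addEnergy_mul_card_sq_le_incidences {p : ℕ} [Fact p.Prime] (B S : Finset (ZMod p))
    (hB : 0 ∉ B) :
    Finset.addEnergy S S * B.card ^ 2 ≤
      incidences ((B * S) ×ˢ B.image (·⁻¹) ×ˢ S) ((B * S) ×ˢ B.image (·⁻¹) ×ˢ S) := by
  rw [incidences_eq_card, Finset.addEnergy, pow_two, ← Finset.card_product, ← Finset.card_product]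
  have hne : ∀ b ∈ B, b ≠ 0 := fun b hb h => hB (h ▸ hb)
  refine Finset.card_le_card_of_injOn (fun w =>
    ((w.2.1 * w.1.1.1, w.2.2⁻¹, w.1.1.2), (w.2.2 * w.1.2.2, w.2.1⁻¹, w.1.2.1))) ?_ ?_
  · rintro ⟨⟨⟨x, y⟩, y', x'⟩, b, b'⟩ h
    simp only [Finset.coe_product, Set.mem_prod, Finset.mem_coe, Finset.mem_filter,
      Finset.mem_product] at h
    obtain ⟨⟨⟨⟨hx, hy⟩, hy', hx'⟩, heq⟩, hb, hb'⟩ := h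
    refine Finset.mem_coe.2 (Finset.mem_filter.2 ⟨Finset.mk_mem_product
      (Finset.mk_mem_product (Finset.mul_mem_mul hb hx)
        (Finset.mk_mem_product (Finset.mem_image_of_mem _ hb') hy))
      (Finset.mk_mem_product (Finset.mul_mem_mul hb' hx')
        (Finset.mk_mem_product (Finset.mem_image_of_mem _ hb) hy')), ?_⟩)
    simp only [Incident]
    rw [mul_right_comm, mul_inv_cancel₀ (hne b hb), mul_right_comm, mul_inv_cancel₀ (hne b' hb')]
    linear_combination heq
  · rintro ⟨⟨⟨x, y⟩, y', x'⟩, b, b'⟩ h ⟨⟨⟨x₁, y₁⟩, y₁', x₁'⟩, b₁, b₁'⟩ h₁ heq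
    simp only [Finset.coe_product, Set.mem_prod, Finset.mem_coe] at h
    simp only [Prod.mk.injEq, inv_inj] at heq
    obtain ⟨⟨h1, rfl, rfl⟩, h2, rfl, rfl⟩ := heq
    rw [mul_left_cancel₀ (hne _ h.2.1) h1, mul_left_cancel₀ (hne _ h.2.2) h2]

lemma card_le_card_mul_left' {p : ℕ} [Fact p.Prime] (B S : Finset (ZMod p)) {b : ZMod p}
    (hb : b ∈ B) (hb0 : b ≠ 0) : S.card ≤ (B * S).card :=
  Finset.card_le_card_of_injOn (fun x => b * x)
    (fun _ hx => Finset.mul_mem_mul hb hx) (fun _ _ _ _ h => mul_left_cancel₀ hb0 h)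

/-- The additive energy of a set with few products with `B`. -/
lemma addEnergy_le {p : ℕ} [Fact p.Prime] (B S : Finset (ZMod p)) (hBne : B.Nonempty)
    (hB : 0 ∉ B) (hS : 0 ∉ S) :
    (Finset.addEnergy S S : ℝ) ≤ 21504 * (((B * S).card : ℝ) ^ 2 * (S.card : ℝ) ^ 2 / p
        + ((B * S).card : ℝ) ^ 2 * S.card / √(B.card)) := by
  have hp0 : (0 : ℝ) < p := by exact_mod_cast (Fact.out : p.Prime).pos
  rcases S.eq_empty_or_nonempty with rfl | ⟨s, hs⟩
  · simp
  obtain ⟨b, hb⟩ := id hBne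
  have hSU := card_le_card_mul_left' B S hb fun h => hB (h ▸ hb)
  have hBU := card_le_card_mul_left' S B hs fun h => hS (h ▸ hs)
  rw [mul_comm S B] at hBU
  have hcard : (B.image (·⁻¹)).card = B.card := Finset.card_image_of_injective _ inv_injective
  have h1 := incidences_prod_le (B * S) (B.image (·⁻¹)) S (hBne.image _)
    (by rwa [hcard]) hSU
  have h2 : ((Finset.addEnergy S S * B.card ^ 2 : ℕ) : ℝ) ≤ _ :=
    (Nat.cast_le.2 (addEnergy_mul_card_sq_le_incidences B S hB)).trans h1
  rw [hcard] at h2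
  push_cast at h2
  have hb0 : (0 : ℝ) < B.card := by exact_mod_cast Finset.card_pos.2 ⟨b, hb⟩
  have hsq : √(B.card : ℝ) ^ 2 = B.card := Real.sq_sqrt hb0.le
  have hs0 : 0 < √(B.card : ℝ) := Real.sqrt_pos.2 hb0
  rw [← le_div_iff₀ (by positivity)] at h2
  refine h2.trans_eq ?_
  rw [← hsq]
  rw [Real.sqrt_sq hs0.le]
  field_simp

/-- The number of additive quadruples, weighted by a function. -/
noncomputable def weightedEnergy {G : Type*} [AddCommGroup G] [Fintype G] (f : G → ℝ) : ℝ :=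
  ∑ z, (∑ x, f x * f (z - x)) ^ 2

lemma sum_conv_sq {G : Type*} [AddCommGroup G] [Fintype G] (f g : G → ℝ) :
    ∑ z, (∑ x, f x * g (z - x)) ^ 2 =
      ∑ v, (∑ x, f x * f (x + v)) * ∑ y, g y * g (y + v) := by
  have h1 : ∀ z, (∑ x, f x * g (z - x)) ^ 2 =
      ∑ x, ∑ v, f x * g (z - x) * (f (x + v) * g (z - (x + v))) := by
    intro z
    rw [pow_two, Finset.sum_mul_sum]
    exact Finset.sum_congr rfl fun x _ => (Equiv.sum_comp (Equiv.addLeft x)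
      fun x' => f x * g (z - x) * (f x' * g (z - x'))).symm
  calc ∑ z, (∑ x, f x * g (z - x)) ^ 2
      = ∑ x, ∑ v, ∑ z, f x * g (z - x) * (f (x + v) * g (z - (x + v))) := by
        rw [Finset.sum_congr rfl fun z _ => h1 z, Finset.sum_comm]
        exact Finset.sum_congr rfl fun x _ => Finset.sum_comm
    _ = ∑ x, ∑ v, ∑ y, f x * f (x + v) * (g y * g (y + v)) := by
        refine Finset.sum_congr rfl fun x _ => Finset.sum_congr rfl fun v _ => ?_
        rw [← Equiv.sum_comp (Equiv.addRight (x + v))]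
        refine Finset.sum_congr rfl fun y _ => ?_
        have hy : y + (x + v) - x = y + v := by abel
        simp only [Equiv.coe_addRight, add_sub_cancel_right, hy]
        ring
    _ = _ := by
        rw [Finset.sum_comm]
        exact Finset.sum_congr rfl fun v _ => (Finset.sum_mul_sum _ _ _ _).symm

lemma sum_conv_sq_le {G : Type*} [AddCommGroup G] [Fintype G] (f g : G → ℝ) :
    ∑ z, (∑ x, f x * g (z - x)) ^ 2 ≤ (weightedEnergy f + weightedEnergy g) / 2 := by
  rw [weightedEnergy, weightedEnergy, sum_conv_sq, sum_conv_sq, sum_conv_sq,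
    ← Finset.sum_add_distrib, Finset.sum_div]
  refine Finset.sum_le_sum fun v _ => ?_
  nlinarith [sq_nonneg ((∑ x, f x * f (x + v)) - ∑ x, g x * g (x + v))]

lemma weightedEnergy_sum_le {G ι : Type*} [AddCommGroup G] [Fintype G] (s : Finset ι)
    (f : ι → G → ℝ) :
    weightedEnergy (fun x => ∑ i ∈ s, f i x) ≤
      (s.card : ℝ) ^ 3 * ∑ i ∈ s, weightedEnergy (f i) := by
  have h1 : ∀ z, (∑ x, (∑ i ∈ s, f i x) * ∑ j ∈ s, f j (z - x)) ^ 2 ≤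
      (s.card : ℝ) ^ 2 * ∑ q ∈ s ×ˢ s, (∑ x, f q.1 x * f q.2 (z - x)) ^ 2 := by
    intro z
    have h2 : (∑ x, (∑ i ∈ s, f i x) * ∑ j ∈ s, f j (z - x)) =
        ∑ q ∈ s ×ˢ s, ∑ x, f q.1 x * f q.2 (z - x) := by
      rw [Finset.sum_comm]
      refine Finset.sum_congr rfl fun x _ => ?_
      rw [Finset.sum_mul_sum, Finset.sum_product]
    rw [h2]
    refine sq_sum_le_card_mul_sum_sq.trans_eq ?_
    rw [Finset.card_product, Nat.cast_mul, pow_two]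
  calc weightedEnergy (fun x => ∑ i ∈ s, f i x)
      ≤ ∑ z, (s.card : ℝ) ^ 2 * ∑ q ∈ s ×ˢ s, (∑ x, f q.1 x * f q.2 (z - x)) ^ 2 :=
        Finset.sum_le_sum fun z _ => h1 z
    _ = (s.card : ℝ) ^ 2 * ∑ q ∈ s ×ˢ s, ∑ z, (∑ x, f q.1 x * f q.2 (z - x)) ^ 2 := by
        rw [← Finset.mul_sum, Finset.sum_comm]
    _ ≤ (s.card : ℝ) ^ 2 *
        ∑ q ∈ s ×ˢ s, (weightedEnergy (f q.1) + weightedEnergy (f q.2)) / 2 := by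
        gcongr with q hq
        exact sum_conv_sq_le _ _
    _ = _ := by
        rw [← Finset.sum_div, Finset.sum_add_distrib, Finset.sum_product, Finset.sum_product]
        simp only [Finset.sum_const, nsmul_eq_mul, ← Finset.mul_sum]
        ring

/-- The energy of a function bounded by a multiple of the indicator function of a set. -/
lemma weightedEnergy_le_mul_addEnergy {G : Type*} [AddCommGroup G] [Fintype G] [DecidableEq G]
    (f : G → ℝ) (S : Finset G) (c : ℝ) (hf : ∀ x, 0 ≤ f x) (hS : ∀ x ∈ S, f x ≤ c)
    (hS' : ∀ x ∉ S, f x = 0) : weightedEnergy f ≤ c ^ 4 * Finset.addEnergy S S := by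
  rw [Finset.addEnergy_eq_sum_sq, Nat.cast_sum, Finset.mul_sum]
  refine Finset.sum_le_sum fun z _ => ?_
  have h : ∑ x, f x * f (z - x) ≤
      c ^ 2 * ((S ×ˢ S).filter fun xy => xy.1 + xy.2 = z).card := by
    have hcard : ((S ×ˢ S).filter fun xy => xy.1 + xy.2 = z).card =
        (Finset.univ.filter fun x => x ∈ S ∧ z - x ∈ S).card := by
      refine Finset.card_bij' (fun xy _ => xy.1) (fun x _ => (x, z - x)) ?_ ?_ ?_ ?_
      · rintro ⟨x, y⟩ h
        simp only [Finset.mem_filter, Finset.mem_product] at h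
        obtain ⟨⟨hx, hy⟩, rfl⟩ := h
        simp [hx, hy]
      · intro x h
        simp only [Finset.mem_filter, Finset.mem_univ, true_and] at h
        simp [h]
      · rintro ⟨x, y⟩ h
        simp only [Finset.mem_filter, Finset.mem_product] at h
        simp [← h.2]
      · simp
    rw [hcard, ← Finset.sum_filter_add_sum_filter_not Finset.univ
      (fun x => x ∈ S ∧ z - x ∈ S) (fun x => f x * f (z - x))]
    have h0 : ∑ x ∈ Finset.univ.filter (fun x => ¬(x ∈ S ∧ z - x ∈ S)), f x * f (z - x) = 0 := by
      refine Finset.sum_eq_zero fun x hx => ?_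
      rw [Finset.mem_filter, not_and_or] at hx
      rcases hx.2 with h | h
      · rw [hS' x h, zero_mul]
      · rw [hS' _ h, mul_zero]
    rw [h0, add_zero, mul_comm, ← nsmul_eq_mul]
    refine Finset.sum_le_card_nsmul _ _ _ fun x hx => ?_
    rw [Finset.mem_filter] at hx
    rw [pow_two]
    exact mul_le_mul (hS _ hx.2.1) (hS _ hx.2.2) (hf _) ((hf _).trans (hS _ hx.2.1))
  have h0 : 0 ≤ ∑ x, f x * f (z - x) := Finset.sum_nonneg fun x _ => mul_nonneg (hf _) (hf _)
  calc (∑ x, f x * f (z - x)) ^ 2 ≤ _ := pow_le_pow_left₀ h0 h 2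
    _ = _ := by push_cast; ring

/-- The number of representations of an element as an alternating sum. -/
noncomputable def altRep {M : Type*} [AddCommGroup M] (k : ℕ) (A : Finset M) (x : M) : ℕ :=
  ((Fintype.piFinset fun _ : Fin k => A).filter fun a => altSum a = x).card

lemma sum_altRep {M : Type*} [AddCommGroup M] [Fintype M] (k : ℕ) (A : Finset M) :
    ∑ x, altRep k A x = A.card ^ k := by
  have h := Finset.card_eq_sum_card_fiberwise (s := Fintype.piFinset fun _ : Fin k => A)
    (t := (Finset.univ : Finset M)) (f := altSum) fun _ _ => Finset.mem_coe.2 (Finset.mem_univ _)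
  rw [Fintype.card_piFinset_const] at h
  exact h.symm

lemma TaddSet_eq_sum_sq {M : Type*} [AddCommGroup M] [Fintype M] (k : ℕ) (A : Finset M) :
    TaddSet k A = ∑ x, altRep k A x ^ 2 := by
  rw [TaddSet, Finset.card_eq_sum_card_fiberwise (t := (Finset.univ : Finset M))
    (f := fun q => altSum q.1) fun _ _ => Finset.mem_coe.2 (Finset.mem_univ _)]
  refine Finset.sum_congr rfl fun x _ => ?_
  rw [altRep, pow_two, ← Finset.card_product]
  congr 1
  ext q
  simp only [Finset.mem_filter, Finset.mem_product]
  constructor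
  · rintro ⟨⟨⟨h1, h2⟩, h3⟩, rfl⟩
    exact ⟨⟨h1, rfl⟩, h2, h3.symm⟩
  · rintro ⟨⟨h1, rfl⟩, h2, h3⟩
    exact ⟨⟨⟨h1, h2⟩, h3.symm⟩, rfl⟩

lemma altSum_append {M : Type*} [AddCommGroup M] {k l : ℕ} (hk : Even k) (a : Fin k → M)
    (b : Fin l → M) : altSum (Fin.append a b) = altSum a + altSum b := by
  rw [altSum, Fin.sum_univ_add]
  simp only [Fin.append_left, Fin.append_right, Fin.val_castAdd, Fin.val_natAdd]
  have h : ∀ i : ℕ, (k + i) % 2 = i % 2 := fun i => by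
    obtain ⟨c, rfl⟩ := hk
    omega
  simp only [h]
  rfl

lemma altRep_add {M : Type*} [AddCommGroup M] [Fintype M] {k l : ℕ} (hk : Even k) (A : Finset M)
    (z : M) : altRep (k + l) A z = ∑ x, altRep k A x * altRep l A (z - x) := by
  have h1 : altRep (k + l) A z = (((Fintype.piFinset fun _ : Fin k => A) ×ˢ
      Fintype.piFinset fun _ : Fin l => A).filter fun q => altSum q.1 + altSum q.2 = z).card := by
    refine (Finset.card_equiv (Fin.appendEquiv k l) fun q => ?_).symm
    simp only [Finset.mem_filter, Finset.mem_product, Fintype.mem_piFinset, Fin.appendEquiv_apply,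
      Fin.forall_fin_add, Fin.append_left, Fin.append_right]
    change _ ↔ _ ∧ altSum (Fin.append q.1 q.2) = z
    rw [altSum_append hk]
  rw [h1, Finset.card_eq_sum_card_fiberwise (t := (Finset.univ : Finset M))
    (f := fun q => altSum q.1) fun _ _ => Finset.mem_coe.2 (Finset.mem_univ _)]
  refine Finset.sum_congr rfl fun x _ => ?_
  rw [altRep, altRep, ← Finset.card_product]
  congr 1
  ext q
  simp only [Finset.mem_filter, Finset.mem_product]
  constructor
  · rintro ⟨⟨⟨h2, h3⟩, rfl⟩, rfl⟩
    exact ⟨⟨h2, rfl⟩, h3, (add_sub_cancel_left _ _).symm⟩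
  · rintro ⟨⟨h2, rfl⟩, h3, h4⟩
    exact ⟨⟨⟨h2, h3⟩, by rw [h4, add_sub_cancel]⟩, rfl⟩

lemma TaddSet_add_self {M : Type*} [AddCommGroup M] [Fintype M] {k : ℕ} (hk : Even k)
    (A : Finset M) : (TaddSet (k + k) A : ℝ) = weightedEnergy fun x => (altRep k A x : ℝ) := by
  rw [TaddSet_eq_sum_sq, weightedEnergy]
  push_cast
  refine Finset.sum_congr rfl fun z _ => ?_
  rw [altRep_add hk]
  push_cast
  rfl

lemma altRep_succ_le {M : Type*} [AddCommGroup M] (k : ℕ) (A : Finset M) (x : M) :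
    altRep (k + 1) A x ≤ A.card ^ k := by
  rw [← Fintype.card_piFinset_const A k]
  refine Finset.card_le_card_of_injOn Fin.tail (fun a ha => ?_) fun a ha b hb hab => ?_
  · rw [Finset.mem_coe, Finset.mem_filter, Fintype.mem_piFinset] at ha
    exact Finset.mem_coe.2 (Fintype.mem_piFinset.2 fun i => ha.1 _)
  · rw [Finset.mem_coe, Finset.mem_filter] at ha hb
    have h := ha.2.trans hb.2.symm
    have htail : ∀ i : Fin k, a i.succ = b i.succ := fun i => congrFun hab i
    simp only [altSum, Fin.sum_univ_succ, htail, add_left_inj] at h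
    funext i
    refine Fin.cases ?_ htail i
    simpa using h

lemma TaddSet_succ_le {M : Type*} [AddCommGroup M] [Fintype M] (k : ℕ) (A : Finset M) :
    TaddSet (k + 1) A ≤ A.card ^ (2 * k + 1) := by
  rw [TaddSet_eq_sum_sq]
  calc ∑ x, altRep (k + 1) A x ^ 2 ≤ ∑ x, A.card ^ k * altRep (k + 1) A x :=
        Finset.sum_le_sum fun x _ => by
          rw [pow_two]
          exact Nat.mul_le_mul_right _ (altRep_succ_le k A x)
    _ = A.card ^ (2 * k + 1) := by
        rw [← Finset.mul_sum, sum_altRep]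
        ring

lemma altRep_le_of_injective {M N : Type*} [AddCommGroup M] [AddCommGroup N] (k : ℕ)
    (A : Finset M) (C : Finset N) (f : M →+ N) (hf : Function.Injective f)
    (hAC : ∀ a ∈ A, f a ∈ C) (x : M) : altRep k A x ≤ altRep k C (f x) := by
  refine Finset.card_le_card_of_injOn (fun a i => f (a i)) (fun a ha => ?_) fun a _ a' _ h => ?_
  · rw [Finset.mem_coe, Finset.mem_filter, Fintype.mem_piFinset] at ha
    refine Finset.mem_coe.2 (Finset.mem_filter.2
      ⟨Fintype.mem_piFinset.2 fun i => hAC _ (ha.1 i), ?_⟩)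
    rw [← ha.2, altSum, altSum, map_sum]
    refine Finset.sum_congr rfl fun i _ => ?_
    split_ifs <;> simp
  · funext i
    exact hf (congrFun h i)

lemma mul_card_mul_le {p : ℕ} [Fact p.Prime] (k : ℕ) (A B S : Finset (ZMod p)) (hB : 0 ∉ B)
    (c : ℕ) (hS : ∀ x ∈ S, c ≤ altRep k A x) : c * (B * S).card ≤ (A * B).card ^ k := by
  rw [← sum_altRep, mul_comm, ← smul_eq_mul]
  refine (Finset.card_nsmul_le_sum _ (altRep k (A * B)) _ fun y hy => ?_).trans
    (Finset.sum_le_univ_sum_of_nonneg fun _ => Nat.zero_le _)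
  obtain ⟨b, hb, x, hx, rfl⟩ := Finset.mem_mul.1 hy
  refine (hS x hx).trans (altRep_le_of_injective k A (A * B) (AddMonoidHom.mulLeft b)
    (mul_right_injective₀ fun h => hB (h ▸ hb)) (fun a ha => ?_) x)
  rw [AddMonoidHom.coe_mulLeft, mul_comm b a]
  exact Finset.mul_mem_mul ha hb

lemma weightedEnergy_dyadic_le {p : ℕ} [Fact p.Prime] (k : ℕ) (A B S : Finset (ZMod p))
    (hBne : B.Nonempty) (hB : 0 ∉ B) (hS : 0 ∉ S) (c : ℕ) (hc : ∀ x ∈ S, c ≤ altRep k A x)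
    (f : ZMod p → ℝ) (hf : ∀ x, 0 ≤ f x) (hfS : ∀ x ∈ S, f x ≤ 2 * c) (hfS' : ∀ x ∉ S, f x = 0) :
    weightedEnergy f ≤ 344064 * (((A * B).card : ℝ) ^ (2 * k) * (A.card : ℝ) ^ (2 * k) / p
      + ((A * B).card : ℝ) ^ (2 * k) * TaddSet k A / √(B.card)) := by
  have h1 : (c : ℝ) * (B * S).card ≤ ((A * B).card : ℝ) ^ k := by
    exact_mod_cast mul_card_mul_le k A B S hB c hc
  have h2 : (c : ℝ) * S.card ≤ (A.card : ℝ) ^ k := by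
    have : S.card • c ≤ ∑ x, altRep k A x :=
      (Finset.card_nsmul_le_sum _ _ _ hc).trans
        (Finset.sum_le_univ_sum_of_nonneg fun _ => Nat.zero_le _)
    rw [sum_altRep, smul_eq_mul, mul_comm] at this
    exact_mod_cast this
  have h3 : (c : ℝ) ^ 2 * S.card ≤ TaddSet k A := by
    have : S.card • c ^ 2 ≤ ∑ x, altRep k A x ^ 2 :=
      (Finset.card_nsmul_le_sum _ _ _ fun x hx => Nat.pow_le_pow_left (hc x hx) 2).trans
        (Finset.sum_le_univ_sum_of_nonneg fun _ => Nat.zero_le _)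
    rw [← TaddSet_eq_sum_sq, smul_eq_mul, mul_comm] at this
    exact_mod_cast this
  have hp0 : (0 : ℝ) < p := by exact_mod_cast (Fact.out : p.Prime).pos
  calc weightedEnergy f ≤ (2 * c) ^ 4 * Finset.addEnergy S S :=
        weightedEnergy_le_mul_addEnergy f S _ hf hfS hfS'
    _ ≤ (2 * c) ^ 4 * (21504 * (((B * S).card : ℝ) ^ 2 * (S.card : ℝ) ^ 2 / p
        + ((B * S).card : ℝ) ^ 2 * S.card / √(B.card))) := by
        gcongr
        exact addEnergy_le B S hBne hB hS
    _ = 344064 * ((c * (B * S).card : ℝ) ^ 2 * (c * S.card : ℝ) ^ 2 / p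
        + (c * (B * S).card : ℝ) ^ 2 * (c ^ 2 * S.card) / √(B.card)) := by ring
    _ ≤ 344064 * ((((A * B).card : ℝ) ^ k) ^ 2 * ((A.card : ℝ) ^ k) ^ 2 / p
        + (((A * B).card : ℝ) ^ k) ^ 2 * TaddSet k A / √(B.card)) := by gcongr
    _ = _ := by
        rw [← pow_mul, ← pow_mul, mul_comm k 2]

lemma weightedEnergy_singleton_le {p : ℕ} [Fact p.Prime] (k : ℕ) (A B : Finset (ZMod p))
    (hBne : B.Nonempty) (hk : 0 < k) (hA : ∃ a ∈ A, a ≠ 0)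
    (f : ZMod p → ℝ) (hf : ∀ x, 0 ≤ f x) (hfS : f 0 ≤ altRep k A 0) (hfS' : ∀ x ≠ 0, f x = 0)
    (hAB : A.card ≤ (A * B).card) :
    weightedEnergy f ≤ ((A * B).card : ℝ) ^ (2 * k) * TaddSet k A / √(B.card) := by
  have h1 : (altRep k A 0 : ℝ) ^ 2 ≤ TaddSet k A := by
    rw [TaddSet_eq_sum_sq]
    exact_mod_cast Finset.single_le_sum (f := fun x => altRep k A x ^ 2)
      (fun _ _ => Nat.zero_le _) (Finset.mem_univ 0)
  obtain ⟨n, rfl⟩ : ∃ n, k = n + 1 := ⟨k - 1, by omega⟩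
  have h2 : (altRep (n + 1) A 0 : ℝ) ≤ ((A * B).card : ℝ) ^ n := by
    exact_mod_cast (altRep_succ_le n A 0).trans (Nat.pow_le_pow_left hAB n)
  obtain ⟨a, ha, ha0⟩ := hA
  have hBAB : (B.card : ℝ) ≤ (A * B).card := by
    exact_mod_cast card_le_card_mul_left' A B ha ha0
  have hB1 : (1 : ℝ) ≤ B.card := by exact_mod_cast hBne.card_pos
  have hs0 : 0 < √(B.card : ℝ) := Real.sqrt_pos.2 (by linarith)
  have hs : √(B.card : ℝ) ≤ ((A * B).card : ℝ) ^ 2 := by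
    rw [Real.sqrt_le_iff]
    refine ⟨by positivity, hBAB.trans ?_⟩
    rw [← pow_mul]
    exact le_self_pow₀ (hB1.trans hBAB) (by norm_num)
  have h0 := weightedEnergy_le_mul_addEnergy f {0} (altRep (n + 1) A 0) hf (by simpa using hfS)
    (by simpa using hfS')
  have he : Finset.addEnergy ({0} : Finset (ZMod p)) {0} = 1 := by
    simp [Finset.addEnergy, Finset.filter_singleton]
  rw [he, Nat.cast_one, mul_one] at h0
  refine h0.trans ?_
  rw [le_div_iff₀ hs0]
  calc (altRep (n + 1) A 0 : ℝ) ^ 4 * √(B.card : ℝ)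
      = (altRep (n + 1) A 0 : ℝ) ^ 2 * (altRep (n + 1) A 0 : ℝ) ^ 2 * √(B.card : ℝ) := by ring
    _ ≤ (((A * B).card : ℝ) ^ n) ^ 2 * TaddSet (n + 1) A * ((A * B).card : ℝ) ^ 2 := by gcongr
    _ = _ := by ring

lemma TaddSet_add_self_le {p : ℕ} [Fact p.Prime] {k : ℕ} (hk : Even k) (hk0 : 0 < k)
    (A B : Finset (ZMod p)) (hA : ∃ a ∈ A, a ≠ 0) (hBne : B.Nonempty) (hB : 0 ∉ B) :
    (TaddSet (k + k) A : ℝ) ≤ 344064 * ((Nat.log 2 (A.card ^ k) + 2 : ℕ) : ℝ) ^ 4 *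
      (((A * B).card : ℝ) ^ (2 * k) * (A.card : ℝ) ^ (2 * k) / p
      + ((A * B).card : ℝ) ^ (2 * k) * TaddSet k A / √(B.card)) := by
  set r := altRep k A with hr
  set J := Nat.log 2 (A.card ^ k) + 1 with hJ
  set X := ((A * B).card : ℝ) ^ (2 * k) * (A.card : ℝ) ^ (2 * k) / p
      + ((A * B).card : ℝ) ^ (2 * k) * TaddSet k A / √(B.card) with hX
  let col : ZMod p → ℕ := fun x => if x = 0 then J else Nat.log 2 (r x)
  let f : ℕ → ZMod p → ℝ := fun j x => if col x = j then (r x : ℝ) else 0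
  have hlog : ∀ x, Nat.log 2 (r x) < J := by
    intro x
    refine Nat.lt_succ_of_le (Nat.log_mono_right ?_)
    rw [← sum_altRep]
    exact Finset.single_le_sum (f := altRep k A) (fun _ _ => Nat.zero_le _) (Finset.mem_univ x)
  have hcol : ∀ x, col x ∈ Finset.range (J + 1) := by
    intro x
    have := hlog x
    simp only [col, Finset.mem_range]
    split_ifs <;> omega
  have hf0 : ∀ j x, 0 ≤ f j x := by
    intro j x
    simp only [f]
    split_ifs <;> positivity
  have hsum : (fun x => (r x : ℝ)) = fun x => ∑ j ∈ Finset.range (J + 1), f j x := by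
    funext x
    simp only [f, Finset.sum_ite_eq, hcol, if_true]
  have hpiece : ∀ j ∈ Finset.range (J + 1), weightedEnergy (f j) ≤ 344064 * X := by
    intro j hj
    by_cases hjJ : j = J
    · subst hjJ
      obtain ⟨b, hb⟩ := id hBne
      have h := weightedEnergy_singleton_le k A B hBne hk0 hA (f J) (hf0 J) (by simp [f, col, hr])
        (fun x hx => by
          have := hlog x
          simp only [f, col, if_neg hx]
          rw [if_neg (by omega)])
        (by
          rw [mul_comm]
          exact card_le_card_mul_left' B A hb fun h => hB (h ▸ hb))
      have h1 : 0 ≤ ((A * B).card : ℝ) ^ (2 * k) * (A.card : ℝ) ^ (2 * k) / p := by positivity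
      have h2 : 0 ≤ ((A * B).card : ℝ) ^ (2 * k) * TaddSet k A / √(B.card) := by positivity
      rw [hX]
      linarith
    · have hmem : ∀ x, x ∈ (Finset.univ.filter fun x => x ≠ 0 ∧ r x ≠ 0 ∧ Nat.log 2 (r x) = j) ↔
          x ≠ 0 ∧ r x ≠ 0 ∧ Nat.log 2 (r x) = j := by simp
      refine weightedEnergy_dyadic_le k A B
        (Finset.univ.filter fun x => x ≠ 0 ∧ r x ≠ 0 ∧ Nat.log 2 (r x) = j) hBne hB ?_ (2 ^ j) ?_
        (f j) (hf0 j) ?_ ?_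
      · simp
      · intro x hx
        obtain ⟨-, h1, rfl⟩ := (hmem x).1 hx
        exact Nat.pow_log_le_self 2 h1
      · intro x hx
        obtain ⟨h0, h1, rfl⟩ := (hmem x).1 hx
        have := (Nat.lt_pow_succ_log_self (b := 2) (by norm_num) (r x)).le
        simp only [f, col, if_neg h0, if_true]
        rw [pow_succ'] at this
        exact_mod_cast this
      · intro x hx
        rw [hmem] at hx
        simp only [f]
        split_ifs with h
        · by_cases h0 : x = 0
          · simp only [col, if_pos h0] at h
            exact absurd h.symm hjJ
          · simp only [col, if_neg h0] at h
            by_contra h1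
            exact hx ⟨h0, by exact_mod_cast h1, h⟩
        · rfl
  rw [TaddSet_add_self hk, ← hr, hsum]
  calc _ ≤ ((Finset.range (J + 1)).card : ℝ) ^ 3 *
        ∑ j ∈ Finset.range (J + 1), weightedEnergy (f j) := weightedEnergy_sum_le _ _
    _ ≤ ((Finset.range (J + 1)).card : ℝ) ^ 3 * ((Finset.range (J + 1)).card • (344064 * X)) := by
        gcongr
        exact Finset.sum_le_card_nsmul _ _ _ hpiece
    _ = _ := by
        rw [Finset.card_range, nsmul_eq_mul, hJ]
        ring

lemma half_le_log {m : ℕ} (hm : 2 ≤ m) : 1 / 2 ≤ Real.log m := by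
  have h2 : Real.log 2 ≤ Real.log m :=
    Real.log_le_log (by norm_num) (by exact_mod_cast hm)
  linarith [Real.log_two_gt_d9]

lemma log_pow_add_two_le {m : ℕ} (hm : 2 ≤ m) (l : ℕ) :
    ((Nat.log 2 (m ^ l) + 2 : ℕ) : ℝ) ≤ (2 * l + 4) * Real.log m := by
  have hL := half_le_log hm
  have h1 : (Nat.log 2 (m ^ l) : ℝ) * Real.log 2 ≤ l * Real.log m := by
    rw [← Real.log_pow, ← Real.log_pow]
    refine Real.log_le_log (by positivity) ?_
    exact_mod_cast Nat.pow_log_le_self 2 (pow_ne_zero l (by omega))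
  have h2 : (Nat.log 2 (m ^ l) : ℝ) * (1 / 2) ≤ Nat.log 2 (m ^ l) * Real.log 2 := by
    gcongr
    linarith [Real.log_two_gt_d9]
  push_cast
  linarith

lemma TaddSet_two_pow_le (n : ℕ) : ∃ K : ℝ, 0 < K ∧ ∀ M : ℝ, 1 ≤ M → ∀ (p : ℕ) [Fact p.Prime]
    (A B : Finset (ZMod p)), B.Nonempty → 0 ∉ B → 2 ≤ A.card →
    ((A * B).card : ℝ) ≤ M * A.card →
    (TaddSet (2 ^ (n + 1)) A : ℝ) ≤ K * Real.log A.card ^ (4 * n) * M ^ 2 ^ (n + 2) *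
      ((A.card : ℝ) ^ 2 ^ (n + 2) / p
        + (A.card : ℝ) ^ (2 ^ (n + 2) - 1) / √(B.card : ℝ) ^ n) := by
  induction n with
  | zero =>
    refine ⟨1, one_pos, fun M hM p _ A B _ _ _ _ => ?_⟩
    have h : (TaddSet 2 A : ℝ) ≤ (A.card : ℝ) ^ 3 := by exact_mod_cast TaddSet_succ_le 1 A
    have hM4 : 1 ≤ M ^ 4 := one_le_pow₀ hM
    have hp : 0 ≤ (A.card : ℝ) ^ 4 / p := by positivity
    norm_num
    calc (TaddSet 2 A : ℝ) ≤ 1 * ((A.card : ℝ) ^ 4 / p + (A.card : ℝ) ^ 3) := by linarith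
      _ ≤ _ := by gcongr
  | succ n ih =>
    obtain ⟨K, hK, ih⟩ := ih
    obtain ⟨l, hl⟩ : ∃ l, l = 2 ^ (n + 1) := ⟨_, rfl⟩
    have hl0 : 0 < l := by rw [hl]; positivity
    have hle : Even l := by rw [hl, pow_succ]; exact even_two.mul_left _
    refine ⟨344064 * (2 * l + 4) ^ 4 * (2 ^ (4 * n) + K), by positivity, ?_⟩
    intro M hM p _ A B hBne hB hA hAB
    have ih := ih M hM p A B hBne hB hA hAB
    have hA0 : ∃ a ∈ A, a ≠ 0 := by
      by_contra! h
      have := Finset.card_le_card (show A ⊆ {0} from fun a ha => by simpa using h a ha)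
      rw [Finset.card_singleton] at this
      omega
    have h := TaddSet_add_self_le hle hl0 A B hA0 hBne hB
    rw [show 2 ^ (n + 1 + 1) = l + l by rw [hl]; ring,
      show 2 ^ (n + 1 + 2) = 2 * l + 2 * l by rw [hl]; ring]
    rw [← hl, show 2 ^ (n + 2) = 2 * l by rw [hl]; ring] at ih
    set L := Real.log A.card
    have hL : 1 / 2 ≤ L := half_le_log hA
    have hN := log_pow_add_two_le hA l
    set N := ((Nat.log 2 (A.card ^ l) + 2 : ℕ) : ℝ)
    have hs : 1 ≤ √(B.card : ℝ) := by
      rw [Real.one_le_sqrt]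
      exact_mod_cast hBne.card_pos
    set s := √(B.card : ℝ)
    set m := (A.card : ℝ)
    have hm : 0 ≤ m := Nat.cast_nonneg _
    have hL0 : 0 ≤ L := by linarith
    have hM2 : 1 ≤ M ^ (2 * l) := one_le_pow₀ hM
    have hLn : 1 ≤ 2 ^ (4 * n) * L ^ (4 * n) := by
      rw [← mul_pow]
      exact one_le_pow₀ (by linarith)
    have hpow : m ^ (2 * l + 2 * l - 1) = m ^ (2 * l) * m ^ (2 * l - 1) := by
      rw [← pow_add]
      congr 1
      omega
    have hs1 : m ^ (2 * l) / p / s ≤ m ^ (2 * l) / p := div_le_self (by positivity) hs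
    have hP : ((A * B).card : ℝ) ^ (2 * l) ≤ M ^ (2 * l) * m ^ (2 * l) := by
      rw [← mul_pow]
      gcongr
    set U := m ^ (2 * l) * m ^ (2 * l) / p with hU
    set V := m ^ (2 * l) * m ^ (2 * l - 1) / s ^ (n + 1) with hV
    have hU0 : 0 ≤ U := by positivity
    have hV0 : 0 ≤ V := by positivity
    calc (TaddSet (l + l) A : ℝ) ≤ 344064 * N ^ 4 *
          (((A * B).card : ℝ) ^ (2 * l) * m ^ (2 * l) / p
            + ((A * B).card : ℝ) ^ (2 * l) * TaddSet l A / s) := h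
      _ ≤ 344064 * ((2 * l + 4) * L) ^ 4 * ((M ^ (2 * l) * m ^ (2 * l)) * m ^ (2 * l) / p
            + (M ^ (2 * l) * m ^ (2 * l)) * (K * L ^ (4 * n) * M ^ (2 * l) *
              (m ^ (2 * l) / p + m ^ (2 * l - 1) / s ^ n)) / s) := by gcongr
      _ = 344064 * ((2 * l + 4) * L) ^ 4 * M ^ (2 * l) * (1 * 1 * U
            + K * L ^ (4 * n) * M ^ (2 * l) *
              (m ^ (2 * l) * (m ^ (2 * l) / p / s) + V)) := by
          rw [hU, hV]
          field_simp
          ring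
      _ ≤ 344064 * ((2 * l + 4) * L) ^ 4 * M ^ (2 * l) *
            ((2 ^ (4 * n) * L ^ (4 * n)) * M ^ (2 * l) * (U + V)
            + K * L ^ (4 * n) * M ^ (2 * l) * (m ^ (2 * l) * (m ^ (2 * l) / p) + V)) := by
          gcongr
          linarith
      _ = _ := by
          rw [hpow, pow_add m, ← hU, ← hV, hU]
          ring

theorem stmt18 (k : ℕ) (hk : 2 ≤ k) :
    ∃ c K D : ℝ, 0 < c ∧ 0 < K ∧ 0 < D ∧
      ∀ (M : ℝ), 1 ≤ M → ∀ (p : ℕ) [Fact p.Prime] (A B : Finset (ZMod p)),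
        ((A * B).card : ℝ) ≤ M * A.card →
        c * M ^ 2 ^ (k + 1) ≤ (B.card : ℝ) * Real.log A.card ^ D →
        (TaddSet (2 ^ k) A : ℝ) ≤
          K * Real.log A.card ^ D * M ^ 2 ^ (k + 1) *
            ((A.card : ℝ) ^ 2 ^ (k + 1) / p
              + (A.card : ℝ) ^ (2 ^ (k + 1) - 1) * (B.card : ℝ) ^ (-(((k : ℝ) - 1) / 2))) := by
  obtain ⟨n, rfl⟩ : ∃ n, k = n + 1 := ⟨k - 1, by omega⟩
  have hn : 0 < n := by omega
  obtain ⟨K, hK, hT⟩ := TaddSet_two_pow_le n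
  refine ⟨1, 2 ^ (4 * n) + 2 ^ n * K, (4 * n : ℕ), one_pos, by positivity,
    by exact_mod_cast (by omega : 0 < 4 * n), ?_⟩
  intro M hM p _ A B hAB hMB
  rw [Real.rpow_natCast] at hMB ⊢
  have hMpow : 1 ≤ M ^ 2 ^ (n + 1 + 1) := one_le_pow₀ hM
  have hpos : 0 < (B.card : ℝ) * Real.log A.card ^ (4 * n) := by linarith
  have hA : 2 ≤ A.card := by
    by_contra! h
    have hlog : Real.log A.card = 0 := by
      interval_cases A.card <;> simp
    rw [hlog, zero_pow (by omega), mul_zero] at hpos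
    exact hpos.false
  have hB : 0 < B.card := by
    rw [Nat.pos_iff_ne_zero]
    intro h
    rw [h, Nat.cast_zero, zero_mul] at hpos
    exact hpos.false
  have hexp : (B.card : ℝ) ^ (-(((n + 1 : ℕ) - 1 : ℝ) / 2)) = 1 / √(B.card : ℝ) ^ n := by
    rw [Real.rpow_neg (Nat.cast_nonneg _), Real.sqrt_eq_rpow, ← Real.rpow_natCast,
      ← Real.rpow_mul (Nat.cast_nonneg _), one_div]
    congr 2
    push_cast
    ring
  rw [hexp, mul_one_div]
  have hL : 1 / 2 ≤ Real.log A.card := half_le_log hA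
  have hL0 : 0 ≤ Real.log A.card := by linarith
  have hLn : 1 ≤ 2 ^ (4 * n) * Real.log A.card ^ (4 * n) := by
    rw [← mul_pow]
    exact one_le_pow₀ (by linarith)
  set L := Real.log A.card
  obtain hB1 | hB2 := (Nat.succ_le_of_lt hB).eq_or_lt
  · have hT1 : (TaddSet (2 ^ (n + 1)) A : ℝ) ≤ (A.card : ℝ) ^ (2 ^ (n + 1 + 1) - 1) := by
      have h := TaddSet_succ_le (2 ^ (n + 1) - 1) A
      have h0 : 0 < 2 ^ (n + 1) := by positivity
      rw [Nat.sub_add_cancel h0, show 2 * (2 ^ (n + 1) - 1) + 1 = 2 ^ (n + 1 + 1) - 1 by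
        rw [pow_succ 2 (n + 1)]; omega] at h
      exact_mod_cast h
    rw [← hB1]
    simp only [Nat.succ_eq_add_one, zero_add, Nat.cast_one, Real.sqrt_one, one_pow, div_one]
    have hp : 0 ≤ (A.card : ℝ) ^ 2 ^ (n + 1 + 1) / p := by positivity
    have hKL : 0 ≤ 2 ^ n * K * L ^ (4 * n) := by positivity
    calc (TaddSet (2 ^ (n + 1)) A : ℝ) ≤ 1 * 1 * ((A.card : ℝ) ^ 2 ^ (n + 1 + 1) / p
          + (A.card : ℝ) ^ (2 ^ (n + 1 + 1) - 1)) := by linarith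
      _ ≤ _ := by
        gcongr
        linarith
  · have hcard : B.card ≤ (B.erase 0).card + 1 := by
      have := Finset.pred_card_le_card_erase (s := B) (a := 0)
      omega
    have hne : (B.erase 0).Nonempty := by
      rw [← Finset.card_pos]
      omega
    have hsub : ((A * B.erase 0).card : ℝ) ≤ (A * B).card := by
      exact_mod_cast Finset.card_le_card (Finset.mul_subset_mul_left (Finset.erase_subset 0 B))
    refine (hT M hM p A (B.erase 0) hne (Finset.notMem_erase 0 B) hA (hsub.trans hAB)).trans ?_
    have hs0 : 0 < √(B.card : ℝ) := Real.sqrt_pos.2 (by exact_mod_cast hB)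
    have hs : √(B.card : ℝ) / 2 ≤ √((B.erase 0).card : ℝ) := by
      rw [div_le_iff₀ two_pos, Real.sqrt_le_left (by positivity), mul_pow,
        Real.sq_sqrt (Nat.cast_nonneg _)]
      exact_mod_cast (by omega : B.card ≤ (B.erase 0).card * 2 ^ 2)
    have h1 : (1 : ℝ) ≤ 2 ^ n := one_le_pow₀ (by norm_num)
    calc K * L ^ (4 * n) * M ^ 2 ^ (n + 2) * ((A.card : ℝ) ^ 2 ^ (n + 2) / p
          + (A.card : ℝ) ^ (2 ^ (n + 2) - 1) / √((B.erase 0).card : ℝ) ^ n)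
        ≤ K * L ^ (4 * n) * M ^ 2 ^ (n + 2) * (2 ^ n * ((A.card : ℝ) ^ 2 ^ (n + 2) / p)
          + (A.card : ℝ) ^ (2 ^ (n + 2) - 1) / (√(B.card : ℝ) / 2) ^ n) := by
          gcongr
          exact le_mul_of_one_le_left (by positivity) h1
      _ = (0 + 2 ^ n * K) * L ^ (4 * n) * M ^ 2 ^ (n + 2) * ((A.card : ℝ) ^ 2 ^ (n + 2) / p
          + (A.card : ℝ) ^ (2 ^ (n + 2) - 1) / √(B.card : ℝ) ^ n) := by
          rw [div_pow]
          field_simp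
          ring
      _ ≤ _ := by
          gcongr
          positivity
end
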